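/- arXiv:1109.1884 — 5 statements merged into one kernel-verified Lean document; each statement's English description precedes it below -/
import Mathlib

section
/- Assume K has characteristic 0. Let I ⊆ K[x_0, x_1, x_2] be the radical ideal of n ≥ 5 distinct points lying on a smooth conic C in P^2, where n is odd. Then for all integers m ≥ 1 and t ≥ 1 one has I^{(t(m+1))} ⊆ M^t (I^{(m)})^t and I^{(t(m+1)−1)} ⊆ M^{t−1} (I^{(m)})^t. -/
open MvPolynomial

noncomputable section

/-- The ideal generated by all homogeneous forms vanishing at the point with
coordinate vector `p`. -/
def homVanishingIdeal {K σ : Type*} [Field K] (p : σ → K) : Ideal (MvPolynomial σ K) :=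
  Ideal.span {F : MvPolynomial σ K | (∃ d, F.IsHomogeneous d) ∧ MvPolynomial.eval p F = 0}

/-- The `m`-th symbolic power of the radical ideal of the finite set of points
with coordinate vectors `P i`: the intersection of the `m`-th powers of the
ideals of the individual points. -/
def symbPow {K σ ι : Type*} [Field K] (P : ι → σ → K) (m : ℕ) : Ideal (MvPolynomial σ K) :=
  ⨅ i, homVanishingIdeal (P i) ^ m

/-- The irrelevant maximal ideal `M = (x_0, …, x_N)`. -/
def irrel (K σ : Type*) [Field K] : Ideal (MvPolynomial σ K) :=
  Ideal.span (Set.range (MvPolynomial.X : σ → MvPolynomial σ K))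

/-- The coordinate vectors `P i` are nonzero and represent pairwise distinct
points of projective space (no two are proportional). -/
def ProjectivelyDistinct {K σ ι : Type*} [Field K] (P : ι → σ → K) : Prop :=
  (∀ i, P i ≠ 0) ∧ Pairwise fun i j => ∀ c : K, P i ≠ c • P j

/-- `α(J)`: the least degree of a nonzero homogeneous element of `J`. -/
def idealAlpha {K σ : Type*} [Field K] (J : Ideal (MvPolynomial σ K)) : ℕ :=
  sInf {d : ℕ | ∃ F ∈ J, F ≠ 0 ∧ MvPolynomial.IsHomogeneous F d}

theorem MvPolynomial.IsHomogeneous.eval_smul_point {K σ : Type*} [Field K]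
    {F : MvPolynomial σ K} {d : ℕ} (hF : F.IsHomogeneous d) (c : K) (p : σ → K) :
    eval (c • p) F = c ^ d * eval p F := by
  rw [eval_eq, eval_eq, Finset.mul_sum]
  refine Finset.sum_congr rfl fun e he => ?_
  have hd : e.degree = d := by
    have := hF (mem_support_iff.mp he)
    rw [← this, Finsupp.degree_eq_weight_one (R := ℕ)]; rfl
  simp only [Pi.smul_apply, smul_eq_mul, mul_pow, Finset.prod_mul_distrib,
    Finset.prod_pow_eq_pow_sum]
  rw [← hd, Finsupp.degree_apply]
  ring

theorem eval_smul_eq_zero_of_mem {K σ : Type*} [Field K] {p : σ → K} {F : MvPolynomial σ K}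
    (hF : F ∈ homVanishingIdeal p) (c : K) : eval (c • p) F = 0 := by
  have hle : homVanishingIdeal p ≤ RingHom.ker (eval (c • p)) := by
    refine Ideal.span_le.mpr ?_
    rintro G ⟨⟨d, hd⟩, hG⟩
    rw [SetLike.mem_coe, RingHom.mem_ker, hd.eval_smul_point, hG, mul_zero]
  exact hle hF

/-- The linear form `x_i - (x_k / p_k) p_i`, which vanishes at `p`. -/
def pointForm {K σ : Type*} [Field K] (p : σ → K) (k i : σ) : MvPolynomial σ K :=
  X i - C (p i / p k) * X k

theorem pointForm_mem {K σ : Type*} [Field K] {p : σ → K} {k : σ} (hk : p k ≠ 0) (i : σ) :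
    pointForm p k i ∈ homVanishingIdeal p := by
  refine Ideal.subset_span ⟨⟨1, ?_⟩, ?_⟩
  · exact (isHomogeneous_X _ _).sub
      (by simpa using (isHomogeneous_C σ (p i / p k)).mul (isHomogeneous_X K k))
  · simp [pointForm, hk]

/-- The expansion of a polynomial in powers of the forms `pointForm p k i`. -/
def pointExpand {K σ : Type*} [Field K] (p : σ → K) (k : σ) :
    MvPolynomial σ K →ₐ[K] Polynomial (MvPolynomial σ K) :=
  aeval fun i => Polynomial.C (C (p i / p k) * X k) + Polynomial.X * Polynomial.C (pointForm p k i)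

theorem pointExpand_coeff_mem {K σ : Type*} [Field K] {p : σ → K} {k : σ}
    {I : Ideal (MvPolynomial σ K)} (hI : ∀ i, pointForm p k i ∈ I)
    (F : MvPolynomial σ K) (j : ℕ) : (pointExpand p k F).coeff j ∈ I ^ j := by
  suffices h : pointExpand p k F ∈ reesAlgebra I from h j
  induction F using MvPolynomial.induction_on with
  | C a =>
    rw [← algebraMap_eq, AlgHom.commutes, IsScalarTower.algebraMap_apply K (MvPolynomial σ K)]
    exact Subalgebra.algebraMap_mem _ _
  | add f g hf hg => rw [map_add]; exact add_mem hf hg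
  | mul_X f i hf =>
    rw [map_mul]
    refine mul_mem hf ?_
    rw [pointExpand, aeval_X]
    refine add_mem (Subalgebra.algebraMap_mem (reesAlgebra I) _) ?_
    rw [mul_comm, Polynomial.C_mul_X_eq_monomial]
    exact reesAlgebra.monomial_mem.mpr (by simpa using hI i)

theorem pointExpand_eval_one {K σ : Type*} [Field K] (p : σ → K) (k : σ)
    (F : MvPolynomial σ K) : (pointExpand p k F).eval 1 = F := by
  have h : ((Polynomial.aeval (1 : MvPolynomial σ K)).restrictScalars K).comp (pointExpand p k)
      = AlgHom.id K _ := by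
    ext i : 1
    simp [pointExpand, pointForm]
  have := DFunLike.congr_fun h F
  simpa [Polynomial.aeval_def, Polynomial.eval₂_eq_eval_map] using this

theorem mem_pow_of_X_pow_dvd_pointExpand {K σ : Type*} [Field K] {p : σ → K} {k : σ}
    {I : Ideal (MvPolynomial σ K)} (hI : ∀ i, pointForm p k i ∈ I) {m : ℕ}
    {F : MvPolynomial σ K} (h : Polynomial.X ^ m ∣ pointExpand p k F) : F ∈ I ^ m := by
  rw [← pointExpand_eval_one p k F, Polynomial.eval_eq_sum, Polynomial.sum]
  refine Ideal.sum_mem _ fun j _ => ?_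
  rw [one_pow, mul_one]
  rcases lt_or_ge j m with hj | hj
  · rw [Polynomial.X_pow_dvd_iff.mp h j hj]
    exact zero_mem _
  · exact Ideal.pow_le_pow_right hj (pointExpand_coeff_mem hI F j)

theorem eval_pointExpand_coeff_zero {K σ : Type*} [Field K] (p : σ → K) (k : σ)
    (F : MvPolynomial σ K) (v : σ → K) :
    eval v ((pointExpand p k F).coeff 0) = eval ((v k / p k) • p) F := by
  have h : (((aeval v : MvPolynomial σ K →ₐ[K] K).comp
      ((Polynomial.aeval (0 : MvPolynomial σ K)).restrictScalars K)).comp (pointExpand p k))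
      = aeval ((v k / p k) • p) := by
    ext i
    simp [pointExpand]
    ring
  have := DFunLike.congr_fun h F
  rw [Polynomial.coeff_zero_eq_eval_zero]
  simpa [Polynomial.aeval_def, Polynomial.eval₂_eq_eval_map, aeval_eq_eval] using this

theorem X_dvd_pointExpand {K σ : Type*} [Field K] [Infinite K] {p : σ → K} {k : σ}
    {F : MvPolynomial σ K} (hF : ∀ c : K, eval (c • p) F = 0) :
    Polynomial.X ∣ pointExpand p k F := by
  rw [Polynomial.X_dvd_iff]
  refine MvPolynomial.funext fun v => ?_
  rw [eval_pointExpand_coeff_zero, hF, map_zero]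

theorem mem_homVanishingIdeal_pow_iff {K σ : Type*} [Field K] [Infinite K] {p : σ → K} {k : σ}
    (hk : p k ≠ 0) {m : ℕ} {F : MvPolynomial σ K} :
    F ∈ homVanishingIdeal p ^ m ↔ Polynomial.X ^ m ∣ pointExpand p k F := by
  refine ⟨fun hF => ?_, mem_pow_of_X_pow_dvd_pointExpand (pointForm_mem hk)⟩
  have hle : homVanishingIdeal p ≤
      (Ideal.span {Polynomial.X}).comap (pointExpand p k).toRingHom := fun G hG =>
    Ideal.mem_span_singleton.mpr (X_dvd_pointExpand (eval_smul_eq_zero_of_mem hG))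
  have := (Ideal.pow_right_mono hle m).trans (Ideal.le_comap_pow _ m) hF
  rwa [Ideal.span_singleton_pow, Ideal.mem_comap, Ideal.mem_span_singleton] at this

theorem mem_homVanishingIdeal_of_eval {K σ : Type*} [Field K] [Infinite K] {p : σ → K}
    (hp : p ≠ 0) {I : Ideal (MvPolynomial σ K)} (hI : ∀ k i, p k ≠ 0 → pointForm p k i ∈ I)
    {F : MvPolynomial σ K} (hF : ∀ c : K, eval (c • p) F = 0) : F ∈ I := by
  obtain ⟨k, hk⟩ := Function.ne_iff.mp hp
  have := mem_pow_of_X_pow_dvd_pointExpand (m := 1) (fun i => hI k i hk)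
    (by rw [pow_one]; exact X_dvd_pointExpand hF)
  rwa [pow_one] at this

theorem mem_homVanishingIdeal_iff {K σ : Type*} [Field K] [Infinite K] {p : σ → K}
    (hp : p ≠ 0) {F : MvPolynomial σ K} :
    F ∈ homVanishingIdeal p ↔ ∀ c : K, eval (c • p) F = 0 :=
  ⟨fun h c => eval_smul_eq_zero_of_mem h c,
    mem_homVanishingIdeal_of_eval hp fun _ i hk => pointForm_mem hk i⟩

theorem pderiv_mem_of_mem_sq {K σ : Type*} [Field K] {I : Ideal (MvPolynomial σ K)}
    {F : MvPolynomial σ K} (hF : F ∈ I ^ 2) (i : σ) : pderiv i F ∈ I := by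
  rw [pow_two] at hF
  refine Submodule.mul_induction_on hF (fun a ha b hb => ?_) fun a b ha hb => ?_
  · rw [Derivation.leibniz, smul_eq_mul, smul_eq_mul]
    exact add_mem (I.mul_mem_right _ ha) (I.mul_mem_right _ hb)
  · rw [map_add]
    exact add_mem ha hb

/-- Multiplying by a polynomial of order exactly one at `p` raises the order of vanishing at `p`
by at most one. -/
theorem mem_pow_of_mul_mem_pow {K σ : Type*} [Field K] [Infinite K] {p : σ → K} (hp : p ≠ 0)
    {Q B : MvPolynomial σ K} (hQ : Q ∈ homVanishingIdeal p) (hQ2 : Q ∉ homVanishingIdeal p ^ 2)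
    {m : ℕ} (h : Q * B ∈ homVanishingIdeal p ^ (m + 1)) : B ∈ homVanishingIdeal p ^ m := by
  obtain ⟨k, hk⟩ := Function.ne_iff.mp hp
  rw [← pow_one (homVanishingIdeal p), mem_homVanishingIdeal_pow_iff hk, pow_one] at hQ
  rw [mem_homVanishingIdeal_pow_iff hk] at hQ2 h ⊢
  obtain ⟨q, hq⟩ := hQ
  rw [map_mul, hq, pow_succ', mul_assoc, mul_dvd_mul_iff_left Polynomial.X_ne_zero] at h
  refine Polynomial.prime_X.pow_dvd_of_dvd_mul_left m (fun hd => hQ2 ?_) h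
  rw [hq, pow_two]
  exact mul_dvd_mul_left _ hd

theorem mem_pow_of_mul_mem_pow_of_notMem {K σ : Type*} [Field K] [Infinite K] {p : σ → K}
    (hp : p ≠ 0) {Q B : MvPolynomial σ K} (hQ : Q ∉ homVanishingIdeal p)
    {m : ℕ} (h : Q * B ∈ homVanishingIdeal p ^ m) : B ∈ homVanishingIdeal p ^ m := by
  obtain ⟨k, hk⟩ := Function.ne_iff.mp hp
  rw [← pow_one (homVanishingIdeal p), mem_homVanishingIdeal_pow_iff hk, pow_one] at hQ
  rw [mem_homVanishingIdeal_pow_iff hk] at h ⊢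
  rw [map_mul] at h
  exact Polynomial.prime_X.pow_dvd_of_dvd_mul_left m hQ h

/-- The parametrization `(s, t) ↦ (s², st, t²)` of the conic `x_0 x_2 = x_1²`. -/
def veronese (K : Type*) [Field K] : MvPolynomial (Fin 3) K →ₐ[K] MvPolynomial (Fin 2) K :=
  aeval ![X 0 ^ 2, X 0 * X 1, X 1 ^ 2]

/-- The substitution `(s, t) ↦ (-s, -t)`. -/
def signFlip (K : Type*) [Field K] : MvPolynomial (Fin 2) K →ₐ[K] MvPolynomial (Fin 2) K :=
  aeval fun i => -X i

/-- A linear section of `veronese` on the polynomials all of whose terms have even degree. -/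
def veroneseSection (K : Type*) [Field K] :
    MvPolynomial (Fin 2) K →ₗ[K] MvPolynomial (Fin 3) K :=
  (basisMonomials (Fin 2) K).constr K
    fun d => X 0 ^ (d 0 / 2) * X 1 ^ (d 0 % 2) * X 2 ^ (d 1 / 2)

theorem monomial_eq_smul_fin_two {K : Type*} [Field K] (d : Fin 2 →₀ ℕ) (a : K) :
    monomial d a = a • (X 0 ^ d 0 * X 1 ^ d 1 : MvPolynomial (Fin 2) K) := by
  rw [monomial_eq, Finsupp.prod_fintype _ _ (fun i => pow_zero _), Fin.prod_univ_two, smul_eq_C_mul]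

theorem monomial_eq_smul_fin_three {K : Type*} [Field K] (d : Fin 3 →₀ ℕ) (a : K) :
    monomial d a = a • (X 0 ^ d 0 * X 1 ^ d 1 * X 2 ^ d 2 : MvPolynomial (Fin 3) K) := by
  rw [monomial_eq, Finsupp.prod_fintype _ _ (fun i => pow_zero _), Fin.prod_univ_three,
    smul_eq_C_mul]

theorem veroneseSection_X_pow_mul {K : Type*} [Field K] (i j : ℕ) :
    veroneseSection K (X 0 ^ i * X 1 ^ j) = X 0 ^ (i / 2) * X 1 ^ (i % 2) * X 2 ^ (j / 2) := by
  have h : (X 0 ^ i * X 1 ^ j : MvPolynomial (Fin 2) K)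
      = basisMonomials (Fin 2) K (Finsupp.single 0 i + Finsupp.single 1 j) := by
    simp [coe_basisMonomials, monomial_eq_smul_fin_two]
  rw [h, veroneseSection, Module.Basis.constr_basis]
  simp

theorem dvd_sub_veroneseSection {K : Type*} [Field K] (F : MvPolynomial (Fin 3) K) :
    (X 0 * X 2 - X 1 ^ 2 : MvPolynomial (Fin 3) K) ∣ F - veroneseSection K (veronese K F) := by
  induction F using MvPolynomial.induction_on' with
  | monomial d a =>
    rw [monomial_eq_smul_fin_three, map_smul, map_smul, ← smul_sub]
    refine dvd_smul_of_dvd a ?_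
    have h : veronese K (X 0 ^ d 0 * X 1 ^ d 1 * X 2 ^ d 2)
        = X 0 ^ (2 * d 0 + d 1) * X 1 ^ (d 1 + 2 * d 2) := by
      simp [veronese]
      ring
    rw [h, veroneseSection_X_pow_mul]
    have h1 : (2 * d 0 + d 1) / 2 = d 0 + d 1 / 2 := by omega
    have h2 : (2 * d 0 + d 1) % 2 = d 1 % 2 := by omega
    have h3 : (d 1 + 2 * d 2) / 2 = d 1 / 2 + d 2 := by omega
    rw [h1, h2, h3]
    have h4 : (X 1 : MvPolynomial (Fin 3) K) ^ d 1 = X 1 ^ (d 1 % 2) * (X 1 ^ 2) ^ (d 1 / 2) := by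
      rw [← pow_mul, ← pow_add, Nat.mod_add_div]
    rw [h4]
    have h5 :=
      (sub_dvd_pow_sub_pow (X 0 * X 2 : MvPolynomial (Fin 3) K) (X 1 ^ 2) (d 1 / 2)).mul_left
      (- (X 0 ^ d 0 * X 1 ^ (d 1 % 2) * X 2 ^ d 2))
    convert h5 using 1
    ring
  | add p q hp hq =>
    rw [map_add, map_add, add_sub_add_comm]
    exact dvd_add hp hq

theorem dvd_of_veronese_eq_zero {K : Type*} [Field K] {F : MvPolynomial (Fin 3) K}
    (hF : veronese K F = 0) : (X 0 * X 2 - X 1 ^ 2 : MvPolynomial (Fin 3) K) ∣ F := by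
  simpa [hF] using dvd_sub_veroneseSection F

theorem signFlip_of_isHomogeneous {K : Type*} [Field K] [Infinite K]
    {g : MvPolynomial (Fin 2) K} {d : ℕ}
    (hg : g.IsHomogeneous d) : signFlip K g = (-1) ^ d * g := by
  refine MvPolynomial.funext fun v => ?_
  have h : ((aeval v : MvPolynomial (Fin 2) K →ₐ[K] K).comp (signFlip K))
      = aeval ((-1 : K) • v) := by
    ext i
    simp [signFlip]
  have := DFunLike.congr_fun h g
  rw [AlgHom.comp_apply, aeval_eq_eval, aeval_eq_eval] at this
  rw [hg.eval_smul_point] at this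
  simpa using this

theorem veronese_veroneseSection {K : Type*} [Field K] [CharZero K] {g : MvPolynomial (Fin 2) K}
    (hg : signFlip K g = g) : veronese K (veroneseSection K g) = g := by
  have key : ∀ g : MvPolynomial (Fin 2) K,
      veronese K (veroneseSection K (g + signFlip K g)) = g + signFlip K g := by
    intro g
    induction g using MvPolynomial.induction_on' with
    | monomial d a =>
      have h : signFlip K (X 0 ^ d 0 * X 1 ^ d 1)
          = ((-1 : K) ^ (d 0 + d 1)) • (X 0 ^ d 0 * X 1 ^ d 1) := by
        simp only [signFlip, map_mul, map_pow, aeval_X, neg_pow (X _ : MvPolynomial (Fin 2) K),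
          smul_eq_C_mul, C_neg, C_1]
        ring
      rw [monomial_eq_smul_fin_two, map_smul (signFlip K), ← smul_add, h, map_smul, map_smul,
        map_add,
        map_smul, map_add, map_smul, veroneseSection_X_pow_mul]
      congr 1
      rcases Nat.even_or_odd (d 0 + d 1) with he | ho
      · rw [he.neg_one_pow, one_smul, one_smul]
        have h1 : (X 0 : MvPolynomial (Fin 2) K) ^ d 0
            = (X 0 ^ 2) ^ (d 0 / 2) * X 0 ^ (d 0 % 2) := by
          rw [← pow_mul, ← pow_add, Nat.div_add_mod]
        have h2 : (X 1 : MvPolynomial (Fin 2) K) ^ d 1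
            = (X 1 ^ 2) ^ (d 1 / 2) * X 1 ^ (d 0 % 2) := by
          have : d 0 % 2 = d 1 % 2 := by rcases he with ⟨k, hk⟩; omega
          rw [this, ← pow_mul, ← pow_add, Nat.div_add_mod]
        have h3 : veronese K (X 0 ^ (d 0 / 2) * X 1 ^ (d 0 % 2) * X 2 ^ (d 1 / 2))
            = X 0 ^ d 0 * X 1 ^ d 1 := by
          rw [h1, h2]
          simp [veronese]
          ring
        rw [h3]
      · simp [ho.neg_one_pow]
    | add p q hp hq =>
      rw [map_add (signFlip K), add_add_add_comm, map_add (veroneseSection K), map_add, hp, hq]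
  have h := key g
  rw [hg, ← two_smul K g, map_smul, map_smul] at h
  exact smul_right_injective _ (two_ne_zero' K) h

/-- The linear form on the projective line vanishing at `p`. -/
def lineForm {K : Type*} [Field K] (p : Fin 2 → K) : MvPolynomial (Fin 2) K :=
  C (p 1) * X 0 - C (p 0) * X 1

theorem lineForm_isHomogeneous {K : Type*} [Field K] (p : Fin 2 → K) :
    (lineForm p).IsHomogeneous 1 := by
  have h (i j : Fin 2) : (C (p i) * X j : MvPolynomial (Fin 2) K).IsHomogeneous 1 := by
    simpa using (isHomogeneous_C (Fin 2) (p i)).mul (isHomogeneous_X K j)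
  exact (h 1 0).sub (h 0 1)

theorem lineForm_dvd_iff {K : Type*} [Field K] [Infinite K] {p : Fin 2 → K} (hp : p ≠ 0)
    {g : MvPolynomial (Fin 2) K} : lineForm p ∣ g ↔ ∀ c : K, eval (c • p) g = 0 := by
  constructor
  · rintro ⟨h, rfl⟩ c
    simp [lineForm]
    left
    ring
  · intro h
    rw [← Ideal.mem_span_singleton]
    refine mem_homVanishingIdeal_of_eval hp (fun k i hk => ?_) h
    rw [Ideal.mem_span_singleton]
    have hC : C (p k) * C (p k)⁻¹ = (1 : MvPolynomial (Fin 2) K) := by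
      rw [← C_mul, mul_inv_cancel₀ hk, C_1]
    fin_cases k <;> fin_cases i <;> simp only [pointForm, lineForm, div_eq_mul_inv, C_mul,
      Fin.zero_eta, Fin.mk_one, Fin.isValue] at hC ⊢
    · exact ⟨0, by linear_combination - X 0 * hC⟩
    · exact ⟨- C (p 0)⁻¹, by linear_combination - X 1 * hC⟩
    · exact ⟨C (p 1)⁻¹, by linear_combination - X 0 * hC⟩
    · exact ⟨0, by linear_combination - X 1 * hC⟩

theorem lineForm_prime {K : Type*} [Field K] [Infinite K] {p : Fin 2 → K} (hp : p ≠ 0) :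
    Prime (lineForm p) := by
  obtain ⟨k, hk⟩ := Function.ne_iff.mp hp
  have hdvd (g : MvPolynomial (Fin 2) K) : lineForm p ∣ g ↔ (pointExpand p k g).coeff 0 = 0 := by
    rw [lineForm_dvd_iff hp, ← Polynomial.X_dvd_iff, ← pow_one Polynomial.X,
      ← mem_homVanishingIdeal_pow_iff hk, pow_one, mem_homVanishingIdeal_iff hp]
  refine ⟨fun h => ?_, fun h => ?_, fun a b => ?_⟩
  · have h0 := congrArg (eval ![1, 0]) h
    have h1 := congrArg (eval ![0, 1]) h
    simp [lineForm] at h0 h1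
    exact hp (by ext i; fin_cases i <;> simp [h0, h1])
  · simpa using (hdvd 1).mp h.dvd
  · simp only [hdvd, map_mul, Polynomial.mul_coeff_zero, mul_eq_zero]
    exact id

theorem lineForm_isRelPrime {K : Type*} [Field K] [Infinite K] {p q : Fin 2 → K}
    (hq : q ≠ 0) (hpq : ∀ c : K, p ≠ c • q) : IsRelPrime (lineForm q) (lineForm p) := by
  rw [(lineForm_prime hq).irreducible.isRelPrime_iff_not_dvd, lineForm_dvd_iff hq]
  intro h
  have h1 : p 1 * q 0 = p 0 * q 1 := by simpa [lineForm, sub_eq_zero] using h 1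
  obtain ⟨k, hk⟩ := Function.ne_iff.mp hq
  rw [Pi.zero_apply] at hk
  refine hpq (p k / q k) ?_
  ext i
  rw [Pi.smul_apply, smul_eq_mul, div_mul_eq_mul_div, eq_div_iff hk]
  fin_cases k <;> fin_cases i <;> simp <;> grind

theorem exists_quadraticForm_eval {K : Type*} [Field K] {Q : MvPolynomial (Fin 3) K}
    (hQ : Q.IsHomogeneous 2) :
    ∃ q : QuadraticForm K (Fin 3 → K), ∀ v, q v = eval v Q := by
  have hlin : ∀ L ∈ homogeneousSubmodule (Fin 3) K 1,
      ∃ l : (Fin 3 → K) →ₗ[K] K, ∀ v, l v = eval v L := by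
    intro L hL
    rw [homogeneousSubmodule_one_eq_span_X] at hL
    induction hL using Submodule.span_induction with
    | mem x h =>
      obtain ⟨i, rfl⟩ := h
      exact ⟨LinearMap.proj i, fun v => by simp⟩
    | zero => exact ⟨0, fun v => by simp⟩
    | add x y _ _ hx hy =>
      obtain ⟨a, ha⟩ := hx
      obtain ⟨b, hb⟩ := hy
      exact ⟨a + b, fun v => by simp [ha, hb]⟩
    | smul c x _ hx =>
      obtain ⟨a, ha⟩ := hx
      exact ⟨c • a, fun v => by simp [ha]⟩
  rw [← mem_homogeneousSubmodule, ← homogeneousSubmodule_one_pow, pow_two] at hQ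
  refine Submodule.mul_induction_on hQ (fun a ha b hb => ?_) fun a b ha hb => ?_
  · obtain ⟨l, hl⟩ := hlin a ha
    obtain ⟨l', hl'⟩ := hlin b hb
    exact ⟨QuadraticMap.linMulLin l l', fun v => by simp [hl, hl']⟩
  · obtain ⟨q, hq⟩ := ha
    obtain ⟨q', hq'⟩ := hb
    exact ⟨q + q', fun v => by simp [hq, hq']⟩

theorem exists_conic_normal_form {K : Type*} [Field K] [IsAlgClosed K] [CharZero K]
    {Q : MvPolynomial (Fin 3) K} (hQ : Q.IsHomogeneous 2) :
    ∃ N : Matrix (Fin 3) (Fin 3) K, ∀ v,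
      eval v Q = N.mulVec v 0 * N.mulVec v 2 - N.mulVec v 1 ^ 2 := by
  obtain ⟨q, hq⟩ := exists_quadraticForm_eval hQ
  have : Invertible (2 : K) := invertibleOfNonzero two_ne_zero
  have hw := q.equivalent_weightedSumSquares
  rw [Module.finrank_fin_fun] at hw
  obtain ⟨w, ⟨e⟩⟩ := hw
  choose r hr using fun i => IsAlgClosed.exists_pow_nat_eq (w i) (n := 2) two_pos
  obtain ⟨I, hI⟩ := IsAlgClosed.exists_pow_nat_eq (-1 : K) (n := 2) two_pos
  let z (i : Fin 3) : (Fin 3 → K) →ₗ[K] K :=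
    r i • (LinearMap.proj i).comp e.toLinearEquiv.toLinearMap
  have hz (i : Fin 3) (v : Fin 3 → K) : z i v ^ 2 = w i * (e v i * e v i) := by
    have : z i v = r i * e v i := rfl
    rw [this, ← hr]
    ring
  refine ⟨LinearMap.toMatrix' (LinearMap.pi ![z 0 + I • z 1, I • z 2, z 0 - I • z 1]), fun v => ?_⟩
  rw [LinearMap.toMatrix'_mulVec, ← hq, ← e.map_app, QuadraticMap.weightedSumSquares_apply,
    Fin.sum_univ_three]
  have h0 := hz 0 v
  have h1 := hz 1 v
  have h2 := hz 2 v
  simp only [smul_eq_mul, LinearMap.pi_apply, Matrix.cons_val, LinearMap.add_apply,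
    LinearMap.sub_apply, LinearMap.smul_apply]
  linear_combination -h0 - h1 - h2 + (z 1 v ^ 2 + z 2 v ^ 2) * hI

/-- The substitution of the linear forms given by the rows of a matrix. -/
def linSubst {K σ : Type*} [Field K] [Fintype σ] (N : Matrix σ σ K) :
    MvPolynomial σ K →ₐ[K] MvPolynomial σ K :=
  aeval fun i => ∑ j, C (N i j) * X j

theorem eval_linSubst {K σ : Type*} [Field K] [Fintype σ] (N : Matrix σ σ K) (v : σ → K)
    (F : MvPolynomial σ K) : eval v (linSubst N F) = eval (N.mulVec v) F := by
  have h : (aeval v : MvPolynomial σ K →ₐ[K] K).comp (linSubst N) = aeval (N.mulVec v) := by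
    ext i
    simp [linSubst, Matrix.mulVec, dotProduct]
  simpa [aeval_eq_eval] using DFunLike.congr_fun h F

theorem linSubst_linSubst {K σ : Type*} [Field K] [Infinite K] [Fintype σ] [DecidableEq σ]
    {M N : Matrix σ σ K} (h : N * M = 1) (F : MvPolynomial σ K) :
    linSubst M (linSubst N F) = F := by
  refine MvPolynomial.funext fun v => ?_
  rw [eval_linSubst, eval_linSubst, Matrix.mulVec_mulVec, h, Matrix.one_mulVec]

/-- A parametrization of the conic `Q = 0` by binary quadratic forms, together with linear forms
`y 0`, `y 1`, `y 2` that pull back to `s²`, `st`, `t²`. -/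
structure ConicParam {K : Type*} [Field K] (Q : MvPolynomial (Fin 3) K) where
  φ : MvPolynomial (Fin 3) K →ₐ[K] MvPolynomial (Fin 2) K
  y : Fin 3 → MvPolynomial (Fin 3) K
  φ_y0 : φ (y 0) = X 0 ^ 2
  φ_y1 : φ (y 1) = X 0 * X 1
  φ_y2 : φ (y 2) = X 1 ^ 2
  eq_y : Q = y 0 * y 2 - y 1 ^ 2
  dvd_of_φ_eq_zero : ∀ F, φ F = 0 → Q ∣ F
  signFlip_φ : ∀ F, signFlip K (φ F) = φ F
  exists_φ_eq : ∀ g, signFlip K g = g → ∃ F, φ F = g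
  exists_point : ∀ v, eval v Q = 0 →
    ∃ a : Fin 2 → K, ∀ (c : K) F, eval (c • a) (φ F) = eval (c ^ 2 • v) F
  eval_y_ne_zero : ∀ v, v ≠ 0 → eval v Q = 0 → eval v (y 0) ≠ 0 ∨ eval v (y 2) ≠ 0

theorem eval_veronese {K : Type*} [Field K] (a : Fin 2 → K) (F : MvPolynomial (Fin 3) K) :
    eval a (veronese K F) = eval ![a 0 ^ 2, a 0 * a 1, a 1 ^ 2] F := by
  have h : (aeval a : MvPolynomial (Fin 2) K →ₐ[K] K).comp (veronese K)
      = aeval ![a 0 ^ 2, a 0 * a 1, a 1 ^ 2] := by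
    ext i
    fin_cases i <;> simp [veronese]
  simpa [aeval_eq_eval] using DFunLike.congr_fun h F

theorem signFlip_veronese {K : Type*} [Field K] (F : MvPolynomial (Fin 3) K) :
    signFlip K (veronese K F) = veronese K F := by
  have h : (signFlip K).comp (veronese K) = veronese K := by
    ext i : 1
    fin_cases i <;> simp [veronese, signFlip]
  exact DFunLike.congr_fun h F

theorem exists_conicParam {K : Type*} [Field K] [IsAlgClosed K] [CharZero K]
    {Q : MvPolynomial (Fin 3) K} (hQ : Q.IsHomogeneous 2)
    (hsm : ∀ p : Fin 3 → K, p ≠ 0 → eval p Q = 0 → ∃ i, eval p (pderiv i Q) ≠ 0) :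
    Nonempty (ConicParam Q) := by
  obtain ⟨N, hN⟩ := exists_conic_normal_form hQ
  have hQN : Q = linSubst N (X 0 * X 2 - X 1 ^ 2) := by
    refine MvPolynomial.funext fun v => ?_
    rw [eval_linSubst, hN]
    simp
  have hker : ∀ v, N.mulVec v = 0 → v = 0 := by
    intro v hv
    by_contra hv0
    obtain ⟨i, hi⟩ := hsm v hv0 (by simp [hN, hv])
    refine hi ?_
    have hX (j : Fin 3) : eval v (linSubst N (X j)) = 0 := by
      rw [eval_linSubst, hv]
      simp
    rw [hQN]
    simp [Derivation.leibniz, Derivation.leibniz_pow, hX]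
  have hdet : IsUnit N.det := by
    rw [isUnit_iff_ne_zero]
    intro h
    obtain ⟨v, hv0, hv⟩ := Matrix.exists_mulVec_eq_zero_iff.mpr h
    exact hv0 (hker v hv)
  have h1 := linSubst_linSubst (Matrix.mul_nonsing_inv N hdet)
  have h2 := linSubst_linSubst (Matrix.nonsing_inv_mul N hdet)
  refine ⟨⟨(veronese K).comp (linSubst N⁻¹), fun i => linSubst N (X i), ?_, ?_, ?_, ?_, ?_, ?_, ?_,
    ?_, ?_⟩⟩
  · simp [h1, veronese]
  · simp [h1, veronese]
  · simp [h1, veronese]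
  · simp [hQN]
  · intro F hF
    rw [hQN, ← h2 F]
    exact map_dvd _ (dvd_of_veronese_eq_zero hF)
  · intro F
    exact signFlip_veronese _
  · intro g hg
    refine ⟨linSubst N (veroneseSection K g), ?_⟩
    rw [AlgHom.comp_apply, h1, veronese_veroneseSection hg]
  · intro v hvQ
    rw [hN] at hvQ
    obtain ⟨s, hs⟩ := IsAlgClosed.exists_pow_nat_eq (N.mulVec v 0) (n := 2) two_pos
    obtain ⟨t, ht⟩ : ∃ t, t ^ 2 = N.mulVec v 2 ∧ s * t = N.mulVec v 1 := by
      obtain ⟨t, ht⟩ := IsAlgClosed.exists_pow_nat_eq (N.mulVec v 2) (n := 2) two_pos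
      have : (s * t - N.mulVec v 1) * (s * t + N.mulVec v 1) = 0 := by
        linear_combination t ^ 2 * hs + N.mulVec v 0 * ht + hvQ
      rcases mul_eq_zero.mp this with h | h
      · exact ⟨t, ht, by linear_combination h⟩
      · exact ⟨-t, by rw [neg_sq, ht], by linear_combination -h⟩
    refine ⟨![s, t], fun c F => ?_⟩
    rw [AlgHom.comp_apply, eval_veronese, eval_linSubst]
    have : ![(c • ![s, t]) 0 ^ 2, (c • ![s, t]) 0 * (c • ![s, t]) 1, (c • ![s, t]) 1 ^ 2]
        = N.mulVec (c ^ 2 • v) := by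
      rw [Matrix.mulVec_smul]
      ext i
      fin_cases i
      · simp [← hs]; ring
      · simp [← ht.2]; ring
      · simp [← ht.1]; ring
    rw [this, Matrix.mulVec_mulVec, Matrix.nonsing_inv_mul N hdet, Matrix.one_mulVec]
  · intro v hv hvQ
    by_contra! h
    simp only [eval_linSubst, eval_X] at h
    refine hv (hker v ?_)
    rw [hN, h.1] at hvQ
    ext i
    fin_cases i
    · exact h.1
    · simpa using hvQ
    · exact h.2

theorem mem_symbPow_iff {K σ ι : Type*} [Field K] {P : ι → σ → K} {m : ℕ}
    {F : MvPolynomial σ K} : F ∈ symbPow P m ↔ ∀ i, F ∈ homVanishingIdeal (P i) ^ m := by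
  rw [symbPow, Submodule.mem_iInf]

theorem symbPow_mul_le {K σ ι : Type*} [Field K] (P : ι → σ → K) (i j : ℕ) :
    symbPow P i * symbPow P j ≤ symbPow P (i + j) := by
  refine le_iInf fun k => ?_
  rw [pow_add]
  exact Ideal.mul_mono (iInf_le _ k) (iInf_le _ k)

theorem mem_irrel_of_eval_zero {K σ : Type*} [Field K] {F : MvPolynomial σ K}
    (hF : eval 0 F = 0) : F ∈ irrel K σ := by
  have key : ∀ F : MvPolynomial σ K, F - C (eval 0 F) ∈ irrel K σ := by
    intro F
    induction F using MvPolynomial.induction_on with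
    | C a => simp
    | add p q hp hq =>
      rw [map_add, C_add, add_sub_add_comm]
      exact add_mem hp hq
    | mul_X p i _ =>
      have h : p * X i ∈ irrel K σ :=
        Ideal.mul_mem_left _ p (Ideal.subset_span (Set.mem_range_self i))
      simpa using h
  have h := key F
  rwa [hF, C_0, sub_zero] at h

/-- The containments for a filtration `S` whose even terms are the powers of `S 2` and whose odd
terms are `S 1` times the powers of `S 2`. -/
theorem filtration_containment {R : Type*} [CommRing R] {S : ℕ → Ideal R} {M : Ideal R}
    (h0 : S 0 = ⊤) (hmul : ∀ i j, S i * S j ≤ S (i + j)) (heven : ∀ k, S (2 * k) ≤ S 2 ^ k)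
    (hodd : ∀ k, S (2 * k + 1) ≤ S 1 * S 2 ^ k) (h1 : S 1 ≤ M) (h2 : S 2 ≤ M * S 1)
    (m v : ℕ) : S (m + v + 1) ≤ M * S m * S v := by
  have heven' : ∀ k, S 2 ^ k ≤ S (2 * k) := by
    intro k
    induction k with
    | zero => simp [h0]
    | succ k ih =>
      rw [pow_succ]
      exact (Ideal.mul_mono_left ih).trans (hmul _ _)
  have hodd' : ∀ k, S 1 * S 2 ^ k ≤ S (2 * k + 1) := by
    intro k
    rw [mul_comm]
    exact (Ideal.mul_mono_left (heven' k)).trans (hmul _ _)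
  obtain ⟨i, rfl | rfl⟩ := m.even_or_odd' <;> obtain ⟨j, rfl | rfl⟩ := v.even_or_odd'
  · calc S (2 * i + 2 * j + 1) = S (2 * (i + j) + 1) := by congr 1; ring
      _ ≤ S 1 * S 2 ^ (i + j) := hodd _
      _ ≤ M * S 2 ^ (i + j) := Ideal.mul_mono_left h1
      _ = M * S 2 ^ i * S 2 ^ j := by ring
      _ ≤ _ := Ideal.mul_mono (Ideal.mul_mono_right (heven' i)) (heven' j)
  · calc S (2 * i + (2 * j + 1) + 1) = S (2 * (i + j + 1)) := by congr 1; ring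
      _ ≤ S 2 ^ (i + j + 1) := heven _
      _ = S 2 * S 2 ^ (i + j) := by ring
      _ ≤ M * S 1 * S 2 ^ (i + j) := Ideal.mul_mono_left h2
      _ = M * S 2 ^ i * (S 1 * S 2 ^ j) := by ring
      _ ≤ _ := Ideal.mul_mono (Ideal.mul_mono_right (heven' i)) (hodd' j)
  · calc S (2 * i + 1 + 2 * j + 1) = S (2 * (i + j + 1)) := by congr 1; ring
      _ ≤ S 2 ^ (i + j + 1) := heven _
      _ = S 2 * S 2 ^ (i + j) := by ring
      _ ≤ M * S 1 * S 2 ^ (i + j) := Ideal.mul_mono_left h2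
      _ = M * (S 1 * S 2 ^ i) * S 2 ^ j := by ring
      _ ≤ _ := Ideal.mul_mono (Ideal.mul_mono_right (hodd' i)) (heven' j)
  · calc S (2 * i + 1 + (2 * j + 1) + 1) = S (2 * (i + j + 1) + 1) := by congr 1; ring
      _ ≤ S 1 * S 2 ^ (i + j + 1) := hodd _
      _ = S 1 * (S 2 * S 2 ^ (i + j)) := by ring
      _ ≤ S 1 * (M * S 1 * S 2 ^ (i + j)) := Ideal.mul_mono_right (Ideal.mul_mono_left h2)
      _ = M * (S 1 * S 2 ^ i) * (S 1 * S 2 ^ j) := by ring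
      _ ≤ _ := Ideal.mul_mono (Ideal.mul_mono_right (hodd' i)) (hodd' j)

theorem filtration_containment_pow {R : Type*} [CommRing R] {S : ℕ → Ideal R} {M : Ideal R}
    (h : ∀ m v, S (m + v + 1) ≤ M * S m * S v) (m t : ℕ) :
    S (t * (m + 1)) ≤ M ^ t * S m ^ t ∧ S ((t + 1) * (m + 1) - 1) ≤ M ^ t * S m ^ (t + 1) := by
  induction t with
  | zero => simp
  | succ t ih =>
    constructor
    · calc S ((t + 1) * (m + 1)) = S (m + t * (m + 1) + 1) := by congr 1; ring
        _ ≤ M * S m * S (t * (m + 1)) := h _ _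
        _ ≤ M * S m * (M ^ t * S m ^ t) := Ideal.mul_mono_right ih.1
        _ = M ^ (t + 1) * S m ^ (t + 1) := by ring
    · calc S ((t + 1 + 1) * (m + 1) - 1) = S (m + ((t + 1) * (m + 1) - 1) + 1) := by
            congr 1
            have : 1 ≤ (t + 1) * (m + 1) := Nat.mul_pos t.succ_pos m.succ_pos
            rw [add_mul (t + 1) 1]
            omega
        _ ≤ M * S m * S ((t + 1) * (m + 1) - 1) := h _ _
        _ ≤ M * S m * (M ^ t * S m ^ (t + 1)) := Ideal.mul_mono_right ih.2
        _ = M ^ (t + 1) * S m ^ (t + 1 + 1) := by ring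

theorem pderiv_pderiv_comm {K σ : Type*} [Field K] (i j : σ) (F : MvPolynomial σ K) :
    pderiv i (pderiv j F) = pderiv j (pderiv i F) := by
  classical
  have h : ⁅(pderiv i : Derivation K (MvPolynomial σ K) _), pderiv j⁆ = 0 :=
    derivation_ext fun k => by
      rw [Derivation.commutator_apply, pderiv_X, pderiv_X, Pi.single_apply, Pi.single_apply]
      split_ifs <;> simp
  have := congrArg (fun D : Derivation K (MvPolynomial σ K) _ => D F) h
  exact sub_eq_zero.mp this

/-- The Euler relations for a binary form and for its first partial derivatives. -/
theorem exists_euler_relations {K : Type*} [Field K] {f : MvPolynomial (Fin 2) K} {N : ℕ}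
    (hf : f.IsHomogeneous (N + 1)) : ∃ p q a b d : MvPolynomial (Fin 2) K,
      p.IsHomogeneous N ∧ q.IsHomogeneous N ∧ a.IsHomogeneous (N - 1) ∧
      b.IsHomogeneous (N - 1) ∧ d.IsHomogeneous (N - 1) ∧
      X 0 * p + X 1 * q = ((N : MvPolynomial (Fin 2) K) + 1) * f ∧
      X 0 * a + X 1 * b = (N : MvPolynomial (Fin 2) K) * p ∧
      X 0 * b + X 1 * d = (N : MvPolynomial (Fin 2) K) * q := by
  have hp : (pderiv 0 f).IsHomogeneous N := hf.pderiv
  have hq : (pderiv 1 f).IsHomogeneous N := hf.pderiv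
  have E0 := hf.sum_X_mul_pderiv
  have E1 := hp.sum_X_mul_pderiv
  have E2 := hq.sum_X_mul_pderiv
  rw [Fin.sum_univ_two, nsmul_eq_mul] at E0 E1 E2
  rw [pderiv_pderiv_comm] at E2
  rw [Nat.cast_add_one] at E0
  exact ⟨_, _, _, _, _, hp, hq, hp.pderiv, hp.pderiv, hq.pderiv, E0, E1, E2⟩

theorem ConicParam.φ_conic {K : Type*} [Field K] {Q : MvPolynomial (Fin 3) K} (c : ConicParam Q) :
    c.φ Q = 0 := by
  refine (congrArg c.φ c.eq_y).trans ?_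
  rw [map_sub, map_mul, map_pow, c.φ_y0, c.φ_y1, c.φ_y2]
  ring

/-- Binary preimages of the points `P i` under a parametrization of a conic through them. -/
structure PointParam {K ι : Type*} [Field K] {Q : MvPolynomial (Fin 3) K} (c : ConicParam Q)
    (P : ι → Fin 3 → K) where
  a : ι → Fin 2 → K
  eval_φ : ∀ i (r : K) F, eval (r • a i) (c.φ F) = eval (r ^ 2 • P i) F
  a_ne_zero : ∀ i, a i ≠ 0
  a_distinct : Pairwise fun i j => ∀ r : K, a i ≠ r • a j

theorem exists_pointParam {K ι : Type*} [Field K] {Q : MvPolynomial (Fin 3) K} (c : ConicParam Q)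
    {P : ι → Fin 3 → K} (hP : ProjectivelyDistinct P) (honC : ∀ i, eval (P i) Q = 0) :
    Nonempty (PointParam c P) := by
  choose a ha using fun i => c.exists_point (P i) (honC i)
  refine ⟨⟨a, ha, fun i h => hP.1 i ?_, fun i j hij r h => hP.2 hij (r ^ 2) ?_⟩⟩
  · ext k
    have h1 := ha i 1 (X k)
    have h2 := ha i 0 (X k)
    rw [h, smul_zero] at h1 h2
    simpa using h1.symm.trans h2
  · ext k
    have h1 := ha i 1 (X k)
    have h2 := ha j r (X k)
    rw [one_smul, h] at h1
    simpa using h1.symm.trans h2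

namespace PointParam

variable {K ι : Type*} [Field K] {Q : MvPolynomial (Fin 3) K} {c : ConicParam Q}
  {P : ι → Fin 3 → K}

theorem eval_zero_φ [Nonempty ι] (s : PointParam c P) (F : MvPolynomial (Fin 3) K) :
    eval 0 (c.φ F) = eval 0 F := by
  simpa using s.eval_φ (Classical.arbitrary ι) 0 F

variable [Fintype ι]

/-- The binary form cutting out the points. -/
def f (s : PointParam c P) : MvPolynomial (Fin 2) K := ∏ i, lineForm (s.a i)

theorem isHomogeneous_f (s : PointParam c P) : s.f.IsHomogeneous (Fintype.card ι) := by
  simpa [f] using IsHomogeneous.prod Finset.univ (fun i => lineForm (s.a i)) (fun _ => 1)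
    fun i _ => lineForm_isHomogeneous _

theorem f_ne_zero [Infinite K] (s : PointParam c P) : s.f ≠ 0 :=
  Finset.prod_ne_zero_iff.mpr fun i _ => (lineForm_prime (s.a_ne_zero i)).ne_zero

theorem f_pow_dvd_φ [Infinite K] (s : PointParam c P) {m : ℕ} {F : MvPolynomial (Fin 3) K}
    (hF : F ∈ symbPow P m) : s.f ^ m ∣ c.φ F := by
  rw [f, ← Finset.prod_pow]
  refine Finset.prod_dvd_of_isRelPrime (fun i _ j _ hij => ?_) fun i _ => ?_
  · exact (lineForm_isRelPrime (s.a_ne_zero i) (s.a_distinct hij.symm)).pow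
  · have hle : homVanishingIdeal (P i) ≤
        (Ideal.span {lineForm (s.a i)}).comap c.φ.toRingHom := fun G hG => by
      refine Ideal.mem_span_singleton.mpr ((lineForm_dvd_iff (s.a_ne_zero i)).mpr fun r => ?_)
      exact (s.eval_φ i r G).trans (eval_smul_eq_zero_of_mem hG _)
    have := (Ideal.pow_right_mono hle m).trans (Ideal.le_comap_pow _ m) (mem_symbPow_iff.mp hF i)
    rwa [Ideal.span_singleton_pow, Ideal.mem_comap, Ideal.mem_span_singleton] at this

theorem mem_symbPow_one_of_dvd [IsAlgClosed K] (hP : ∀ i, P i ≠ 0) (s : PointParam c P)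
    {F : MvPolynomial (Fin 3) K} (hF : s.f ∣ c.φ F) : F ∈ symbPow P 1 := by
  have : Infinite K := IsAlgClosed.instInfinite
  refine mem_symbPow_iff.mpr fun i => ?_
  rw [pow_one, mem_homVanishingIdeal_iff (hP i)]
  intro r
  obtain ⟨u, rfl⟩ := IsAlgClosed.exists_pow_nat_eq r (n := 2) two_pos
  rw [← s.eval_φ]
  have hf : lineForm (s.a i) ∣ s.f := Finset.dvd_prod_of_mem _ (Finset.mem_univ i)
  exact (lineForm_dvd_iff (s.a_ne_zero i)).mp (hf.trans hF) u

theorem conic_mem_symbPow_one [IsAlgClosed K] (hP : ∀ i, P i ≠ 0) (s : PointParam c P) :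
    Q ∈ symbPow P 1 :=
  s.mem_symbPow_one_of_dvd hP (by rw [c.φ_conic]; exact dvd_zero _)

/-- A form in the second symbolic power that restricts to the conic as twice the divisor of the
points. -/
theorem exists_double_form [IsAlgClosed K] [CharZero K] (hP : ∀ i, P i ≠ 0)
    (honC : ∀ i, eval (P i) Q = 0) (s : PointParam c P) (hodd : Odd (Fintype.card ι))
    (h3 : 3 ≤ Fintype.card ι) :
    ∃ G ∈ symbPow P 2, G ∈ irrel K (Fin 3) * symbPow P 1 ∧ c.φ G = s.f ^ 2 := by
  have : Infinite K := IsAlgClosed.instInfinite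
  have : Nonempty ι := Fintype.card_pos_iff.mp (by omega)
  obtain ⟨N, hN⟩ : ∃ N, Fintype.card ι = N + 1 := ⟨Fintype.card ι - 1, by omega⟩
  have hNeven : Even N := by
    rw [hN] at hodd
    exact (Nat.odd_add_one.mp hodd |> Nat.not_odd_iff_even.mp)
  have hNodd : Odd (N - 1) := Nat.Even.sub_odd (by omega) hNeven odd_one
  have hN1 : N - 1 ≠ 0 := by omega
  have hN0 : N ≠ 0 := by omega
  have hf := s.isHomogeneous_f
  rw [hN] at hf
  obtain ⟨p, q, a, b, d, hp, hq, ha, hb, hd, E0, E1, E2⟩ := exists_euler_relations hf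
  have heval {g : MvPolynomial (Fin 2) K} {k : ℕ} (hg : g.IsHomogeneous k) (hk : k ≠ 0) :
      eval 0 g = 0 := by
    simpa [hk] using hg.eval_smul_point 0 0
  have hsign {g : MvPolynomial (Fin 2) K} (hg : g.IsHomogeneous N) : signFlip K g = g := by
    rw [signFlip_of_isHomogeneous hg, hNeven.neg_one_pow, one_mul]
  obtain ⟨V, hV⟩ := c.exists_φ_eq p (hsign hp)
  obtain ⟨U, hU⟩ := c.exists_φ_eq q (hsign hq)
  obtain ⟨H, hH⟩ := c.exists_φ_eq (a * d - b ^ 2) (by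
    rw [map_sub, map_mul, map_pow, signFlip_of_isHomogeneous ha, signFlip_of_isHomogeneous hb,
      signFlip_of_isHomogeneous hd, hNodd.neg_one_pow]
    ring)
  have hVM : V ∈ irrel K (Fin 3) :=
    mem_irrel_of_eval_zero (by rw [← s.eval_zero_φ, hV, heval hp hN0])
  have hUM : U ∈ irrel K (Fin 3) :=
    mem_irrel_of_eval_zero (by rw [← s.eval_zero_φ, hU, heval hq hN0])
  have hHM : H ∈ irrel K (Fin 3) :=
    mem_irrel_of_eval_zero (by
      rw [← s.eval_zero_φ, hH, map_sub, map_mul, map_pow, heval ha hN1, heval hb hN1]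
      simp)
  obtain ⟨n₂, hn₂⟩ : ∃ n₂ : MvPolynomial (Fin 2) K, n₂ = N := ⟨_, rfl⟩
  obtain ⟨n₃, hn₃⟩ : ∃ n₃ : MvPolynomial (Fin 3) K, n₃ = N := ⟨_, rfl⟩
  rw [← hn₂] at E0 E1 E2
  have hcn : n₂ = C (N : K) := by rw [hn₂, map_natCast]
  have hφn : c.φ n₃ = n₂ := by rw [hn₂, hn₃, map_natCast]
  have hQ1 : Q ∈ symbPow P 1 := s.conic_mem_symbPow_one hP
  have hF1 : c.y 0 * V + c.y 1 * U ∈ symbPow P 1 := by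
    refine s.mem_symbPow_one_of_dvd hP ⟨X 0 * (n₂ + 1), ?_⟩
    simp only [map_add, map_mul, c.φ_y0, c.φ_y1, hV, hU]
    linear_combination X 0 * E0
  have hF2 : c.y 1 * V + c.y 2 * U ∈ symbPow P 1 := by
    refine s.mem_symbPow_one_of_dvd hP ⟨X 1 * (n₂ + 1), ?_⟩
    simp only [map_add, map_mul, c.φ_y2, c.φ_y1, hV, hU]
    linear_combination X 1 * E0
  have hW1 : n₃ ^ 2 * U ^ 2 + c.y 0 * H ∈ symbPow P 1 := by
    refine s.mem_symbPow_one_of_dvd hP ⟨n₂ * (n₂ + 1) * d, ?_⟩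
    simp only [map_add, map_mul, map_pow, hφn, c.φ_y0, hU, hH]
    linear_combination X 0 * d * E1 - (X 0 * b + n₂ * q) * E2 + n₂ * d * E0
  have hW2 : n₃ ^ 2 * V ^ 2 + c.y 2 * H ∈ symbPow P 1 := by
    refine s.mem_symbPow_one_of_dvd hP ⟨n₂ * (n₂ + 1) * a, ?_⟩
    simp only [map_add, map_mul, map_pow, hφn, c.φ_y2, hV, hH]
    linear_combination X 1 * a * E2 - (X 1 * b + n₂ * p) * E1 + n₂ * a * E0
  have hmul {A B : MvPolynomial (Fin 3) K} (hA : A ∈ symbPow P 1) (hB : B ∈ symbPow P 1) :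
      A * B ∈ symbPow P 2 := symbPow_mul_le P 1 1 (Ideal.mul_mem_mul hA hB)
  obtain ⟨G, hG⟩ : ∃ G, G = n₃ ^ 2 * (c.y 0 * V ^ 2 + 2 * c.y 1 * U * V + c.y 2 * U ^ 2) + Q * H :=
    ⟨_, rfl⟩
  have hG0 : c.y 0 * G ∈ symbPow P 2 := by
    have : c.y 0 * G = n₃ ^ 2 * ((c.y 0 * V + c.y 1 * U) * (c.y 0 * V + c.y 1 * U))
        + Q * (n₃ ^ 2 * U ^ 2 + c.y 0 * H) := by
      rw [hG]
      linear_combination (-n₃ ^ 2 * U ^ 2) * c.eq_y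
    rw [this]
    exact add_mem (Ideal.mul_mem_left _ _ (hmul hF1 hF1)) (hmul hQ1 hW1)
  have hG2 : c.y 2 * G ∈ symbPow P 2 := by
    have : c.y 2 * G = n₃ ^ 2 * ((c.y 1 * V + c.y 2 * U) * (c.y 1 * V + c.y 2 * U))
        + Q * (n₃ ^ 2 * V ^ 2 + c.y 2 * H) := by
      rw [hG]
      linear_combination (-n₃ ^ 2 * V ^ 2) * c.eq_y
    rw [this]
    exact add_mem (Ideal.mul_mem_left _ _ (hmul hF2 hF2)) (hmul hQ1 hW2)
  have hGS : G ∈ symbPow P 2 := by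
    refine mem_symbPow_iff.mpr fun i => ?_
    have hne (k : Fin 3) (hk : eval (P i) (c.y k) ≠ 0) : c.y k ∉ homVanishingIdeal (P i) :=
      fun h => hk (by simpa using eval_smul_eq_zero_of_mem h 1)
    rcases c.eval_y_ne_zero (P i) (hP i) (honC i) with h | h
    · exact mem_pow_of_mul_mem_pow_of_notMem (hP i) (hne 0 h) (mem_symbPow_iff.mp hG0 i)
    · exact mem_pow_of_mul_mem_pow_of_notMem (hP i) (hne 2 h) (mem_symbPow_iff.mp hG2 i)
  have hGM : G ∈ irrel K (Fin 3) * symbPow P 1 := by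
    have : G = n₃ ^ 2 * (V * (c.y 0 * V + c.y 1 * U) + U * (c.y 1 * V + c.y 2 * U)) + H * Q := by
      rw [hG]
      ring
    rw [this]
    exact add_mem (Ideal.mul_mem_left _ _ (add_mem (Ideal.mul_mem_mul hVM hF1)
      (Ideal.mul_mem_mul hUM hF2))) (Ideal.mul_mem_mul hHM hQ1)
  have hφG : c.φ G = C (((N : K) * (N + 1)) ^ 2) * s.f ^ 2 := by
    simp only [hG, map_add, map_mul, map_pow, hφn, map_ofNat, c.φ_y0, c.φ_y1, c.φ_y2, hV,
      hU, c.φ_conic]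
    rw [C_1, ← hcn]
    linear_combination n₂ ^ 2 * (X 0 * p + X 1 * q + (n₂ + 1) * s.f) * E0
  have hne : ((N : K) * (N + 1)) ^ 2 ≠ 0 :=
    pow_ne_zero _ (mul_ne_zero (Nat.cast_ne_zero.mpr hN0) (Nat.cast_add_one_ne_zero N))
  refine ⟨C (((N : K) * (N + 1)) ^ 2)⁻¹ * G, Ideal.mul_mem_left _ _ hGS,
    Ideal.mul_mem_left _ _ hGM, ?_⟩
  rw [map_mul, hφG, ← algebraMap_eq, AlgHom.commutes, algebraMap_eq, ← mul_assoc, ← C_mul,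
    inv_mul_cancel₀ hne, C_1, one_mul]

end PointParam

theorem mem_symbPow_of_mul_mem {K σ ι : Type*} [Field K] [Infinite K] {P : ι → σ → K}
    (hP : ∀ i, P i ≠ 0) {Q : MvPolynomial σ K} (hQ : Q ∈ symbPow P 1)
    (hsm : ∀ i, ∃ k, eval (P i) (pderiv k Q) ≠ 0) {m : ℕ} {B : MvPolynomial σ K}
    (h : Q * B ∈ symbPow P (m + 1)) : B ∈ symbPow P m := by
  refine mem_symbPow_iff.mpr fun i => mem_pow_of_mul_mem_pow (hP i) ?_ (fun h2 => ?_)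
    (mem_symbPow_iff.mp h i)
  · simpa using mem_symbPow_iff.mp hQ i
  · obtain ⟨k, hk⟩ := hsm i
    exact hk (by simpa using eval_smul_eq_zero_of_mem (pderiv_mem_of_mem_sq h2 k) 1)

theorem symbPow_pow_le {K σ ι : Type*} [Field K] (P : ι → σ → K) (j k : ℕ) :
    symbPow P j ^ k ≤ symbPow P (j * k) := by
  induction k with
  | zero => simp [symbPow]
  | succ k ih =>
    rw [pow_succ, mul_add, mul_one]
    exact (Ideal.mul_mono_left ih).trans (symbPow_mul_le _ _ _)

theorem symbPow_one_le_irrel {K σ ι : Type*} [Field K] [Nonempty ι] (P : ι → σ → K) :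
    symbPow P 1 ≤ irrel K σ := fun F hF => by
  have h := mem_symbPow_iff.mp hF (Classical.arbitrary ι)
  rw [pow_one] at h
  exact mem_irrel_of_eval_zero (by simpa using eval_smul_eq_zero_of_mem h 0)

namespace PointParam

variable {K ι : Type*} [Field K] [IsAlgClosed K] [Fintype ι]
  {Q : MvPolynomial (Fin 3) K} {c : ConicParam Q} {P : ι → Fin 3 → K}

theorem signFlip_f (s : PointParam c P) (hodd : Odd (Fintype.card ι)) :
    signFlip K s.f = -s.f := by
  have : Infinite K := IsAlgClosed.instInfinite
  rw [signFlip_of_isHomogeneous s.isHomogeneous_f, hodd.neg_one_pow, neg_one_mul]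

/-- Division with remainder by `Q` in an even symbolic power. -/
theorem exists_eq_of_mem_symbPow_even (hP : ∀ i, P i ≠ 0)
    (hsm : ∀ i, ∃ k, eval (P i) (pderiv k Q) ≠ 0) (s : PointParam c P)
    (hodd : Odd (Fintype.card ι)) {G : MvPolynomial (Fin 3) K} (hG : G ∈ symbPow P 2)
    (hφG : c.φ G = s.f ^ 2) {k : ℕ} {A : MvPolynomial (Fin 3) K}
    (hA : A ∈ symbPow P (2 * k + 2)) :
    ∃ H, ∃ B ∈ symbPow P (2 * k + 1), A = G ^ (k + 1) * H + Q * B := by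
  have : Infinite K := IsAlgClosed.instInfinite
  obtain ⟨h, hh⟩ := s.f_pow_dvd_φ hA
  have hfp : s.f ^ (2 * k + 2) ≠ 0 := pow_ne_zero _ s.f_ne_zero
  have hsh : signFlip K h = h := by
    have h1 := c.signFlip_φ A
    rw [hh, map_mul, map_pow, s.signFlip_f hodd,
      Even.neg_pow (⟨k + 1, by ring⟩ : Even (2 * k + 2))] at h1
    exact mul_left_cancel₀ hfp h1
  obtain ⟨H, rfl⟩ := c.exists_φ_eq h hsh
  obtain ⟨B, hB⟩ := c.dvd_of_φ_eq_zero (A - G ^ (k + 1) * H) (by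
    rw [map_sub, map_mul, map_pow, hφG, hh]
    ring)
  have hGk : G ^ (k + 1) ∈ symbPow P (2 * k + 2) :=
    symbPow_pow_le P 2 (k + 1) (Ideal.pow_mem_pow hG _)
  refine ⟨H, B, mem_symbPow_of_mul_mem hP (s.conic_mem_symbPow_one hP) hsm ?_, ?_⟩
  · rw [← hB]
    exact sub_mem hA (Ideal.mul_mem_right _ _ hGk)
  · rw [← hB]
    ring

/-- Division with remainder by `Q` in an odd symbolic power. -/
theorem exists_eq_of_mem_symbPow_odd (hP : ∀ i, P i ≠ 0)
    (hsm : ∀ i, ∃ k, eval (P i) (pderiv k Q) ≠ 0) (s : PointParam c P)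
    (hodd : Odd (Fintype.card ι)) {G : MvPolynomial (Fin 3) K} (hG : G ∈ symbPow P 2)
    (hφG : c.φ G = s.f ^ 2) {k : ℕ} {A : MvPolynomial (Fin 3) K}
    (hA : A ∈ symbPow P (2 * k + 3)) :
    ∃ F ∈ symbPow P 1, ∃ B ∈ symbPow P (2 * k + 2), A = G ^ (k + 1) * F + Q * B := by
  have : Infinite K := IsAlgClosed.instInfinite
  obtain ⟨h, hh⟩ := s.f_pow_dvd_φ hA
  rw [pow_succ, mul_assoc] at hh
  have hfp : s.f ^ (2 * k + 2) ≠ 0 := pow_ne_zero _ s.f_ne_zero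
  have hsh : signFlip K (s.f * h) = s.f * h := by
    have h1 := c.signFlip_φ A
    rw [hh, map_mul, map_pow, s.signFlip_f hodd,
      Even.neg_pow (⟨k + 1, by ring⟩ : Even (2 * k + 2))] at h1
    exact mul_left_cancel₀ hfp h1
  obtain ⟨F, hF⟩ := c.exists_φ_eq _ hsh
  have hF1 : F ∈ symbPow P 1 := s.mem_symbPow_one_of_dvd hP ⟨h, hF⟩
  obtain ⟨B, hB⟩ := c.dvd_of_φ_eq_zero (A - G ^ (k + 1) * F) (by
    rw [map_sub, map_mul, map_pow, hφG, hh, hF]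
    ring)
  have hGk : G ^ (k + 1) ∈ symbPow P (2 * k + 2) :=
    symbPow_pow_le P 2 (k + 1) (Ideal.pow_mem_pow hG _)
  refine ⟨F, hF1, B, mem_symbPow_of_mul_mem hP (s.conic_mem_symbPow_one hP) hsm ?_, ?_⟩
  · rw [← hB]
    exact sub_mem hA (symbPow_mul_le P _ _ (Ideal.mul_mem_mul hGk hF1))
  · rw [← hB]
    ring

end PointParam

/-- The symbolic powers of an odd number of points on a smooth conic are generated by the first
two. -/
theorem symbPow_even_odd_le {K ι : Type*} [Field K] [IsAlgClosed K] [CharZero K] [Fintype ι]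
    {Q : MvPolynomial (Fin 3) K} {c : ConicParam Q} {P : ι → Fin 3 → K} (hP : ∀ i, P i ≠ 0)
    (hsm : ∀ i, ∃ k, eval (P i) (pderiv k Q) ≠ 0) (s : PointParam c P)
    (hodd : Odd (Fintype.card ι)) {G : MvPolynomial (Fin 3) K} (hG : G ∈ symbPow P 2)
    (hφG : c.φ G = s.f ^ 2) (k : ℕ) :
    symbPow P (2 * k) ≤ symbPow P 2 ^ k ∧
      symbPow P (2 * k + 1) ≤ symbPow P 1 * symbPow P 2 ^ k := by
  have hQ : Q ∈ symbPow P 1 := s.conic_mem_symbPow_one hP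
  induction k with
  | zero => simp
  | succ k ih =>
    have hGk : G ^ (k + 1) ∈ symbPow P 2 ^ (k + 1) := Ideal.pow_mem_pow hG _
    have heven : symbPow P (2 * (k + 1)) ≤ symbPow P 2 ^ (k + 1) := fun A hA => by
      obtain ⟨H, B, hB, rfl⟩ := s.exists_eq_of_mem_symbPow_even hP hsm hodd hG hφG hA
      refine add_mem (Ideal.mul_mem_right _ _ hGk) ?_
      rw [pow_succ']
      refine Ideal.mul_mono_left (symbPow_mul_le P 1 1) ?_
      rw [mul_assoc]
      exact Ideal.mul_mem_mul hQ (ih.2 hB)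
    refine ⟨heven, fun A hA => ?_⟩
    obtain ⟨F, hF, B, hB, rfl⟩ := s.exists_eq_of_mem_symbPow_odd hP hsm hodd hG hφG hA
    rw [mul_comm (G ^ (k + 1))]
    exact add_mem (Ideal.mul_mem_mul hF hGk) (Ideal.mul_mem_mul hQ (heven hB))

/-- For an odd number of points on a smooth conic,
`I^(m+v+1) ⊆ M I^(m) I^(v)`. -/
theorem symbPow_add_one_le {K ι : Type*} [Field K] [IsAlgClosed K] [CharZero K] [Fintype ι]
    (hodd : Odd (Fintype.card ι)) (h3 : 3 ≤ Fintype.card ι) {Q : MvPolynomial (Fin 3) K}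
    (hQ : Q.IsHomogeneous 2)
    (hsm : ∀ p : Fin 3 → K, p ≠ 0 → eval p Q = 0 → ∃ i, eval p (pderiv i Q) ≠ 0)
    {P : ι → Fin 3 → K} (hP : ProjectivelyDistinct P) (honC : ∀ i, eval (P i) Q = 0) (m v : ℕ) :
    symbPow P (m + v + 1) ≤ irrel K (Fin 3) * symbPow P m * symbPow P v := by
  have : Nonempty ι := Fintype.card_pos_iff.mp (by omega)
  obtain ⟨c⟩ := exists_conicParam hQ hsm
  obtain ⟨s⟩ := exists_pointParam c hP honC
  have hsmP : ∀ i, ∃ k, eval (P i) (pderiv k Q) ≠ 0 := fun i => hsm _ (hP.1 i) (honC i)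
  obtain ⟨G, hG, hGM, hφG⟩ := s.exists_double_form hP.1 honC hodd h3
  have key := symbPow_even_odd_le hP.1 hsmP s hodd hG hφG
  refine filtration_containment (by simp [symbPow]) (symbPow_mul_le P) (fun k => (key k).1)
    (fun k => (key k).2) (symbPow_one_le_irrel P) (fun A hA => ?_) m v
  obtain ⟨H, B, hB, rfl⟩ := s.exists_eq_of_mem_symbPow_even hP.1 hsmP hodd hG hφG (k := 0) hA
  have hQ1 : Q ∈ symbPow P 1 := s.conic_mem_symbPow_one hP.1
  rw [zero_add, pow_one]
  exact add_mem (Ideal.mul_mem_right _ _ hGM)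
    (Ideal.mul_mem_mul (symbPow_one_le_irrel P hQ1) hB)

/-- In characteristic 0, for the radical ideal of an odd number `n ≥ 5` of
distinct points on a smooth plane conic, `I^{(t(m+1))} ⊆ M^t (I^{(m)})^t` and
`I^{(t(m+1)-1)} ⊆ M^{t-1} (I^{(m)})^t` for all `m, t ≥ 1`. -/
theorem stmt10 {K : Type*} [Field K] [IsAlgClosed K] [CharZero K]
    {n : ℕ} (hn : 5 ≤ n) (hodd : Odd n)
    (Q : MvPolynomial (Fin 3) K) (hQdeg : Q.IsHomogeneous 2) (hQ0 : Q ≠ 0)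
    (hsm : ∀ p : Fin 3 → K, p ≠ 0 → MvPolynomial.eval p Q = 0 →
      ∃ i, MvPolynomial.eval p (MvPolynomial.pderiv i Q) ≠ 0)
    (P : Fin n → (Fin 3 → K)) (hP : ProjectivelyDistinct P)
    (honC : ∀ i, MvPolynomial.eval (P i) Q = 0)
    (m t : ℕ) (hm : 1 ≤ m) (ht : 1 ≤ t) :
    symbPow P (t * (m + 1)) ≤ irrel K (Fin 3) ^ t * symbPow P m ^ t ∧
    symbPow P (t * (m + 1) - 1) ≤ irrel K (Fin 3) ^ (t - 1) * symbPow P m ^ t := by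
  have h := symbPow_add_one_le (by simpa using hodd) (by rw [Fintype.card_fin]; omega) hQdeg hsm
    hP honC
  obtain ⟨u, rfl⟩ : ∃ u, t = u + 1 := ⟨t - 1, by omega⟩
  exact ⟨(filtration_containment_pow h m (u + 1)).1, (filtration_containment_pow h m u).2⟩
end
end

section
/- Let I ⊆ K[x_0, x_1, x_2] be the radical ideal of the star configuration of points in P^2 defined by s ≥ 2 lines. Then I^{(2j+1)} = (I^{(2)})^j · I for every integer j ≥ 0. -/
open MvPolynomial

noncomputable section

section MonomialGeneration

variable {R ι : Type*} [CommRing R] {L : ι → R}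

/-- The intersection, over all pairs `a ≠ b`, of the `m`-th powers of the ideals `(L a, L b)`. -/
def pairPow (L : ι → R) (m : ℕ) : Ideal R :=
  ⨅ (a) (b) (_ : a ≠ b), Ideal.span {L a, L b} ^ m

theorem mem_pairPow {m : ℕ} {x : R} :
    x ∈ pairPow L m ↔ ∀ a b, a ≠ b → x ∈ Ideal.span {L a, L b} ^ m := by
  simp [pairPow]

theorem pairPow_pow_mul_le (L : ι → R) (j : ℕ) :
    pairPow L 2 ^ j * pairPow L 1 ≤ pairPow L (2 * j + 1) := by
  refine le_iInf fun a => le_iInf fun b => le_iInf fun hab => ?_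
  have hle : ∀ m, pairPow L m ≤ Ideal.span {L a, L b} ^ m := fun m x hx =>
    mem_pairPow.1 hx a b hab
  calc pairPow L 2 ^ j * pairPow L 1
      ≤ (Ideal.span {L a, L b} ^ 2) ^ j * Ideal.span {L a, L b} ^ 1 :=
        Ideal.mul_mono (Ideal.pow_right_mono (hle 2) j) (hle 1)
    _ = Ideal.span {L a, L b} ^ (2 * j + 1) := by rw [← pow_mul, ← pow_add]

theorem pow_mul_pow_mem_span_pair_pow (x y : R) {m k l : ℕ} (h : m ≤ k + l) :
    x ^ k * y ^ l ∈ Ideal.span {x, y} ^ m := by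
  refine Ideal.pow_le_pow_right h ?_
  rw [pow_add]
  exact Ideal.mul_mem_mul (Ideal.pow_mem_pow (Ideal.subset_span (by simp)) _)
    (Ideal.pow_mem_pow (Ideal.subset_span (by simp)) _)

theorem prod_pow_mem_span_pair_pow [Fintype ι] {m : ℕ} (e : ι → ℕ) {a b : ι} (hab : a ≠ b)
    (he : m ≤ e a + e b) : ∏ i, L i ^ e i ∈ Ideal.span {L a, L b} ^ m := by
  classical
  rw [← Finset.mul_prod_erase _ _ (Finset.mem_univ a),
    ← Finset.mul_prod_erase _ _ (Finset.mem_erase.2 ⟨hab.symm, Finset.mem_univ b⟩), ← mul_assoc]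
  exact Ideal.mul_mem_right _ _ (pow_mul_pow_mem_span_pair_pow _ _ he)

theorem prod_pow_mem_pairPow [Fintype ι] {m : ℕ} (e : ι → ℕ)
    (he : ∀ a b, a ≠ b → m ≤ e a + e b) : ∏ i, L i ^ e i ∈ pairPow L m :=
  mem_pairPow.2 fun a b hab => prod_pow_mem_span_pair_pow e hab (he a b hab)

theorem prod_pow_mem_pairPow_mul [Fintype ι] {j t : ℕ} (ht : t ≤ j) (a : ι) (e : ι → ℕ)
    (ha : j - t ≤ e a) (he : ∀ b, b ≠ a → j + 1 + t ≤ e b) :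
    ∏ i, L i ^ e i ∈ pairPow L 2 ^ j * pairPow L 1 := by
  classical
  let u : ι → ℕ := fun i => if i = a then 0 else 1
  have hu : ∀ b c, b ≠ c → 1 ≤ u b + u c := by
    intro b c hbc
    simp only [u]
    split_ifs with h1 h2 <;> first | omega | exact absurd (h1.trans h2.symm) hbc
  have h2u : (∏ i, L i ^ (2 * u i)) ∈ pairPow L 2 :=
    prod_pow_mem_pairPow _ fun b c hbc => by have := hu b c hbc; omega
  have h1u : (∏ i, L i ^ u i) ∈ pairPow L 1 := prod_pow_mem_pairPow _ hu
  have h11 : (∏ i, L i ^ 1) ∈ pairPow L 2 := prod_pow_mem_pairPow _ fun _ _ _ => le_rfl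
  have hmem : (∏ i, L i ^ 1) ^ (j - t) * (∏ i, L i ^ (2 * u i)) ^ t * (∏ i, L i ^ u i) ∈
      pairPow L 2 ^ j * pairPow L 1 := by
    refine Ideal.mul_mem_mul ?_ h1u
    have := Ideal.mul_mem_mul (Ideal.pow_mem_pow h11 (j - t)) (Ideal.pow_mem_pow h2u t)
    rwa [← pow_add, Nat.sub_add_cancel ht] at this
  refine Ideal.mem_of_dvd _ ?_ hmem
  rw [← Finset.prod_pow, ← Finset.prod_pow, ← Finset.prod_mul_distrib, ← Finset.prod_mul_distrib]
  refine Finset.prod_dvd_prod_of_dvd _ _ fun i _ => ?_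
  rw [← pow_mul, ← pow_mul, ← pow_add, ← pow_add]
  refine pow_dvd_pow _ ?_
  by_cases hi : i = a
  · subst hi
    simpa [u] using ha
  · have := he i hi
    simp only [u, if_neg hi]
    omega

/-- If powers of pairwise non-dividing primes divide `x`, then so does their product. -/
theorem prod_pow_dvd_of_prime {S κ : Type*} [CommRing S] [IsDomain S] (p : κ → S) (c : κ → ℕ)
    (x : S) (s : Finset κ) (hp : ∀ i ∈ s, Prime (p i))
    (hpq : ∀ i ∈ s, ∀ k ∈ s, i ≠ k → ¬ p i ∣ p k) (hx : ∀ i ∈ s, p i ^ c i ∣ x) :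
    ∏ i ∈ s, p i ^ c i ∣ x := by
  classical
  induction s using Finset.induction_on with
  | empty => simp
  | insert i s hi ih =>
    obtain ⟨y, rfl⟩ := ih (fun k hk => hp k (Finset.mem_insert_of_mem hk))
      (fun k hk l hl => hpq k (Finset.mem_insert_of_mem hk) l (Finset.mem_insert_of_mem hl))
      (fun k hk => hx k (Finset.mem_insert_of_mem hk))
    have hpi := hp i (Finset.mem_insert_self i s)
    have hnd : ¬ p i ∣ ∏ k ∈ s, p k ^ c k := by
      rw [hpi.dvd_finsetProd_iff]
      rintro ⟨k, hk, hdvd⟩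
      exact hpq i (Finset.mem_insert_self i s) k (Finset.mem_insert_of_mem hk)
        (fun h => hi (h ▸ hk)) (hpi.dvd_of_dvd_pow hdvd)
    rw [Finset.prod_insert hi, mul_comm]
    exact mul_dvd_mul_left _
      (hpi.pow_dvd_of_dvd_mul_left _ hnd (hx i (Finset.mem_insert_self i s)))

theorem exists_sub_mul_prod_mem_span_singleton [Fintype ι] [DecidableEq ι] {a : ι}
    (hprime : (Ideal.span {L a}).IsPrime)
    (hpair : ∀ b, b ≠ a → (Ideal.span {L a, L b}).IsPrime)
    (hnot : ∀ b, b ≠ a → L b ∉ Ideal.span {L a})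
    (hnot' : ∀ b c, b ≠ a → c ≠ a → b ≠ c → L c ∉ Ideal.span {L a, L b})
    (c : ι → ℕ) {G : R} (hG : ∀ b, b ≠ a → G ∈ Ideal.span {L a, L b} ^ c b) :
    ∃ G' H, G = L a * G' + (∏ b ∈ Finset.univ.erase a, L b ^ c b) * H := by
  set φ := Ideal.Quotient.mk (Ideal.span {L a}) with hφ
  have hφa : φ (L a) = 0 := Ideal.Quotient.eq_zero_iff_mem.2 (Ideal.mem_span_singleton_self _)
  have hmap : ∀ b, Ideal.map φ (Ideal.span {L a, L b}) = Ideal.span {φ (L b)} := by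
    intro b
    rw [Ideal.map_span, Set.image_pair, hφa, Ideal.span_insert_zero]
  have hcomap : ∀ b x, φ (L b) ∣ φ x → x ∈ Ideal.span {L a, L b} := by
    rintro b x ⟨y, hy⟩
    obtain ⟨y, rfl⟩ := Ideal.Quotient.mk_surjective y
    rw [← map_mul, Ideal.Quotient.eq, Ideal.mem_span_singleton'] at hy
    obtain ⟨z, hz⟩ := hy
    exact Ideal.mem_span_pair.2 ⟨z, y, by rw [hz]; ring⟩
  have hdvd : ∏ b ∈ Finset.univ.erase a, φ (L b) ^ c b ∣ φ G := by
    refine prod_pow_dvd_of_prime (fun b => φ (L b)) c _ _ (fun b hb => ?_)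
      (fun b hb k hk hbk h => ?_) (fun b hb => ?_)
    · have hba := (Finset.mem_erase.1 hb).1
      have hne : φ (L b) ≠ 0 := fun h => hnot b hba (Ideal.Quotient.eq_zero_iff_mem.1 h)
      rw [← Ideal.span_singleton_prime hne, ← hmap]
      have := hpair b hba
      refine Ideal.map_isPrime_of_surjective Ideal.Quotient.mk_surjective ?_
      rw [Ideal.mk_ker]
      exact Ideal.span_mono (by simp)
    · exact hnot' b k (Finset.mem_erase.1 hb).1 (Finset.mem_erase.1 hk).1 hbk (hcomap b _ h)
    · have := Ideal.mem_map_of_mem φ (hG b (Finset.mem_erase.1 hb).1)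
      rwa [Ideal.map_pow, hmap, Ideal.span_singleton_pow, Ideal.mem_span_singleton] at this
  obtain ⟨H, hH⟩ := hdvd
  obtain ⟨H, rfl⟩ := Ideal.Quotient.mk_surjective H
  have : φ G = φ ((∏ b ∈ Finset.univ.erase a, L b ^ c b) * H) := by
    rw [hH, map_mul, map_prod]; simp only [map_pow]; rfl
  rw [Ideal.Quotient.eq, Ideal.mem_span_singleton'] at this
  obtain ⟨G', hG'⟩ := this
  exact ⟨G', H, by rw [mul_comm (L a), hG']; ring⟩

/-- The order of vanishing along the ideal generated by `S` is read off from a ring homomorphism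
to polynomials in an auxiliary variable. -/
def IsOrderHom (S : Set R) (Φ : R →+* Polynomial R) : Prop :=
  (∀ s ∈ S, Φ s = Polynomial.X * Polynomial.C s) ∧
    ∀ n F, F ∈ Ideal.span S ^ n ↔ Polynomial.X ^ n ∣ Φ F

namespace IsOrderHom

variable {S : Set R} {Φ : R →+* Polynomial R}

theorem mem_span_iff (h : IsOrderHom S Φ) {x : R} : x ∈ Ideal.span S ↔ Polynomial.X ∣ Φ x := by
  simpa using h.2 1 x

theorem isPrime [IsDomain R] (h : IsOrderHom S Φ) : (Ideal.span S).IsPrime := by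
  refine ⟨fun htop => ?_, fun {x y} hxy => ?_⟩
  · have h1 := h.mem_span_iff.1 (htop ▸ Submodule.mem_top : (1 : R) ∈ Ideal.span S)
    rw [map_one] at h1
    exact Polynomial.prime_X.not_dvd_one h1
  · rw [h.mem_span_iff, map_mul] at hxy
    simpa only [h.mem_span_iff] using Polynomial.prime_X.dvd_or_dvd hxy

theorem mem_pow_of_mul_mem [IsDomain R] (h : IsOrderHom S Φ) {x y : R} {n : ℕ}
    (hx : x ∉ Ideal.span S)
    (hxy : x * y ∈ Ideal.span S ^ n) : y ∈ Ideal.span S ^ n := by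
  rw [h.2, map_mul] at hxy
  rw [h.2]
  exact Polynomial.prime_X.pow_dvd_of_dvd_mul_left n (fun hd => hx (h.mem_span_iff.2 hd)) hxy

theorem mem_pow_pred_of_mul_mem [IsDomain R] (h : IsOrderHom S Φ) {x y : R} {n : ℕ}
    (hx : x ∈ S) (hx0 : x ≠ 0)
    (hxy : x * y ∈ Ideal.span S ^ n) : y ∈ Ideal.span S ^ (n - 1) := by
  cases n with
  | zero => simp
  | succ n =>
    rw [h.2, map_mul, h.1 x hx, pow_succ', mul_assoc,
      mul_dvd_mul_iff_left Polynomial.X_ne_zero] at hxy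
    rw [Nat.add_sub_cancel, h.2]
    refine Polynomial.prime_X.pow_dvd_of_dvd_mul_left n (fun hd => hx0 ?_) hxy
    simpa using Polynomial.X_dvd_iff.1 hd

end IsOrderHom

/-- A monomial `∏ L i ^ f i` times `G` lies in the product of ideals as soon as `G` vanishes to the
complementary order `2 * j + 1 - f a - f b` along each `(L a, L b)`; for `f = 0` this bounds
`pairPow L (2 * j + 1)`. -/
theorem prod_pow_mul_mem_pairPow_mul [IsDomain R] [Fintype ι] [Nonempty ι] (h0 : ∀ a, L a ≠ 0)
    (hprime : ∀ a, (Ideal.span {L a}).IsPrime)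
    (hpair : ∀ a b, a ≠ b → ∃ Φ, IsOrderHom {L a, L b} Φ)
    (hnot : ∀ a b, b ≠ a → L b ∉ Ideal.span {L a})
    (hnot' : ∀ a b c, a ≠ b → c ≠ a → c ≠ b → L c ∉ Ideal.span {L a, L b})
    (j : ℕ) (f : ι → ℕ) (hf : ∀ i, f i ≤ j + 1) (G : R)
    (hG : ∀ a b, a ≠ b → G ∈ Ideal.span {L a, L b} ^ (2 * j + 1 - f a - f b)) :
    (∏ i, L i ^ f i) * G ∈ pairPow L 2 ^ j * pairPow L 1 := by
  classical
  induction hN : ∑ i, (j + 1 - f i) generalizing f G with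
  | zero =>
    have hf' : ∀ i, j + 1 - f i = 0 := fun i => by
      simpa using (Finset.sum_eq_zero_iff.1 hN) i (Finset.mem_univ i)
    refine Ideal.mul_mem_right _ _
      (prod_pow_mem_pairPow_mul (Nat.zero_le j) (Classical.arbitrary ι) f ?_ fun b _ => ?_)
    · have := hf' (Classical.arbitrary ι); omega
    · have := hf' b; omega
  | succ N ih =>
    obtain ⟨a, ha⟩ : ∃ a, f a ≤ j := by
      by_contra! hcon
      have : ∑ i, (j + 1 - f i) = 0 := Finset.sum_eq_zero fun i _ => by
        have := hcon i; omega
      omega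
    obtain ⟨G', H, rfl⟩ := exists_sub_mul_prod_mem_span_singleton (hprime a)
      (fun b hb => (hpair a b hb.symm).elim fun _ h => h.isPrime) (hnot a)
      (fun b c hb hc hbc => hnot' a b c hb.symm hc hbc.symm)
      (fun b => 2 * j + 1 - f a - f b) (fun b hb => hG a b hb.symm)
    set Q := ∏ b ∈ Finset.univ.erase a, L b ^ (2 * j + 1 - f a - f b) with hQ
    let e : ι → ℕ := fun i => if i = a then 0 else 2 * j + 1 - f a - f i
    have hQe : Q = ∏ i, L i ^ e i := by
      rw [← Finset.mul_prod_erase _ _ (Finset.mem_univ a)]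
      simp only [e, if_true, pow_zero, one_mul]
      exact Finset.prod_congr rfl fun i hi => by rw [if_neg (Finset.mem_erase.1 hi).1]
    have hQmem : ∀ b c, b ≠ c → Q ∈ Ideal.span {L b, L c} ^ (2 * j + 1 - f b - f c) := by
      intro b c hbc
      rw [hQe]
      refine prod_pow_mem_span_pair_pow e hbc ?_
      by_cases hb : b = a
      · have hc : c ≠ a := fun hc => hbc (hb.trans hc.symm)
        simp only [e, if_neg hc, hb, if_true]
        omega
      · by_cases hc : c = a
        · simp only [e, if_neg hb, hc, if_true]
          omega
        · simp only [e, if_neg hb, if_neg hc]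
          omega
    have hG' : ∀ b c, b ≠ c → L a * G' ∈ Ideal.span {L b, L c} ^ (2 * j + 1 - f b - f c) := by
      intro b c hbc
      exact (Submodule.add_mem_iff_left _ (Ideal.mul_mem_right _ _ (hQmem b c hbc))).1 (hG b c hbc)
    rw [mul_add]
    refine Ideal.add_mem _ ?_ ?_
    · let g : ι → ℕ := fun i => if i = a then f i + 1 else f i
      have hga : g a = f a + 1 := by simp [g]
      have hgb : ∀ b, b ≠ a → g b = f b := fun b hb => by simp [g, hb]
      have hprod : ∏ i, L i ^ g i = (∏ i, L i ^ f i) * L a := by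
        rw [← Finset.mul_prod_erase _ _ (Finset.mem_univ a),
          ← Finset.mul_prod_erase _ (fun i => L i ^ f i) (Finset.mem_univ a), hga, pow_succ,
          Finset.prod_congr rfl fun i hi => by rw [hgb i (Finset.mem_erase.1 hi).1]]
        ring
      rw [← mul_assoc, ← hprod]
      refine ih g (fun i => ?_) G' (fun b c hbc => ?_) ?_
      · have := hf i
        by_cases hi : i = a
        · subst hi; omega
        · rw [hgb i hi]; exact this
      · obtain ⟨Φ, hΦ⟩ := hpair b c hbc
        by_cases hb : b = a
        · subst hb
          have := hΦ.mem_pow_pred_of_mul_mem (by simp) (h0 b) (hG' b c hbc)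
          rw [hga, hgb c hbc.symm]
          convert this using 2
          omega
        · by_cases hc : c = a
          · subst hc
            have := hΦ.mem_pow_pred_of_mul_mem (by simp) (h0 c) (hG' b c hbc)
            rw [hga, hgb b hb]
            convert this using 2
            omega
          · rw [hgb b hb, hgb c hc]
            exact hΦ.mem_pow_of_mul_mem (hnot' b c a hbc (Ne.symm hb) (Ne.symm hc)) (hG' b c hbc)
      · have h1 : ∑ i, (j + 1 - f i) = ∑ i, ((j + 1 - g i) + if i = a then 1 else 0) :=
          Finset.sum_congr rfl fun i _ => by
            by_cases hi : i = a
            · subst hi; simp only [if_true]; omega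
            · rw [hgb i hi, if_neg hi, add_zero]
        rw [Finset.sum_add_distrib, Finset.sum_ite_eq' Finset.univ a, if_pos (Finset.mem_univ a),
          hN] at h1
        omega
    · rw [← mul_assoc, hQe, ← Finset.prod_mul_distrib]
      simp only [← pow_add]
      refine Ideal.mul_mem_right _ _
        (prod_pow_mem_pairPow_mul (t := j - f a) (Nat.sub_le _ _) a _ ?_ fun b hb => ?_)
      · omega
      · simp only [e, if_neg hb]; omega

end MonomialGeneration

section LinearForms

variable {K σ : Type*} [Field K]

theorem algHom_apply_of_isHomogeneous_one (π : MvPolynomial σ K →ₐ[K] MvPolynomial σ K)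
    {l : MvPolynomial σ K} (hl : l.IsHomogeneous 1) :
    aeval (fun i => Polynomial.C (π (X i)) + Polynomial.X * Polynomial.C (X i - π (X i))) l =
      Polynomial.C (π l) + Polynomial.X * Polynomial.C (l - π l) := by
  have hmem : l ∈ Submodule.span K (Set.range (X : σ → MvPolynomial σ K)) := by
    rw [← homogeneousSubmodule_one_eq_span_X]
    exact hl
  clear hl
  induction hmem using Submodule.span_induction with
  | mem x hx => obtain ⟨i, rfl⟩ := hx; simp
  | zero => simp
  | add x y _ _ hx hy =>
    rw [map_add, hx, hy]
    simp only [map_add, map_sub]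
    ring
  | smul c x _ hx =>
    rw [map_smul, hx]
    simp only [map_smul, ← smul_sub, ← Polynomial.smul_C, smul_add, mul_smul_comm]

theorem exists_isOrderHom {S : Set (MvPolynomial σ K)} (hS : ∀ l ∈ S, l.IsHomogeneous 1)
    (π : MvPolynomial σ K →ₐ[K] MvPolynomial σ K) (hπ : ∀ l ∈ S, π l = 0)
    (hX : ∀ i, X i - π (X i) ∈ Ideal.span S) :
    ∃ Φ : MvPolynomial σ K →+* Polynomial (MvPolynomial σ K), IsOrderHom S Φ := by
  let Ψ : MvPolynomial σ K →ₐ[K] Polynomial (MvPolynomial σ K) :=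
    aeval fun i => Polynomial.C (π (X i)) + Polynomial.X * Polynomial.C (X i - π (X i))
  have hΨS : ∀ l ∈ S, Ψ l = Polynomial.X * Polynomial.C l := fun l hl => by
    rw [algHom_apply_of_isHomogeneous_one π (hS l hl), hπ l hl]
    simp
  have hrees : ∀ F, Ψ F ∈ reesAlgebra (Ideal.span S) := fun F => by
    induction F using MvPolynomial.induction_on with
    | C a =>
      have : Ψ (C a) = algebraMap _ _ (C a : MvPolynomial σ K) := by
        simp [Ψ, IsScalarTower.algebraMap_apply K (MvPolynomial σ K)
          (Polynomial (MvPolynomial σ K)), MvPolynomial.algebraMap_eq]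
      rw [this]
      exact Subalgebra.algebraMap_mem _ _
    | add p q hp hq => rw [map_add]; exact add_mem hp hq
    | mul_X p i hp =>
      rw [map_mul]
      refine mul_mem hp ?_
      simp only [Ψ, aeval_X]
      refine add_mem (Subalgebra.algebraMap_mem (reesAlgebra (Ideal.span S)) (π (X i))) ?_
      rw [mul_comm, Polynomial.C_mul_X_eq_monomial, reesAlgebra.monomial_mem, pow_one]
      exact hX i
  have heval : ∀ F, (Ψ F).eval 1 = F := fun F => by
    have : ((Polynomial.aeval (1 : MvPolynomial σ K)).restrictScalars K).comp Ψ =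
        AlgHom.id K _ := by
      ext i
      simp [Ψ]
    simpa using DFunLike.congr_fun this F
  refine ⟨Ψ.toRingHom, hΨS, fun n F => ⟨fun hF => ?_, fun hF => ?_⟩⟩
  · have hle : Ideal.span S ≤ (Ideal.span {Polynomial.X}).comap Ψ.toRingHom :=
      Ideal.span_le.2 fun l hl => by
        change Ψ l ∈ Ideal.span {Polynomial.X}
        rw [hΨS l hl]
        exact Ideal.mul_mem_right _ _ (Ideal.mem_span_singleton_self _)
    have := Ideal.le_comap_pow _ n (Ideal.pow_right_mono hle n hF)
    rwa [Ideal.mem_comap, Ideal.span_singleton_pow, Ideal.mem_span_singleton] at this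
  · rw [← heval F, Polynomial.eval_eq_sum_range]
    refine Ideal.sum_mem _ fun i _ => ?_
    rw [one_pow, mul_one]
    by_cases hi : i < n
    · have h0 : (Ψ F).coeff i = 0 := Polynomial.X_pow_dvd_iff.1 hF i hi
      rw [h0]
      exact zero_mem _
    · exact Ideal.pow_le_pow_right (not_lt.1 hi) (hrees F i)

theorem exists_eq_sum_of_isHomogeneous_one [Fintype σ] {l : MvPolynomial σ K}
    (hl : l.IsHomogeneous 1) : ∃ c : σ → K, ∑ i, c i • X i = l := by
  have hmem : l ∈ Submodule.span K (Set.range (X : σ → MvPolynomial σ K)) := by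
    rw [← homogeneousSubmodule_one_eq_span_X]
    exact hl
  exact (Submodule.mem_span_range_iff_exists_fun K).1 hmem

theorem exists_isOrderHom_singleton [Fintype σ] {l : MvPolynomial σ K} (hl : l.IsHomogeneous 1)
    (hl0 : l ≠ 0) :
    ∃ Φ : MvPolynomial σ K →+* Polynomial (MvPolynomial σ K), IsOrderHom {l} Φ := by
  classical
  obtain ⟨c, hc⟩ := exists_eq_sum_of_isHomogeneous_one hl
  obtain ⟨k, hk⟩ : ∃ k, c k ≠ 0 := by
    by_contra! h
    exact hl0 (by rw [← hc]; simp [h])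
  let π : MvPolynomial σ K →ₐ[K] MvPolynomial σ K :=
    aeval fun i => if i = k then X k - (c k)⁻¹ • l else X i
  refine exists_isOrderHom (by simpa using hl) π ?_ fun i => ?_
  · have hi : ∀ i, c i • π (X i) = c i • X i - if i = k then l else 0 := by
      intro i
      by_cases hi : i = k
      · subst hi
        simp [π, smul_sub, smul_smul, hk]
      · simp [π, hi]
    have : π l = 0 := by
      have hsum : π l = ∑ i, c i • π (X i) := by
        rw [← hc, map_sum]
        simp only [map_smul]
      rw [hsum, Finset.sum_congr rfl fun i _ => hi i, Finset.sum_sub_distrib, hc]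
      simp
    simpa using this
  · rw [Ideal.mem_span_singleton]
    by_cases hi : i = k
    · subst hi
      simp [π, smul_eq_C_mul]
    · simp [π, hi]

theorem not_mem_span_singleton_of_isHomogeneous_one {l l' : MvPolynomial σ K}
    (hl : l.IsHomogeneous 1) (hl' : l'.IsHomogeneous 1) (hl0 : l' ≠ 0)
    (hne : ∀ c : K, l' ≠ c • l) : l' ∉ Ideal.span {l} := by
  rw [Ideal.mem_span_singleton]
  rintro ⟨q, rfl⟩
  have h1 := left_ne_zero_of_mul hl0
  have h2 := right_ne_zero_of_mul hl0
  have hd := hl'.totalDegree hl0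
  rw [totalDegree_mul_of_isDomain h1 h2, hl.totalDegree h1] at hd
  have hq := totalDegree_eq_zero_iff_eq_C.1 (show q.totalDegree = 0 by omega)
  exact hne (q.coeff 0) (by rw [smul_eq_C_mul, ← hq, mul_comm])

end LinearForms

section ProjectivePlane

variable {K : Type*} [Field K] {l l' : MvPolynomial (Fin 3) K} {p : Fin 3 → K}

theorem mem_span_pair_of_eval_eq_zero (hl : l.IsHomogeneous 1) (hl' : l'.IsHomogeneous 1)
    (hl0 : l ≠ 0) (hne : ∀ c : K, l' ≠ c • l) (hp : p ≠ 0) (h : eval p l = 0) (h' : eval p l' = 0)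
    {x : MvPolynomial (Fin 3) K} (hx : x.IsHomogeneous 1) (hxp : eval p x = 0) :
    x ∈ Submodule.span K {l, l'} := by
  obtain ⟨c, rfl⟩ := exists_eq_sum_of_isHomogeneous_one hl
  obtain ⟨c', rfl⟩ := exists_eq_sum_of_isHomogeneous_one hl'
  obtain ⟨w, rfl⟩ := exists_eq_sum_of_isHomogeneous_one hx
  let lin : (Fin 3 → K) →ₗ[K] MvPolynomial (Fin 3) K := Fintype.linearCombination K X
  have hlin : ∀ v, lin v = ∑ i, v i • X i := fun v => Fintype.linearCombination_apply ..
  let ev : (Fin 3 → K) →ₗ[K] K := (aeval p).toLinearMap ∘ₗ lin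
  have hev : ∀ v, ev v = eval p (∑ i, v i • X i) := fun v => by
    simp only [ev, LinearMap.comp_apply, hlin, AlgHom.toLinearMap_apply, ← coe_aeval_eq_eval]
    rfl
  obtain ⟨k, hk⟩ := Function.ne_iff.1 hp
  have hsurj : Function.Surjective ev := by
    refine LinearMap.surjective fun h0 => hk ?_
    have : ev (Pi.single k 1) = 0 := by rw [h0]; rfl
    simpa [hev, Pi.single_apply] using this
  have hker : Module.finrank K (LinearMap.ker ev) = 2 := by
    have h1 := ev.finrank_range_add_finrank_ker
    rw [LinearMap.range_eq_top.2 hsurj, finrank_top] at h1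
    simp at h1
    omega
  have hli : LinearIndependent K ![c, c'] := by
    refine (LinearIndependent.pair_iff' fun h0 => hl0 (by simp [h0])).2 fun a ha => hne a ?_
    rw [← hlin, ← hlin, ← ha, map_smul]
  have hspan : Submodule.span K (Set.range ![c, c']) = LinearMap.ker ev := by
    refine Submodule.eq_of_le_of_finrank_eq (Submodule.span_le.2 ?_) ?_
    · rintro _ ⟨i, rfl⟩
      fin_cases i
      · simpa [hev] using h
      · simpa [hev] using h'
    · rw [finrank_span_eq_card hli, hker]; rfl
  have hw : w ∈ Submodule.span K (Set.range ![c, c']) := by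
    rw [hspan, LinearMap.mem_ker, hev, hxp]
  have := Submodule.mem_map_of_mem (f := lin) hw
  rw [Submodule.map_span] at this
  simpa [hlin, Set.image_pair, Set.pair_comm] using this

theorem aeval_C_mul_of_isHomogeneous {σ : Type*} [Fintype σ] {d : ℕ} {F : MvPolynomial σ K}
    (hF : F.IsHomogeneous d) (q : σ → K) (y : MvPolynomial σ K) :
    aeval (fun i => C (q i) * y) F = C (eval q F) * y ^ d := by
  rw [aeval_def, eval₂_eq', eval_eq', map_sum, Finset.sum_mul]
  refine Finset.sum_congr rfl fun m hm => ?_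
  have hdeg : ∑ i, m i = d := by
    rw [← Finsupp.degree_eq_sum]
    by_contra hne
    exact mem_support_iff.1 hm (hF.coeff_eq_zero hne)
  rw [← hdeg, ← Finset.prod_pow_eq_pow_sum]
  simp only [mul_pow, Finset.prod_mul_distrib, map_mul, map_prod, map_pow, algebraMap_eq]
  ring

theorem exists_isOrderHom_pair (hl : l.IsHomogeneous 1) (hl' : l'.IsHomogeneous 1)
    (hl0 : l ≠ 0) (hne : ∀ c : K, l' ≠ c • l) (hp : p ≠ 0) (h : eval p l = 0)
    (h' : eval p l' = 0) :
    homVanishingIdeal p = Ideal.span {l, l'} ∧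
      ∃ Φ : MvPolynomial (Fin 3) K →+* Polynomial (MvPolynomial (Fin 3) K),
        IsOrderHom {l, l'} Φ := by
  obtain ⟨k, hk⟩ := Function.ne_iff.1 hp
  let π : MvPolynomial (Fin 3) K →ₐ[K] MvPolynomial (Fin 3) K :=
    aeval fun i => C (p i) * (C (p k)⁻¹ * X k)
  have hπ : ∀ {d} {F : MvPolynomial (Fin 3) K}, F.IsHomogeneous d → eval p F = 0 → π F = 0 :=
    fun hF hFp => by simp only [π, aeval_C_mul_of_isHomogeneous hF, hFp, map_zero, zero_mul]
  have hX : ∀ i, X i - π (X i) ∈ Ideal.span {l, l'} := fun i => by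
    have hmem : X i - π (X i) ∈ Submodule.span K {l, l'} := by
      refine mem_span_pair_of_eval_eq_zero hl hl' hl0 hne hp h h' ?_ ?_
      · simp only [π, aeval_X, ← mul_assoc, ← map_mul]
        exact (isHomogeneous_X K i).sub (isHomogeneous_C_mul_X _ k)
      · have : p k ≠ 0 := hk
        simp [π, this]
    exact Submodule.span_le_restrictScalars K (MvPolynomial (Fin 3) K) _ hmem
  have hsub : ∀ F, F - π F ∈ Ideal.span {l, l'} := fun F => by
    have : (Ideal.Quotient.mkₐ K (Ideal.span {l, l'})).comp π =
        Ideal.Quotient.mkₐ K (Ideal.span {l, l'}) :=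
      algHom_ext fun i => ((Ideal.Quotient.mk_eq_mk_iff_sub_mem _ _).2 (hX i)).symm
    exact (Ideal.Quotient.mk_eq_mk_iff_sub_mem _ _).1 (DFunLike.congr_fun this F).symm
  refine ⟨le_antisymm (Ideal.span_le.2 ?_) (Ideal.span_le.2 ?_), exists_isOrderHom ?_ π ?_ hX⟩
  · rintro F ⟨⟨d, hF⟩, hFp⟩
    simpa [hπ hF hFp] using hsub F
  · rintro F (rfl | rfl)
    · exact Ideal.subset_span ⟨⟨1, hl⟩, h⟩
    · exact Ideal.subset_span ⟨⟨1, hl'⟩, h'⟩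
  · rintro F (rfl | rfl) <;> assumption
  · rintro F (rfl | rfl)
    · exact hπ hl h
    · exact hπ hl' h'

end ProjectivePlane

/-- For the radical ideal of the star configuration of points in `P^2`
defined by `s ≥ 2` lines, `I^{(2j+1)} = (I^{(2)})^j · I` for every `j ≥ 0`.  The points
are indexed by the pairs `q.1 < q.2` of lines, `P q` being the intersection point of
lines `q.1` and `q.2`. -/
theorem stmt11 {K : Type*} [Field K] [IsAlgClosed K]
    {s : ℕ} (hs : 2 ≤ s)
    (L : Fin s → MvPolynomial (Fin 3) K)
    (hL1 : ∀ i, (L i).IsHomogeneous 1) (hL0 : ∀ i, L i ≠ 0)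
    (hLdist : Pairwise fun i j => ∀ c : K, L i ≠ c • L j)
    (hL3 : ∀ i j k : Fin s, i ≠ j → i ≠ k → j ≠ k → ∀ p : Fin 3 → K, p ≠ 0 →
      MvPolynomial.eval p (L i) = 0 → MvPolynomial.eval p (L j) = 0 →
      MvPolynomial.eval p (L k) ≠ 0)
    (P : {q : Fin s × Fin s // q.1 < q.2} → (Fin 3 → K)) (hP : ProjectivelyDistinct P)
    (hPL : ∀ q, MvPolynomial.eval (P q) (L q.1.1) = 0 ∧
      MvPolynomial.eval (P q) (L q.1.2) = 0)
    (j : ℕ) :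
    symbPow P (2 * j + 1) = symbPow P 2 ^ j * symbPow P 1 := by
  have hpair : ∀ q, homVanishingIdeal (P q) = Ideal.span {L q.1.1, L q.1.2} ∧
      ∃ Φ, IsOrderHom {L q.1.1, L q.1.2} Φ := fun q =>
    exists_isOrderHom_pair (hL1 _) (hL1 _) (hL0 _) (hLdist q.2.ne') (hP.1 q) (hPL q).1 (hPL q).2
  have hsymb : ∀ m, symbPow P m = pairPow L m := fun m => by
    ext x
    rw [mem_pairPow]
    simp only [symbPow, Ideal.mem_iInf]
    refine ⟨fun h a b hab => ?_, fun h q => by rw [(hpair q).1]; exact h _ _ q.2.ne⟩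
    rcases lt_or_gt_of_ne hab with hab | hab
    · exact (hpair ⟨(a, b), hab⟩).1 ▸ h ⟨(a, b), hab⟩
    · rw [Set.pair_comm]
      exact (hpair ⟨(b, a), hab⟩).1 ▸ h ⟨(b, a), hab⟩
  have hord : ∀ a b, a ≠ b → ∃ Φ, IsOrderHom {L a, L b} Φ := fun a b hab => by
    rcases lt_or_gt_of_ne hab with hab | hab
    · exact (hpair ⟨(a, b), hab⟩).2
    · rw [Set.pair_comm]
      exact (hpair ⟨(b, a), hab⟩).2
  have hnot : ∀ a b c, a < b → c ≠ a → c ≠ b → L c ∉ Ideal.span {L a, L b} := by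
    intro a b c hab hca hcb hmem
    obtain ⟨u, v, huv⟩ := Ideal.mem_span_pair.1 hmem
    have h := hPL ⟨(a, b), hab⟩
    refine hL3 a b c hab.ne hca.symm hcb.symm _ (hP.1 ⟨(a, b), hab⟩) h.1 h.2 ?_
    rw [← huv, map_add, map_mul, map_mul, h.1, h.2, mul_zero, mul_zero, add_zero]
  have : Nonempty (Fin s) := ⟨⟨0, by omega⟩⟩
  simp only [hsymb]
  refine le_antisymm (fun G hG => ?_) ?_
  · simpa using prod_pow_mul_mem_pairPow_mul hL0
      (fun a => (exists_isOrderHom_singleton (hL1 a) (hL0 a)).elim fun _ h => h.isPrime) hord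
      (fun a b hba => not_mem_span_singleton_of_isHomogeneous_one (hL1 a) (hL1 b) (hL0 b)
        (hLdist hba))
      (fun a b c hab hca hcb => by
        rcases lt_or_gt_of_ne hab with hab | hab
        · exact hnot a b c hab hca hcb
        · rw [Set.pair_comm]
          exact hnot b a c hab hcb hca)
      j 0 (fun _ => Nat.zero_le _) G (fun a b hab => by simpa using mem_pairPow.1 hG a b hab)
  · exact pairPow_pow_mul_le L j
end
end

section
/- Assume K has characteristic 0. Let I ⊆ K[x_0, x_1, x_2] be the radical ideal of the star configuration of points in P^2 defined by s ≥ 2 lines. Then for all integers m ≥ 1 and t ≥ 1 one has I^{(t(m+1))} ⊆ M^t (I^{(m)})^t and I^{(t(m+1)−1)} ⊆ M^{t−1} (I^{(m)})^t. -/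
open MvPolynomial

noncomputable section

section StarConfiguration

variable {R : Type*} [CommRing R]

theorem Ideal.span_pair_pow_succ_le (x y : R) (n : ℕ) :
    Ideal.span {x, y} ^ (n + 1) ≤
      Ideal.span {x} * Ideal.span {x, y} ^ n ⊔ Ideal.span {y ^ (n + 1)} := by
  induction n with
  | zero => simp [Ideal.span_insert]
  | succ n ih =>
    rw [pow_succ]
    nth_rw 2 [Ideal.span_insert]
    rw [Ideal.mul_sup]
    refine sup_le (by rw [mul_comm]; exact le_sup_left) ?_
    refine (Ideal.mul_mono_left ih).trans ?_
    rw [Ideal.sup_mul, Ideal.span_singleton_mul_span_singleton, ← pow_succ]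
    refine sup_le_sup_right ?_ _
    rw [mul_assoc, pow_succ]
    refine Ideal.mul_mono_right (Ideal.mul_mono_right ?_)
    exact Ideal.span_mono (by simp)

theorem Ideal.span_pair_pow_le (x y : R) (n : ℕ) :
    Ideal.span {x, y} ^ n ≤ Ideal.span {x, y ^ n} := by
  cases n with
  | zero => simp [Ideal.span_insert]
  | succ n =>
    refine (Ideal.span_pair_pow_succ_le x y n).trans ?_
    rw [Ideal.span_insert x {y ^ (n + 1)}]
    exact sup_le_sup_right Ideal.mul_le_left _

theorem Ideal.mem_span_pair_pow_of_mul_mem_left {x y h : R} (hx : Prime x) [IsDomain R]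
    (hy : ¬ x ∣ y) {n : ℕ} (hh : x * h ∈ Ideal.span {x, y} ^ n) :
    h ∈ Ideal.span {x, y} ^ (n - 1) := by
  cases n with
  | zero => simp
  | succ n =>
    obtain ⟨u, hu, v, hv, huv⟩ := Submodule.mem_sup.1 (Ideal.span_pair_pow_succ_le x y n hh)
    obtain ⟨q, hq, rfl⟩ := Ideal.mem_span_singleton_mul.1 hu
    obtain ⟨g, rfl⟩ := Ideal.mem_span_singleton'.1 hv
    have hdvd : x ∣ g * y ^ (n + 1) := ⟨h - q, by linear_combination huv⟩
    obtain ⟨g', rfl⟩ := (hx.dvd_or_dvd hdvd).resolve_right fun H => hy (hx.dvd_of_dvd_pow H)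
    have : h = q + g' * y * y ^ n := by
      apply mul_left_cancel₀ hx.ne_zero
      linear_combination -huv
    rw [this]
    exact add_mem hq (Ideal.mul_mem_left _ _ (Ideal.pow_mem_pow
      (Ideal.subset_span (by simp)) _))

theorem Ideal.mem_span_pair_of_mul_mem {x y z h : R} (hx : Prime x)
    (hy : ¬ x ∣ y) [hp : (Ideal.span {x, y}).IsPrime] (hz : z ∉ Ideal.span {x, y}) {n : ℕ}
    (hh : z * h ∈ Ideal.span {x, y ^ n}) : h ∈ Ideal.span {x, y ^ n} := by
  induction n with
  | zero => simp [Ideal.span_insert]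
  | succ n ih =>
    obtain ⟨a, b, hab⟩ := Ideal.mem_span_pair.1 hh
    obtain ⟨c, d, rfl⟩ := Ideal.mem_span_pair.1
      (ih (Ideal.mem_span_pair.2 ⟨a, b * y, by linear_combination hab⟩))
    have hdvd : x ∣ y ^ n * (z * d - y * b) := ⟨a - z * c, by linear_combination -hab⟩
    obtain ⟨e, he⟩ := (hx.dvd_or_dvd hdvd).resolve_left fun H => hy (hx.dvd_of_dvd_pow H)
    have hd : d ∈ Ideal.span {x, y} :=
      (hp.mem_or_mem (Ideal.mem_span_pair.2 ⟨e, b, by linear_combination -he⟩)).resolve_left hz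
    obtain ⟨d₁, d₂, rfl⟩ := Ideal.mem_span_pair.1 hd
    exact Ideal.mem_span_pair.2 ⟨c + d₁ * y ^ n, d₂, by ring⟩

theorem Ideal.mem_span_pair_pow_of_mul_mem {x y z h : R} (hx : Prime x) [IsDomain R]
    (hy : ¬ x ∣ y) [hp : (Ideal.span {x, y}).IsPrime] (hz : z ∉ Ideal.span {x, y}) {n : ℕ}
    (hh : z * h ∈ Ideal.span {x, y} ^ n) : h ∈ Ideal.span {x, y} ^ n := by
  induction n generalizing h with
  | zero => simp
  | succ n ih =>
    obtain ⟨k, g, rfl⟩ := Ideal.mem_span_pair.1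
      (Ideal.mem_span_pair_of_mul_mem hx hy hz (Ideal.span_pair_pow_le x y _ hh))
    have hyn : y ^ (n + 1) ∈ Ideal.span {x, y} ^ (n + 1) :=
      Ideal.pow_mem_pow (Ideal.subset_span (by simp)) _
    have hk : x * (z * k) ∈ Ideal.span {x, y} ^ (n + 1) := by
      have := sub_mem hh (Ideal.mul_mem_left _ (z * g) hyn)
      convert this using 1
      ring
    have hk' := ih (Ideal.mem_span_pair_pow_of_mul_mem_left hx hy hk)
    refine add_mem ?_ (Ideal.mul_mem_left _ _ hyn)
    rw [pow_succ]
    exact Ideal.mul_mem_mul hk' (Ideal.subset_span (by simp))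

theorem Ideal.mem_span_pair_prod_pow {ι : Type*} {x F : R} (hx : Prime x) (y : ι → R)
    (n : ι → ℕ) (T : Finset ι) (hy : ∀ j ∈ T, ¬ x ∣ y j)
    (hp : ∀ j ∈ T, (Ideal.span {x, y j}).IsPrime)
    (hyy : ∀ j ∈ T, ∀ k ∈ T, j ≠ k → y k ∉ Ideal.span {x, y j})
    (hF : ∀ j ∈ T, F ∈ Ideal.span {x, y j ^ n j}) :
    F ∈ Ideal.span {x, ∏ j ∈ T, y j ^ n j} := by
  classical
  induction T using Finset.induction_on with
  | empty => simp [Ideal.span_insert]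
  | insert j T hj ih =>
    obtain ⟨a, b, hab⟩ := Ideal.mem_span_pair.1 (ih
      (fun k hk => hy k (Finset.mem_insert_of_mem hk))
      (fun k hk => hp k (Finset.mem_insert_of_mem hk))
      (fun k hk l hl => hyy k (Finset.mem_insert_of_mem hk) l (Finset.mem_insert_of_mem hl))
      (fun k hk => hF k (Finset.mem_insert_of_mem hk)))
    have hjT := Finset.mem_insert_self j T
    have := hp j hjT
    have hprod : ∏ k ∈ T, y k ^ n k ∉ Ideal.span {x, y j} := by
      intro H
      obtain ⟨k, hk, hk'⟩ := (Ideal.IsPrime.prod_mem_iff (hp := this)).1 H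
      exact hyy j hjT k (Finset.mem_insert_of_mem hk) (by rintro rfl; exact hj hk)
        (this.mem_of_pow_mem _ hk')
    have hb : b ∈ Ideal.span {x, y j ^ n j} := by
      refine Ideal.mem_span_pair_of_mul_mem hx (hy j hjT) hprod ?_
      have := sub_mem (hF j hjT) (Ideal.mul_mem_left (Ideal.span {x, y j ^ n j}) a
        (Ideal.subset_span (Set.mem_insert x _)))
      convert this using 1
      linear_combination hab
    obtain ⟨b₁, b₂, rfl⟩ := Ideal.mem_span_pair.1 hb
    rw [Finset.prod_insert hj]
    exact Ideal.mem_span_pair.2 ⟨a + b₁ * ∏ k ∈ T, y k ^ n k, b₂, by linear_combination hab⟩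

variable {ι : Type*}

/-- The algebraic content of a star configuration in the plane: pairwise non-associated primes
`L i` such that any two of them generate a prime ideal which contains none of the others. -/
structure IsStarFamily (L : ι → R) : Prop where
  prime (i : ι) : Prime (L i)
  not_dvd {i j : ι} (hij : i ≠ j) : ¬ L i ∣ L j
  isPrime {i j : ι} (hij : i ≠ j) : (Ideal.span {L i, L j}).IsPrime
  notMem {i j k : ι} (hij : i ≠ j) (hik : i ≠ k) (hjk : j ≠ k) : L k ∉ Ideal.span {L i, L j}

/-- The intersection of the `N`-th powers of the ideals `(L i, L j)` for `i ≠ j`. -/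
def starPow (L : ι → R) (N : ℕ) : Ideal R :=
  ⨅ i, ⨅ j, ⨅ _ : i ≠ j, Ideal.span {L i, L j} ^ N

theorem mem_starPow {L : ι → R} {N : ℕ} {F : R} :
    F ∈ starPow L N ↔ ∀ i j, i ≠ j → F ∈ Ideal.span {L i, L j} ^ N := by
  simp [starPow, Submodule.mem_iInf]

theorem mul_mem_starPow {L : ι → R} {a b : ℕ} {F G : R} (hF : F ∈ starPow L a)
    (hG : G ∈ starPow L b) : F * G ∈ starPow L (a + b) := by
  rw [mem_starPow] at *
  intro i j hij
  rw [pow_add]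
  exact Ideal.mul_mem_mul (hF i j hij) (hG i j hij)

theorem pow_mem_starPow {L : ι → R} {a : ℕ} {F : R} (hF : F ∈ starPow L a) (n : ℕ) :
    F ^ n ∈ starPow L (a * n) := by
  rw [mem_starPow] at *
  intro i j hij
  rw [pow_mul]
  exact Ideal.pow_mem_pow (hF i j hij) n

theorem starPow_pow_le (L : ι → R) (a n : ℕ) : starPow L a ^ n ≤ starPow L (a * n) := by
  refine le_iInf fun i => le_iInf fun j => le_iInf fun hij => ?_
  rw [pow_mul]
  exact Ideal.pow_right_mono (fun F hF => mem_starPow.1 hF i j hij) n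

section Fintype

variable [Fintype ι] [DecidableEq ι]

theorem prod_mem_starPow_two (L : ι → R) : ∏ j, L j ∈ starPow L 2 := by
  rw [mem_starPow]
  intro i j hij
  rw [← Finset.mul_prod_erase Finset.univ L (Finset.mem_univ i),
    ← Finset.mul_prod_erase (Finset.univ.erase i) L (a := j) (by simp [hij.symm]), ← mul_assoc,
    sq]
  exact Ideal.mul_mem_right _ _ (Ideal.mul_mem_mul (Ideal.subset_span (by simp))
    (Ideal.subset_span (by simp)))

theorem prod_erase_mem_starPow_one (L : ι → R) (i : ι) :
    ∏ j ∈ Finset.univ.erase i, L j ∈ starPow L 1 := by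
  rw [mem_starPow]
  intro k l hkl
  rw [pow_one]
  by_cases h : k = i
  · have hl : l ∈ Finset.univ.erase i := by simp [← h, hkl.symm]
    exact Ideal.mem_of_dvd _ (Finset.dvd_prod_of_mem L hl) (Ideal.subset_span (by simp))
  · have hk : k ∈ Finset.univ.erase i := by simp [h]
    exact Ideal.mem_of_dvd _ (Finset.dvd_prod_of_mem L hk) (Ideal.subset_span (by simp))

/-- An ideal contains every monomial in the `L i` whose pairwise sums of exponents are at
least `N` as soon as it contains the extremal ones. -/
theorem prod_pow_mem_of_extremal_mem [Nonempty ι] {L : ι → R} {N : ℕ} {J : Ideal R}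
    (hJ : ∀ k n i, 2 * k + n = N →
      (∏ j, L j) ^ k * (∏ j ∈ Finset.univ.erase i, L j) ^ n ∈ J)
    {a : ι → ℕ} (ha : ∀ i j, i ≠ j → N ≤ a i + a j) : ∏ j, L j ^ a j ∈ J := by
  obtain ⟨i, -, hi⟩ := Finset.exists_min_image Finset.univ a Finset.univ_nonempty
  refine Ideal.mem_of_dvd _ ?_ (hJ (min (a i) (N / 2)) (N - 2 * min (a i) (N / 2)) i (by omega))
  rw [← Finset.mul_prod_erase Finset.univ L (Finset.mem_univ i), mul_pow, mul_assoc, ← pow_add,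
    ← Finset.mul_prod_erase Finset.univ _ (Finset.mem_univ i), ← Finset.prod_pow]
  refine mul_dvd_mul (pow_dvd_pow _ (by omega)) (Finset.prod_dvd_prod_of_dvd _ _ fun j hj => ?_)
  have h1 := ha i j (Finset.ne_of_mem_erase hj).symm
  have h2 := hi j (Finset.mem_univ j)
  exact pow_dvd_pow _ (by omega)

variable [IsDomain R]

theorem IsStarFamily.prod_pow_mul_mem [Nonempty ι] {L : ι → R} (hL : IsStarFamily L) {N : ℕ}
    {J : Ideal R}
    (hJ : ∀ a : ι → ℕ, (∀ i j, i ≠ j → N ≤ a i + a j) → ∏ j, L j ^ a j ∈ J)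
    (c : ι → ℕ) {F : R}
    (hF : ∀ i j, i ≠ j → F ∈ Ideal.span {L i, L j} ^ (N - c i - c j)) :
    (∏ j, L j ^ c j) * F ∈ J := by
  induction hd : ∑ i, (N - c i) using Nat.strong_induction_on generalizing c F with
  | _ d ih =>
  by_cases hc : ∀ i, N ≤ 2 * c i
  · refine Ideal.mul_mem_right _ _ (hJ c fun i j _ => ?_)
    have := hc i
    have := hc j
    omega
  push Not at hc
  obtain ⟨s, hs⟩ := hc
  have hF' : F ∈ Ideal.span
      {L s, ∏ j ∈ Finset.univ.erase s, L j ^ (N - c s - c j)} := by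
    refine Ideal.mem_span_pair_prod_pow (hL.prime s) L _ _ ?_ ?_ ?_ ?_
    · exact fun j hj => hL.not_dvd (Finset.ne_of_mem_erase hj).symm
    · exact fun j hj => hL.isPrime (Finset.ne_of_mem_erase hj).symm
    · exact fun j hj k hk hjk => hL.notMem (Finset.ne_of_mem_erase hj).symm
        (Finset.ne_of_mem_erase hk).symm hjk
    · exact fun j hj => Ideal.span_pair_pow_le _ _ _ (hF s j (Finset.ne_of_mem_erase hj).symm)
  obtain ⟨H, G, rfl⟩ := Ideal.mem_span_pair.1 hF'
  set A := ∏ j ∈ Finset.univ.erase s, L j ^ (N - c s - c j) with hA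
  have hAs : ∀ j, j ≠ s → A ∈ Ideal.span {L s, L j} ^ (N - c s - c j) := by
    intro j hj
    have hj' : j ∈ Finset.univ.erase s := by simp [hj]
    exact Ideal.mem_of_dvd _ (Finset.dvd_prod_of_mem _ hj')
      (Ideal.pow_mem_pow (Ideal.subset_span (by simp)) _)
  have hAij : ∀ i j, i ≠ j → i ≠ s → j ≠ s →
      A ∈ Ideal.span {L i, L j} ^ (N - c i - c j) := by
    intro i j hij hi hj
    rw [hA, ← Finset.mul_prod_erase (Finset.univ.erase s) _ (a := i) (by simp [hi]),
      ← Finset.mul_prod_erase ((Finset.univ.erase s).erase i) _ (a := j) (by simp [hj, hij.symm]),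
      ← mul_assoc]
    refine Ideal.mul_mem_right _ _ (Ideal.pow_le_pow_right
      (show N - c i - c j ≤ (N - c s - c i) + (N - c s - c j) by omega) ?_)
    rw [pow_add]
    exact Ideal.mul_mem_mul (Ideal.pow_mem_pow (Ideal.subset_span (by simp)) _)
      (Ideal.pow_mem_pow (Ideal.subset_span (by simp)) _)
  set c' : ι → ℕ := fun i => c i + if i = s then 1 else 0 with hc'
  have hHs : ∀ j, j ≠ s → H ∈ Ideal.span {L s, L j} ^ (N - c' s - c' j) := by
    intro j hj
    have h1 : L s * H ∈ Ideal.span {L s, L j} ^ (N - c s - c j) := by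
      convert sub_mem (hF s j hj.symm) (Ideal.mul_mem_left _ G (hAs j hj)) using 1
      ring
    convert Ideal.mem_span_pair_pow_of_mul_mem_left (hL.prime s) (hL.not_dvd hj.symm) h1 using 2
    simp only [hc', if_pos, if_neg hj]
    omega
  have hH : ∀ i j, i ≠ j → H ∈ Ideal.span {L i, L j} ^ (N - c' i - c' j) := by
    intro i j hij
    by_cases hi : i = s
    · subst hi
      exact hHs j hij.symm
    by_cases hj : j = s
    · subst hj
      rw [Set.pair_comm, Nat.sub_right_comm]
      exact hHs i hij
    have h1 : L s * H ∈ Ideal.span {L i, L j} ^ (N - c i - c j) := by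
      convert sub_mem (hF i j hij) (Ideal.mul_mem_left _ G (hAij i j hij hi hj)) using 1
      ring
    have := hL.isPrime hij
    simpa [hc', hi, hj] using
      Ideal.mem_span_pair_pow_of_mul_mem (hL.prime i) (hL.not_dvd hij) (hL.notMem hij hi hj) h1
  have hlt : ∑ i, (N - c' i) < d := by
    rw [← hd]
    exact Finset.sum_lt_sum (fun i _ => by simp only [hc']; omega)
      ⟨s, Finset.mem_univ s, by simp only [hc', if_pos]; omega⟩
  have h1 := ih _ hlt c' hH rfl
  have h2 : (∏ j, L j ^ c' j) = (∏ j, L j ^ c j) * L s := by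
    simp only [hc', pow_add, Finset.prod_mul_distrib]
    simp
  have h3 : (∏ j, L j ^ c j) * A =
      ∏ j, L j ^ (c j + if j = s then 0 else N - c s - c j) := by
    simp only [pow_add, Finset.prod_mul_distrib, hA]
    congr 1
    rw [← Finset.mul_prod_erase Finset.univ _ (Finset.mem_univ s)]
    simp only [if_pos, pow_zero, one_mul]
    exact Finset.prod_congr rfl fun j hj => by rw [if_neg (Finset.ne_of_mem_erase hj)]
  have h4 : (∏ j, L j ^ c j) * A ∈ J := by
    rw [h3]
    refine hJ _ fun i j hij => ?_
    split_ifs with hi hj hj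
    · exact absurd (hi.trans hj.symm) hij
    · subst hi; omega
    · subst hj; omega
    · omega
  convert add_mem h1 (Ideal.mul_mem_left _ G h4) using 1
  rw [h2]
  ring

theorem IsStarFamily.starPow_le [Nonempty ι] {L : ι → R} (hL : IsStarFamily L) {N : ℕ}
    {J : Ideal R}
    (hJ : ∀ k n i, 2 * k + n = N →
      (∏ j, L j) ^ k * (∏ j ∈ Finset.univ.erase i, L j) ^ n ∈ J) :
    starPow L N ≤ J := by
  intro F hF
  have := hL.prod_pow_mul_mem (N := N) (J := J)
    (fun a ha => prod_pow_mem_of_extremal_mem hJ ha) 0 (F := F)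
    (fun i j hij => by simpa using mem_starPow.1 hF i j hij)
  simpa using this

theorem IsStarFamily.starPow_even_le [Nonempty ι] {L : ι → R} (hL : IsStarFamily L) (q : ℕ) :
    starPow L (2 * q) ≤ starPow L 2 ^ q := by
  refine hL.starPow_le fun k n i h => ?_
  obtain ⟨n, rfl⟩ : ∃ l, n = 2 * l := ⟨q - k, by omega⟩
  obtain rfl : q = k + n := by omega
  rw [pow_mul, pow_add]
  exact Ideal.mul_mem_mul (Ideal.pow_mem_pow (prod_mem_starPow_two L) _)
    (Ideal.pow_mem_pow (pow_mem_starPow (prod_erase_mem_starPow_one L i) 2) _)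

theorem IsStarFamily.starPow_odd_le [Nonempty ι] {L : ι → R} (hL : IsStarFamily L) (q : ℕ) :
    starPow L (2 * q + 1) ≤ starPow L 2 ^ q * starPow L 1 := by
  refine hL.starPow_le fun k n i h => ?_
  obtain ⟨n, rfl⟩ : ∃ l, n = 2 * l + 1 := ⟨q - k, by omega⟩
  obtain rfl : q = k + n := by omega
  rw [pow_succ, ← mul_assoc, pow_mul, pow_add]
  exact Ideal.mul_mem_mul (Ideal.mul_mem_mul (Ideal.pow_mem_pow (prod_mem_starPow_two L) _)
    (Ideal.pow_mem_pow (pow_mem_starPow (prod_erase_mem_starPow_one L i) 2) _))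
    (prod_erase_mem_starPow_one L i)

theorem IsStarFamily.starPow_mul_le [Nonempty ι] {L : ι → R} (hL : IsStarFamily L)
    {N : ℕ} (hN : Even N) (t : ℕ) : starPow L (t * N) ≤ starPow L N ^ t := by
  obtain ⟨r, rfl⟩ := hN
  calc starPow L (t * (r + r)) = starPow L (2 * (r * t)) := by congr 1; ring
    _ ≤ starPow L 2 ^ (r * t) := hL.starPow_even_le _
    _ = (starPow L 2 ^ r) ^ t := pow_mul _ _ _
    _ ≤ starPow L (2 * r) ^ t := Ideal.pow_right_mono (starPow_pow_le L 2 r) t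
    _ = starPow L (r + r) ^ t := by rw [two_mul]

variable [Nontrivial ι] {L : ι → R} {M : Ideal R}

theorem IsStarFamily.starPow_succ_le (hL : IsStarFamily L) (hM : ∀ i, L i ∈ M) (N : ℕ) :
    starPow L (N + 1) ≤ M * starPow L N := by
  have hgen : ∀ k n i, (∏ j, L j) ^ k * (∏ j ∈ Finset.univ.erase i, L j) ^ n ∈
      starPow L (2 * k + n) := by
    intro k n i
    have := mul_mem_starPow (pow_mem_starPow (prod_mem_starPow_two L) k)
      (pow_mem_starPow (prod_erase_mem_starPow_one L i) n)
    rwa [one_mul] at this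
  refine hL.starPow_le fun k n i h => ?_
  cases n with
  | zero =>
    obtain ⟨k, rfl⟩ : ∃ l, k = l + 1 := ⟨k - 1, by omega⟩
    obtain rfl : N = 2 * k + 1 := by omega
    convert Ideal.mul_mem_mul (hM i) (hgen k 1 i) using 1
    rw [pow_zero, mul_one, pow_one, mul_left_comm,
      Finset.mul_prod_erase Finset.univ L (Finset.mem_univ i), pow_succ]
  | succ n =>
    obtain rfl : N = 2 * k + n := by omega
    obtain ⟨j, hj⟩ := exists_ne i
    have hj' : j ∈ Finset.univ.erase i := by simp [hj]
    convert Ideal.mul_mem_mul (Ideal.mem_of_dvd _ (Finset.dvd_prod_of_mem L hj') (hM j))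
      (hgen k n i) using 1
    rw [pow_succ]
    ring

theorem IsStarFamily.starPow_add_le (hL : IsStarFamily L) (hM : ∀ i, L i ∈ M) (N t : ℕ) :
    starPow L (N + t) ≤ M ^ t * starPow L N := by
  induction t with
  | zero => simp
  | succ t ih =>
    rw [← add_assoc, pow_succ', mul_assoc]
    exact (hL.starPow_succ_le hM _).trans (Ideal.mul_mono_right ih)

theorem IsStarFamily.starPow_containment (hL : IsStarFamily L) (hM : ∀ i, L i ∈ M) (m t : ℕ) :
    starPow L (t * (m + 1)) ≤ M ^ t * starPow L m ^ t := by
  rcases Nat.even_or_odd m with hm | hm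
  · rw [mul_add, mul_one]
    exact (hL.starPow_add_le hM _ _).trans (Ideal.mul_mono_right (hL.starPow_mul_le hm t))
  · rw [← mul_pow]
    exact (hL.starPow_mul_le hm.add_one t).trans
      (Ideal.pow_right_mono (hL.starPow_succ_le hM m) t)

theorem IsStarFamily.starPow_pred_containment (hL : IsStarFamily L) (hM : ∀ i, L i ∈ M)
    (m : ℕ) {t : ℕ} (ht : 1 ≤ t) :
    starPow L (t * (m + 1) - 1) ≤ M ^ (t - 1) * starPow L m ^ t := by
  obtain ⟨t, rfl⟩ : ∃ l, t = l + 1 := ⟨t - 1, by omega⟩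
  rw [Nat.add_sub_cancel]
  rcases Nat.even_or_odd m with hm | ⟨r, rfl⟩
  · rw [show (t + 1) * (m + 1) - 1 = (t + 1) * m + t by
      exact Nat.sub_eq_of_eq_add (by ring)]
    exact (hL.starPow_add_le hM _ _).trans (Ideal.mul_mono_right (hL.starPow_mul_le hm _))
  · rw [show (t + 1) * (2 * r + 1 + 1) - 1 = 2 * ((r + 1) * t + r) + 1 by
      exact Nat.sub_eq_of_eq_add (by ring)]
    refine (hL.starPow_odd_le _).trans ?_
    rw [pow_add, pow_mul, mul_assoc, pow_succ (starPow L (2 * r + 1)), ← mul_assoc (M ^ t),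
      ← mul_pow M]
    refine Ideal.mul_mono (Ideal.pow_right_mono ?_ t) ?_
    · exact (starPow_pow_le L 2 (r + 1)).trans (hL.starPow_succ_le hM (2 * r + 1))
    · intro F hF
      refine Submodule.mul_induction_on hF (fun a ha b hb => ?_) fun a b ha hb => add_mem ha hb
      exact mul_mem_starPow (starPow_pow_le L 2 r ha) hb

end Fintype

end StarConfiguration

section LinearForms

variable {K : Type*} [Field K]

theorem MvPolynomial.IsHomogeneous.exists_eq_sum_C_mul_X {σ : Type*} [Fintype σ]
    {F : MvPolynomial σ K} (hF : F.IsHomogeneous 1) : ∃ a : σ → K, F = ∑ i, C (a i) * X i := by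
  rw [← mem_homogeneousSubmodule, homogeneousSubmodule_one_eq_span_X,
    Submodule.mem_span_range_iff_exists_fun] at hF
  obtain ⟨a, rfl⟩ := hF
  exact ⟨a, by simp [smul_eq_C_mul]⟩

theorem MvPolynomial.IsHomogeneous.mem_span_pair_of_eval_eq_zero
    {F G H : MvPolynomial (Fin 3) K} (hF : F.IsHomogeneous 1) (hG : G.IsHomogeneous 1)
    (hH : H.IsHomogeneous 1) (hG0 : G ≠ 0) (hFG : ∀ c : K, F ≠ c • G) {p : Fin 3 → K}
    (hp : p ≠ 0) (hFp : eval p F = 0) (hGp : eval p G = 0) (hHp : eval p H = 0) :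
    H ∈ Ideal.span {F, G} := by
  obtain ⟨a, ha⟩ := hF.exists_eq_sum_C_mul_X
  obtain ⟨b, hb⟩ := hG.exists_eq_sum_C_mul_X
  obtain ⟨c, hc⟩ := hH.exists_eq_sum_C_mul_X
  have hdet : (Matrix.of ![a, b, c]).det = 0 := by
    refine Matrix.exists_mulVec_eq_zero_iff.1 ⟨p, hp, ?_⟩
    rw [ha] at hFp
    rw [hb] at hGp
    rw [hc] at hHp
    ext i
    fin_cases i
    · simpa [Matrix.mulVec, dotProduct] using hFp
    · simpa [Matrix.mulVec, dotProduct] using hGp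
    · simpa [Matrix.mulVec, dotProduct] using hHp
  obtain ⟨w, hw, hw0⟩ := Matrix.exists_vecMul_eq_zero_iff.2 hdet
  have hrel : C (w 0) * F + C (w 1) * G + C (w 2) * H = 0 := by
    have h (i : Fin 3) : w 0 * a i + w 1 * b i + w 2 * c i = 0 := by
      simpa [Matrix.vecMul, dotProduct, Fin.sum_univ_three] using congrFun hw0 i
    calc C (w 0) * F + C (w 1) * G + C (w 2) * H
        = ∑ i, C (w 0 * a i + w 1 * b i + w 2 * c i) * X i := by
          rw [ha, hb, hc]
          simp only [Finset.mul_sum, ← Finset.sum_add_distrib, C_add, map_mul]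
          exact Finset.sum_congr rfl fun i _ => by ring
      _ = 0 := by simp [h]
  have hinv {x : K} (hx : x ≠ 0) : (C x⁻¹ * C x : MvPolynomial (Fin 3) K) = 1 := by
    rw [← map_mul, inv_mul_cancel₀ hx, C_1]
  have hw2 : w 2 ≠ 0 := by
    intro h2
    by_cases h0 : w 0 = 0
    · have h1 : w 1 = 0 := by simpa [h0, h2, hG0] using hrel
      exact hw (by ext i; fin_cases i <;> assumption)
    · refine hFG (-((w 0)⁻¹ * w 1)) ?_
      rw [h2] at hrel
      rw [smul_eq_C_mul, map_neg, map_mul]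
      simp only [C_0, zero_mul, add_zero] at hrel
      linear_combination C (w 0)⁻¹ * hrel - F * hinv h0
  refine Ideal.mem_span_pair.2 ⟨-(C (w 2)⁻¹ * C (w 0)), -(C (w 2)⁻¹ * C (w 1)), ?_⟩
  linear_combination -C (w 2)⁻¹ * hrel + H * hinv hw2

/-- Restriction of a polynomial to the line through the origin spanned by `p`. -/
def restrictLine {σ : Type*} (p : σ → K) : MvPolynomial σ K →ₐ[K] Polynomial K :=
  aeval fun i => Polynomial.C (p i) * Polynomial.X

theorem MvPolynomial.IsHomogeneous.restrictLine_eq {σ : Type*} (p : σ → K)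
    {F : MvPolynomial σ K} {d : ℕ} (hF : F.IsHomogeneous d) :
    restrictLine p F = Polynomial.C (eval p F) * Polynomial.X ^ d := by
  rw [restrictLine, aeval_def, eval₂_eq, eval_eq, map_sum, Finset.sum_mul]
  refine Finset.sum_congr rfl fun e he => ?_
  have hd : ∑ i ∈ e.support, e i = d := (hF.degree_eq_sum_deg_support he).symm
  simp only [mul_pow, Finset.prod_mul_distrib, Finset.prod_pow_eq_pow_sum, hd, map_mul, map_prod,
    map_pow, mul_assoc]
  rfl

theorem homVanishingIdeal_le_ker {σ : Type*} (p : σ → K) :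
    homVanishingIdeal p ≤ RingHom.ker (restrictLine p) := by
  rw [homVanishingIdeal, Ideal.span_le]
  rintro F ⟨⟨d, hd⟩, hF⟩
  simp [RingHom.mem_ker, hd.restrictLine_eq, hF]

theorem ker_restrictLine_le_span_pair {F G : MvPolynomial (Fin 3) K} (hF : F.IsHomogeneous 1)
    (hG : G.IsHomogeneous 1) (hG0 : G ≠ 0) (hFG : ∀ c : K, F ≠ c • G) {p : Fin 3 → K}
    (hp : p ≠ 0) (hFp : eval p F = 0) (hGp : eval p G = 0) :
    RingHom.ker (restrictLine p) ≤ Ideal.span {F, G} := by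
  obtain ⟨k, hk⟩ := Function.ne_iff.1 hp
  set Z : MvPolynomial (Fin 3) K := C (p k)⁻¹ * X k with hZ
  have hX (i : Fin 3) : X i - C (p i) * Z ∈ Ideal.span {F, G} := by
    refine hF.mem_span_pair_of_eval_eq_zero hG ?_ hG0 hFG hp hFp hGp ?_
    · rw [hZ, ← mul_assoc, ← C_mul]
      exact (isHomogeneous_X K i).sub (isHomogeneous_C_mul_X _ _)
    · simp only [hZ, map_sub, map_mul, eval_X, eval_C]
      rw [inv_mul_cancel₀ hk, mul_one, sub_self]
  have hcomp : (Ideal.Quotient.mkₐ K (Ideal.span {F, G})) =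
      ((Ideal.Quotient.mkₐ K (Ideal.span {F, G})).comp (Polynomial.aeval Z)).comp
        (restrictLine p) := by
    ext i
    simp only [restrictLine, AlgHom.comp_apply, aeval_X]
    refine Ideal.Quotient.eq.2 ?_
    rw [map_mul, Polynomial.aeval_C, Polynomial.aeval_X]
    exact hX i
  intro H hH
  have h := DFunLike.congr_fun hcomp H
  rw [RingHom.mem_ker] at hH
  rw [AlgHom.comp_apply, hH, map_zero] at h
  exact Ideal.Quotient.eq_zero_iff_mem.1 h

theorem homVanishingIdeal_eq_ker {F G : MvPolynomial (Fin 3) K} (hF : F.IsHomogeneous 1)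
    (hG : G.IsHomogeneous 1) (hG0 : G ≠ 0) (hFG : ∀ c : K, F ≠ c • G) {p : Fin 3 → K}
    (hp : p ≠ 0) (hFp : eval p F = 0) (hGp : eval p G = 0) :
    homVanishingIdeal p = Ideal.span {F, G} ∧
      RingHom.ker (restrictLine p) = Ideal.span {F, G} := by
  have h1 := ker_restrictLine_le_span_pair hF hG hG0 hFG hp hFp hGp
  have h2 := homVanishingIdeal_le_ker p
  have h3 : Ideal.span {F, G} ≤ homVanishingIdeal p := by
    rw [Ideal.span_le]
    rintro x (rfl | rfl)
    · exact Ideal.subset_span ⟨⟨1, hF⟩, hFp⟩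
    · exact Ideal.subset_span ⟨⟨1, hG⟩, hGp⟩
  exact ⟨le_antisymm (h2.trans h1) h3, le_antisymm h1 (h3.trans h2)⟩

theorem MvPolynomial.IsHomogeneous.prime_of_degree_one {σ : Type*} {F : MvPolynomial σ K}
    (hF : F.IsHomogeneous 1) (hF0 : F ≠ 0) : Prime F := by
  refine (irreducible_of_totalDegree_eq_one (hF.totalDegree hF0) fun x hx => ?_).prime
  obtain ⟨d, hd⟩ := ne_zero_iff.1 hF0
  exact isUnit_iff_ne_zero.2 fun h => hd (zero_dvd_iff.1 (h ▸ hx d))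

theorem MvPolynomial.IsHomogeneous.exists_eq_smul_of_dvd {σ : Type*} {F G : MvPolynomial σ K}
    (hF : F.IsHomogeneous 1) (hG : G.IsHomogeneous 1) (hG0 : G ≠ 0) (h : F ∣ G) :
    ∃ c : K, G = c • F := by
  obtain ⟨H, rfl⟩ := h
  have hF0 := left_ne_zero_of_mul hG0
  have hdeg := totalDegree_mul_of_isDomain hF0 (right_ne_zero_of_mul hG0)
  rw [hG.totalDegree hG0, hF.totalDegree hF0] at hdeg
  have hH := totalDegree_eq_zero_iff_eq_C.1 (show H.totalDegree = 0 by omega)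
  exact ⟨coeff 0 H, by rw [smul_eq_C_mul, ← hH, mul_comm]⟩

theorem isStarFamily_of_lines {s : ℕ} {L : Fin s → MvPolynomial (Fin 3) K}
    (hL1 : ∀ i, (L i).IsHomogeneous 1) (hL0 : ∀ i, L i ≠ 0)
    (hLdist : Pairwise fun i j => ∀ c : K, L i ≠ c • L j)
    (hL3 : ∀ i j k : Fin s, i ≠ j → i ≠ k → j ≠ k → ∀ p : Fin 3 → K, p ≠ 0 →
      eval p (L i) = 0 → eval p (L j) = 0 → eval p (L k) ≠ 0)
    (P : {q : Fin s × Fin s // q.1 < q.2} → (Fin 3 → K)) (hP : ∀ q, P q ≠ 0)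
    (hPL : ∀ q, eval (P q) (L q.1.1) = 0 ∧ eval (P q) (L q.1.2) = 0) :
    IsStarFamily L := by
  have hpt (i j : Fin s) (hij : i ≠ j) :
      ∃ p : Fin 3 → K, p ≠ 0 ∧ eval p (L i) = 0 ∧ eval p (L j) = 0 := by
    rcases lt_or_gt_of_ne hij with h | h
    · exact ⟨_, hP ⟨(i, j), h⟩, hPL ⟨(i, j), h⟩⟩
    · exact ⟨_, hP ⟨(j, i), h⟩, (hPL ⟨(j, i), h⟩).symm⟩
  refine ⟨fun i => (hL1 i).prime_of_degree_one (hL0 i), fun {i j} hij hdvd => ?_,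
    fun {i j} hij => ?_, fun {i j k} hij hik hjk hmem => ?_⟩
  · obtain ⟨c, hc⟩ := (hL1 i).exists_eq_smul_of_dvd (hL1 j) (hL0 j) hdvd
    exact hLdist hij.symm c hc
  · obtain ⟨p, hp, hi, hj⟩ := hpt i j hij
    rw [← (homVanishingIdeal_eq_ker (hL1 i) (hL1 j) (hL0 j) (hLdist hij) hp hi hj).2]
    exact RingHom.ker_isPrime _
  · obtain ⟨p, hp, hi, hj⟩ := hpt i j hij
    rw [← (homVanishingIdeal_eq_ker (hL1 i) (hL1 j) (hL0 j) (hLdist hij) hp hi hj).2,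
      RingHom.mem_ker, (hL1 k).restrictLine_eq] at hmem
    exact hL3 i j k hij hik hjk p hp hi hj (by simpa using hmem)

theorem symbPow_eq_starPow {s : ℕ} {L : Fin s → MvPolynomial (Fin 3) K}
    (hL1 : ∀ i, (L i).IsHomogeneous 1) (hL0 : ∀ i, L i ≠ 0)
    (hLdist : Pairwise fun i j => ∀ c : K, L i ≠ c • L j)
    (P : {q : Fin s × Fin s // q.1 < q.2} → (Fin 3 → K)) (hP : ∀ q, P q ≠ 0)
    (hPL : ∀ q, eval (P q) (L q.1.1) = 0 ∧ eval (P q) (L q.1.2) = 0) (N : ℕ) :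
    symbPow P N = starPow L N := by
  have hspan (q : {q : Fin s × Fin s // q.1 < q.2}) :
      homVanishingIdeal (P q) = Ideal.span {L q.1.1, L q.1.2} :=
    (homVanishingIdeal_eq_ker (hL1 _) (hL1 _) (hL0 _) (hLdist q.2.ne) (hP q) (hPL q).1
      (hPL q).2).1
  simp only [symbPow, hspan]
  refine le_antisymm ?_ (le_iInf fun q F hF => mem_starPow.1 hF _ _ q.2.ne)
  intro F hF
  rw [Submodule.mem_iInf] at hF
  refine mem_starPow.2 fun i j hij => ?_
  rcases lt_or_gt_of_ne hij with h | h
  · exact hF ⟨(i, j), h⟩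
  · rw [Set.pair_comm]
    exact hF ⟨(j, i), h⟩

theorem MvPolynomial.IsHomogeneous.mem_irrel {σ : Type*} {F : MvPolynomial σ K}
    (hF : F.IsHomogeneous 1) : F ∈ irrel K σ := by
  rw [← mem_homogeneousSubmodule, homogeneousSubmodule_one_eq_span_X] at hF
  exact Submodule.span_le_restrictScalars K (MvPolynomial σ K) _ hF

end LinearForms

/-- In characteristic 0, for the radical ideal of the star configuration of
points in `P^2` defined by `s ≥ 2` lines, `I^{(t(m+1))} ⊆ M^t (I^{(m)})^t` and
`I^{(t(m+1)-1)} ⊆ M^{t-1} (I^{(m)})^t` for all `m, t ≥ 1`. -/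
theorem stmt12 {K : Type*} [Field K] [IsAlgClosed K] [CharZero K]
    {s : ℕ} (hs : 2 ≤ s)
    (L : Fin s → MvPolynomial (Fin 3) K)
    (hL1 : ∀ i, (L i).IsHomogeneous 1) (hL0 : ∀ i, L i ≠ 0)
    (hLdist : Pairwise fun i j => ∀ c : K, L i ≠ c • L j)
    (hL3 : ∀ i j k : Fin s, i ≠ j → i ≠ k → j ≠ k → ∀ p : Fin 3 → K, p ≠ 0 →
      MvPolynomial.eval p (L i) = 0 → MvPolynomial.eval p (L j) = 0 →
      MvPolynomial.eval p (L k) ≠ 0)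
    (P : {q : Fin s × Fin s // q.1 < q.2} → (Fin 3 → K)) (hP : ProjectivelyDistinct P)
    (hPL : ∀ q, MvPolynomial.eval (P q) (L q.1.1) = 0 ∧
      MvPolynomial.eval (P q) (L q.1.2) = 0)
    (m t : ℕ) (hm : 1 ≤ m) (ht : 1 ≤ t) :
    symbPow P (t * (m + 1)) ≤ irrel K (Fin 3) ^ t * symbPow P m ^ t ∧
    symbPow P (t * (m + 1) - 1) ≤ irrel K (Fin 3) ^ (t - 1) * symbPow P m ^ t := by
  have hstar := isStarFamily_of_lines hL1 hL0 hLdist hL3 P hP.1 hPL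
  have hM : ∀ i, L i ∈ irrel K (Fin 3) := fun i => (hL1 i).mem_irrel
  have : Nontrivial (Fin s) := Fin.nontrivial_iff_two_le.2 hs
  simp only [symbPow_eq_starPow hL1 hL0 hLdist P hP.1 hPL]
  exact ⟨hstar.starPow_containment hM m t, hstar.starPow_pred_containment hM m ht⟩
end
end

section
/- Assume K has characteristic 0 and let 1 ≤ N ≤ d be integers. Let Z = {P_1, …, P_n} be a star configuration of points in P^N, where P^N is embedded as a linear subspace of P^d, and let I ⊆ K[x_0, …, x_d] be the radical ideal of these points regarded as points of P^d, with M the irrelevant maximal ideal of K[x_0, …, x_d]. Then for every integer r ≥ 1: (a) I^{(rd)} ⊆ M^{r(d−1)} I^r, and (b) I^{(rd−(d−1))} ⊆ M^{(r−1)(d−1)} I^r. -/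
open MvPolynomial

noncomputable section

theorem Ideal.sup_pow_le_pow_sup {R : Type*} [CommSemiring R] (A B : Ideal R) (k : ℕ) :
    (A ⊔ B) ^ k ≤ A ^ k ⊔ B := by
  induction k with
  | zero => simp
  | succ k ih =>
    rw [pow_succ, pow_succ]
    refine (Ideal.mul_mono ih le_rfl).trans ?_
    rw [Ideal.sup_mul, Ideal.mul_sup]
    exact sup_le (sup_le le_sup_left (le_sup_of_le_right Ideal.mul_le_right))
      (le_sup_of_le_right Ideal.mul_le_left)

theorem prod_pow_mem_span_image_pow {R ι : Type*} [CommSemiring R] [Fintype ι] [DecidableEq ι]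
    (h : ι → R) (a : ι → ℕ) (S : Finset ι) {k : ℕ} (hk : k ≤ ∑ i ∈ S, a i) :
    ∏ i, h i ^ a i ∈ Ideal.span (h '' (S : Set ι)) ^ k := by
  refine Ideal.pow_le_pow_right hk ?_
  rw [← Finset.prod_mul_prod_compl S, ← Finset.prod_pow_eq_pow_sum]
  refine Ideal.mul_mem_right _ _ (Ideal.prod_mem_prod fun i hi => Ideal.pow_mem_pow ?_ _)
  exact Ideal.subset_span ⟨i, hi, rfl⟩

/-- Membership in an intersection of powers of ideals generated by bases of a matroid
is witnessed by products of the generators, provided the generators behave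
like variables of a polynomial ring. -/
theorem mem_span_prod_pow_sup {R ι : Type*} [CommRing R] [Fintype ι] [DecidableEq ι]
    (h : ι → R) (B : Finset (Finset ι))
    (exch : ∀ T ∈ B, ∀ C ⊆ T, ∀ x ∉ T, ∀ T' ∈ B, insert x C ⊆ T' →
      ∃ y ∈ T \ C, insert x (T.erase y) ∈ B)
    (cancel_notMem : ∀ T ∈ B, ∀ C ⊆ T, ∀ x ∉ T, ∀ (k : ℕ) (F : R),
      h x * F ∈ Ideal.span (h '' ((T \ C : Finset ι) : Set ι)) ^ k ⊔
        Ideal.span (h '' (C : Set ι)) →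
      F ∈ Ideal.span (h '' ((T \ C : Finset ι) : Set ι)) ^ k ⊔ Ideal.span (h '' (C : Set ι)))
    (cancel_mem : ∀ T ∈ B, ∀ C ⊆ T, ∀ x ∈ T \ C, ∀ (k : ℕ) (F : R),
      h x * F ∈ Ideal.span (h '' ((T \ C : Finset ι) : Set ι)) ^ (k + 1) ⊔
        Ideal.span (h '' (C : Set ι)) →
      F ∈ Ideal.span (h '' ((T \ C : Finset ι) : Set ι)) ^ k ⊔ Ideal.span (h '' (C : Set ι)))
    (C : Finset ι) (m : ℕ) (b : ι → ℕ) (F : R)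
    (hF : ∀ T ∈ B, C ⊆ T →
      F ∈ Ideal.span (h '' ((T \ C : Finset ι) : Set ι)) ^ (m - ∑ i ∈ T \ C, b i) ⊔
        Ideal.span (h '' (C : Set ι))) :
    F ∈ Ideal.span {g | ∃ a : ι → ℕ,
        (∀ T ∈ B, C ⊆ T → m ≤ ∑ i ∈ T \ C, (a i + b i)) ∧ g = ∏ i, h i ^ a i} ⊔
      Ideal.span (h '' (C : Set ι)) := by
  induction hn : Cᶜ.card using Nat.strong_induction_on generalizing C m b F with
  | _ n ihC =>
  induction hw : ∑ T ∈ B with C ⊆ T, (m - ∑ i ∈ T \ C, b i) using Nat.strong_induction_on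
    generalizing b F with
  | _ w ihw =>
  by_cases hall : ∀ T ∈ B, C ⊆ T → m ≤ ∑ i ∈ T \ C, b i
  · have h1 : (1 : R) ∈ Ideal.span {g | ∃ a : ι → ℕ,
        (∀ T ∈ B, C ⊆ T → m ≤ ∑ i ∈ T \ C, (a i + b i)) ∧ g = ∏ i, h i ^ a i} :=
      Ideal.subset_span ⟨0, by simpa using hall, by simp⟩
    rw [(Ideal.eq_top_iff_one _).2 h1]
    simp
  push Not at hall
  obtain ⟨T₀, hT₀, hCT₀, hlt⟩ := hall
  by_cases hTC : T₀ \ C = ∅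
  · have := hF T₀ hT₀ hCT₀
    rw [hTC] at this hlt
    simp only [Finset.sum_empty, Finset.coe_empty, Set.image_empty, Ideal.span_empty,
      Nat.sub_zero] at this hlt
    rw [← Ideal.zero_eq_bot, zero_pow hlt.ne', Ideal.zero_eq_bot, bot_sup_eq] at this
    exact Ideal.mem_sup_right this
  obtain ⟨x, hx, hxmin⟩ := Finset.exists_min_image
    (Finset.univ.filter fun x => x ∉ C ∧ ∃ T ∈ B, insert x C ⊆ T) b (by
      obtain ⟨x, hx⟩ := Finset.nonempty_iff_ne_empty.2 hTC
      rw [Finset.mem_sdiff] at hx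
      exact ⟨x, by simp [hx.2]; exact ⟨T₀, hT₀, Finset.insert_subset hx.1 hCT₀⟩⟩)
  simp only [Finset.mem_filter, Finset.mem_univ, true_and] at hx hxmin
  obtain ⟨hxC, T₁, hT₁, hxT₁⟩ := hx
  have sdiff_insert : ∀ T : Finset ι, x ∈ T → insert x (T \ insert x C) = T \ C := by
    intro T hxT
    ext i
    by_cases hi : i = x
    · subst hi; simp [hxT, hxC]
    · simp [hi]
  have sum_split : ∀ (f : ι → ℕ) (T : Finset ι), x ∈ T →
      ∑ i ∈ T \ C, f i = f x + ∑ i ∈ T \ insert x C, f i := by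
    intro f T hxT
    rw [← sdiff_insert T hxT, Finset.sum_insert (by simp)]
  -- exchanging `x` into a basis
  have exchange : ∀ T ∈ B, C ⊆ T → x ∉ T → ∃ y ∈ T \ C, b x ≤ b y ∧
      insert x (T.erase y) ∈ B ∧ insert x C ⊆ insert x (T.erase y) ∧
      ∀ f : ι → ℕ, ∑ i ∈ T \ C, f i =
        f y + ∑ i ∈ insert x (T.erase y) \ insert x C, f i := by
    intro T hT hCT hxT
    obtain ⟨y, hy, hyB⟩ := exch T hT C hCT x hxT T₁ hT₁ hxT₁
    have hy' := Finset.mem_sdiff.1 hy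
    refine ⟨y, hy, hxmin y ⟨hy'.2, T, hT, Finset.insert_subset hy'.1 hCT⟩, hyB, ?_, ?_⟩
    · refine Finset.insert_subset_insert _ fun i hi => Finset.mem_erase.2 ⟨?_, hCT hi⟩
      rintro rfl
      exact hy'.2 hi
    · intro f
      have : insert x (T.erase y) \ insert x C = (T \ C).erase y := by
        ext i
        by_cases hi : i = x
        · subst hi; simp [hxT]
        · simp [hi, and_assoc]
      rw [this, Finset.add_sum_erase _ _ hy]
  set A := Ideal.span {g | ∃ a : ι → ℕ,
        (∀ T ∈ B, C ⊆ T → m ≤ ∑ i ∈ T \ C, (a i + b i)) ∧ g = ∏ i, h i ^ a i} with hA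
  -- restriction to `h x = 0`
  have hres := ihC (insert x C)ᶜ.card (by
      rw [← hn]
      refine Finset.card_lt_card (Finset.compl_ssubset_compl.2 (Finset.ssubset_insert hxC)))
    (insert x C) (m - b x) b F (by
      intro T hT hCT
      have hxT : x ∈ T := hCT (Finset.mem_insert_self _ _)
      have := hF T hT ((Finset.subset_insert _ _).trans hCT)
      rw [sum_split b T hxT, ← Nat.sub_sub, ← sdiff_insert T hxT, Finset.coe_insert,
        Set.image_insert_eq, Ideal.span_insert, sup_comm (Ideal.span {h x})] at this
      rw [Finset.coe_insert, Set.image_insert_eq, Ideal.span_insert, ← sup_assoc]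
      exact SetLike.le_def.1 (sup_le_sup_right (Ideal.sup_pow_le_pow_sup _ _ _) _) this) rfl
  have hle : Ideal.span {g | ∃ a : ι → ℕ, (∀ T ∈ B, insert x C ⊆ T →
      m - b x ≤ ∑ i ∈ T \ insert x C, (a i + b i)) ∧ g = ∏ i, h i ^ a i} ≤ A := by
    refine Ideal.span_mono ?_
    rintro g ⟨a, ha, rfl⟩
    refine ⟨a, fun T hT hCT => ?_, rfl⟩
    by_cases hxT : x ∈ T
    · have := ha T hT (Finset.insert_subset hxT hCT)
      rw [sum_split _ T hxT]
      omega
    · obtain ⟨y, -, hxy, hB, hsub, hsum⟩ := exchange T hT hCT hxT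
      have := ha _ hB hsub
      rw [hsum]
      omega
  rw [Finset.coe_insert, Set.image_insert_eq, Ideal.span_insert] at hres
  obtain ⟨G, hG, c, hc, rfl⟩ := Submodule.mem_sup.1 hres
  obtain ⟨e, he, c', hc', rfl⟩ := Submodule.mem_sup.1 hc
  obtain ⟨F', rfl⟩ := Ideal.mem_span_singleton'.1 he
  have hAle : ∀ T ∈ B, C ⊆ T →
      A ≤ Ideal.span (h '' ((T \ C : Finset ι) : Set ι)) ^ (m - ∑ i ∈ T \ C, b i) := by
    intro T hT hCT
    rw [hA, Ideal.span_le]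
    rintro g ⟨a, ha, rfl⟩
    refine prod_pow_mem_span_image_pow h a _ ?_
    have := ha T hT hCT
    rw [Finset.sum_add_distrib] at this
    omega
  have hxF' : ∀ T ∈ B, C ⊆ T →
      h x * F' ∈ Ideal.span (h '' ((T \ C : Finset ι) : Set ι)) ^ (m - ∑ i ∈ T \ C, b i) ⊔
        Ideal.span (h '' (C : Set ι)) := by
    intro T hT hCT
    have h1 := hF T hT hCT
    have h2 := Ideal.sub_mem _ h1
      (Ideal.mem_sup_left (hAle T hT hCT (hle hG)))
    have h3 := Ideal.sub_mem _ h2 (Ideal.mem_sup_right hc')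
    convert h3 using 1
    ring
  have sum_update : ∀ T : Finset ι, ∑ i ∈ T \ C, (b + Pi.single x 1 : ι → ℕ) i =
      ∑ i ∈ T \ C, b i + if x ∈ T then 1 else 0 := by
    intro T
    simp [Finset.sum_add_distrib, hxC]
  have hF' := ihw (∑ T ∈ B with C ⊆ T, (m - ∑ i ∈ T \ C, (b + Pi.single x 1 : ι → ℕ) i)) (by
      rw [← hw]
      refine Finset.sum_lt_sum (fun T _ => by rw [sum_update]; omega) ?_
      by_cases hxT : x ∈ T₀
      · refine ⟨T₀, by simp [hT₀, hCT₀], ?_⟩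
        rw [sum_update, if_pos hxT]
        omega
      · obtain ⟨y, -, hxy, hB, hsub, hsum⟩ := exchange T₀ hT₀ hCT₀ hxT
        refine ⟨_, Finset.mem_filter.2 ⟨hB, (Finset.subset_insert _ _).trans hsub⟩, ?_⟩
        rw [sum_update, if_pos (Finset.mem_insert_self _ _),
          sum_split _ _ (Finset.mem_insert_self _ _)]
        have := hsum b
        omega) (b + Pi.single x 1) F' (by
      intro T hT hCT
      rw [sum_update]
      by_cases hxT : x ∈ T
      · rw [if_pos hxT]
        rcases Nat.eq_zero_or_pos (m - ∑ i ∈ T \ C, b i) with h0 | h0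
        · rw [show m - (∑ i ∈ T \ C, b i + 1) = 0 by omega]
          simp
        · refine cancel_mem T hT C hCT x (by simp [hxT, hxC]) _ _ ?_
          convert hxF' T hT hCT using 3
          omega
      · rw [if_neg hxT]
        exact cancel_notMem T hT C hCT x hxT _ _ (hxF' T hT hCT)) rfl
  have hmul : h x * F' ∈ A ⊔ Ideal.span (h '' (C : Set ι)) := by
    obtain ⟨G', hG', c'', hc'', rfl⟩ := Submodule.mem_sup.1 hF'
    rw [mul_add]
    refine Ideal.add_mem _ (Ideal.mem_sup_left ?_)
      (Ideal.mem_sup_right (Ideal.mul_mem_left _ _ hc''))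
    refine Submodule.span_induction ?_ (by simp) ?_ ?_ hG'
    · rintro g ⟨a, ha, rfl⟩
      refine Ideal.subset_span ⟨a + Pi.single x 1, fun T hT hCT => ?_, ?_⟩
      · convert ha T hT hCT using 2
        simp only [Pi.add_apply]
        ring
      · simp only [Pi.add_apply, pow_add, Finset.prod_mul_distrib]
        rw [mul_comm]
        congr 1
        rw [Finset.prod_eq_single x (fun i _ hi => by simp [hi]) (by simp)]
        simp
    · intro u v _ _ hu hv
      rw [mul_add]
      exact Ideal.add_mem _ hu hv
    · intro r u _ hu
      rw [smul_eq_mul, mul_left_comm]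
      exact Ideal.mul_mem_left _ _ hu
  refine Ideal.add_mem _ (Ideal.mem_sup_left (hle hG)) (Ideal.add_mem _ ?_ (Ideal.mem_sup_right hc'))
  rw [mul_comm]
  exact hmul

theorem mem_span_X_pow_sup_iff {K τ : Type*} [Field K] [DecidableEq τ] (S C : Finset τ) (k : ℕ)
    (F : MvPolynomial τ K) :
    F ∈ Ideal.span ((X : τ → MvPolynomial τ K) '' (S : Set τ)) ^ k ⊔
        Ideal.span ((X : τ → MvPolynomial τ K) '' (C : Set τ)) ↔
      ∀ u ∈ F.support, k ≤ ∑ i ∈ S, u i ∨ ∃ c ∈ C, u c ≠ 0 := by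
  constructor
  · have hle : Ideal.span ((X : τ → MvPolynomial τ K) '' (S : Set τ)) ^ k ≤
        Ideal.span ((fun u => monomial u (1 : K)) '' {u | k ≤ ∑ i ∈ S, u i}) := by
      induction k with
      | zero =>
        refine le_top.trans_eq ((Ideal.eq_top_iff_one _).2 (Ideal.subset_span ?_)).symm
        exact ⟨0, by simp, rfl⟩
      | succ k ih =>
        rw [pow_succ]
        refine (Ideal.mul_mono ih le_rfl).trans ?_
        rw [Ideal.span_mul_span', Ideal.span_le]
        rintro _ ⟨_, ⟨u, hu, rfl⟩, _, ⟨i, hi, rfl⟩, rfl⟩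
        refine Ideal.subset_span ⟨u + Finsupp.single i 1, ?_, ?_⟩
        · have hu' : k ≤ ∑ i ∈ S, u i := hu
          have hi' : i ∈ S := hi
          simp [Finset.sum_add_distrib, Finsupp.single_apply, hi', hu']
        · simp [X, monomial_mul]
    intro hF u hu
    obtain ⟨G, hG, L, hL, rfl⟩ := Submodule.mem_sup.1 hF
    have hG' := mem_ideal_span_monomial_image.1 (hle hG)
    have hL' := mem_ideal_span_X_image.1 hL
    rcases Finset.mem_union.1 (support_add hu) with h | h
    · obtain ⟨w, hw, hwu⟩ := hG' u h
      exact Or.inl (le_trans hw (Finset.sum_le_sum fun i _ => hwu i))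
    · exact Or.inr (hL' u h)
  · intro h
    rw [F.as_sum]
    refine Ideal.sum_mem _ fun u hu => ?_
    rw [monomial_eq]
    refine Ideal.mul_mem_left _ _ ?_
    rcases h u hu with h | ⟨c, hc, hcu⟩
    · refine Ideal.mem_sup_left ?_
      rw [Finsupp.prod_of_support_subset u (s := u.support ∪ S) Finset.subset_union_left _
        (by simp), ← Finset.prod_sdiff (Finset.subset_union_right : S ⊆ u.support ∪ S)]
      refine Ideal.mul_mem_left _ _ (Ideal.pow_le_pow_right h ?_)
      rw [← Finset.prod_pow_eq_pow_sum]
      refine Ideal.prod_mem_prod fun i hi => Ideal.pow_mem_pow ?_ _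
      exact Ideal.subset_span ⟨i, hi, rfl⟩
    · refine Ideal.mem_sup_right ?_
      refine Ideal.mem_of_dvd _ ((dvd_pow_self (X c : MvPolynomial τ K) hcu).trans
        (Finset.dvd_prod_of_mem (fun i => (X i : MvPolynomial τ K) ^ u i)
          (Finsupp.mem_support_iff.2 hcu))) (Ideal.subset_span ⟨c, hc, rfl⟩)

theorem mem_span_X_pow_sup_of_X_mul_mem {K τ : Type*} [Field K] [DecidableEq τ]
    {S C : Finset τ} {k : ℕ} {F : MvPolynomial τ K} {x : τ} (hxC : x ∉ C)
    (h : X x * F ∈ Ideal.span ((X : τ → MvPolynomial τ K) '' (S : Set τ)) ^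
          (k + if x ∈ S then 1 else 0) ⊔
        Ideal.span ((X : τ → MvPolynomial τ K) '' (C : Set τ))) :
    F ∈ Ideal.span ((X : τ → MvPolynomial τ K) '' (S : Set τ)) ^ k ⊔
        Ideal.span ((X : τ → MvPolynomial τ K) '' (C : Set τ)) := by
  rw [mem_span_X_pow_sup_iff] at h ⊢
  intro u hu
  have := h (Finsupp.single x 1 + u) (by
    rw [mem_support_iff] at hu ⊢
    rwa [coeff_X_mul])
  simp only [Finsupp.add_apply, Finset.sum_add_distrib, Finsupp.single_apply,
    Finset.sum_ite_eq] at this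
  rcases this with h1 | ⟨c, hc, h1⟩
  · left
    omega
  · refine Or.inr ⟨c, hc, ?_⟩
    rwa [if_neg (by rintro rfl; exact hxC hc), zero_add] at h1

/-- The linear form in the coordinates attached to a linear functional. -/
noncomputable def linForm {K σ : Type*} [Field K] [Fintype σ] [DecidableEq σ] :
    Module.Dual K (σ → K) →ₗ[K] MvPolynomial σ K :=
  (SymmetricAlgebra.equivMvPolynomial (Pi.basisFun K σ).dualBasis).toLinearMap ∘ₗ
    SymmetricAlgebra.ι K (Module.Dual K (σ → K))

section linForm

variable {K σ : Type*} [Field K] [Fintype σ] [DecidableEq σ]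

theorem linForm_proj (j : σ) : linForm (LinearMap.proj j : (σ → K) →ₗ[K] K) = X j := by
  have : (LinearMap.proj j : (σ → K) →ₗ[K] K) = (Pi.basisFun K σ).dualBasis j := by
    ext i
    simp [Pi.single_apply]
  rw [this]
  exact SymmetricAlgebra.equivMvPolynomial_ι_apply _ j

theorem eq_sum_smul_proj (f : Module.Dual K (σ → K)) :
    f = ∑ j, f (Pi.single j 1) • (LinearMap.proj j : (σ → K) →ₗ[K] K) := by
  ext i
  simp [Pi.single_apply]

theorem linForm_eq_sum (f : Module.Dual K (σ → K)) :
    linForm f = ∑ j, f (Pi.single j 1) • X j := by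
  conv_lhs => rw [eq_sum_smul_proj f]
  simp only [map_sum, map_smul, linForm_proj]

theorem eval_linForm (p : σ → K) (f : Module.Dual K (σ → K)) : eval p (linForm f) = f p := by
  conv_rhs => rw [eq_sum_smul_proj f]
  simp [linForm_eq_sum, smul_eval]

theorem isHomogeneous_linForm (f : Module.Dual K (σ → K)) : (linForm f).IsHomogeneous 1 := by
  rw [linForm_eq_sum]
  refine IsHomogeneous.sum _ _ _ fun j _ => ?_
  rw [smul_eq_C_mul]
  exact (isHomogeneous_X K j).C_mul _

theorem MvPolynomial.IsHomogeneous.exists_linForm_eq {F : MvPolynomial σ K}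
    (hF : F.IsHomogeneous 1) : ∃ f, linForm f = F := by
  have h : homogeneousSubmodule σ K 1 ≤ LinearMap.range (linForm (K := K) (σ := σ)) := by
    rw [homogeneousSubmodule_one_eq_span_X, Submodule.span_le]
    rintro _ ⟨j, rfl⟩
    exact ⟨_, linForm_proj j⟩
  exact h hF

theorem exists_equiv_X_eq_linForm {U : Type*} {v : U → Module.Dual K (σ → K)}
    (hv : LinearIndependent K v) :
    ∃ (τ : Set (Module.Dual K (σ → K))) (Φ : MvPolynomial (U ⊕ τ) K ≃ₐ[K] MvPolynomial σ K),
      ∀ i, Φ (X (Sum.inl i)) = linForm (v i) := by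
  refine ⟨_, (SymmetricAlgebra.equivMvPolynomial (Module.Basis.sumExtend hv)).symm.trans
    (SymmetricAlgebra.equivMvPolynomial (Pi.basisFun K σ).dualBasis), fun i => ?_⟩
  rw [AlgEquiv.trans_apply, SymmetricAlgebra.equivMvPolynomial_symm_X]
  have : Module.Basis.sumExtend hv (Sum.inl i) = v i := by
    simp [Module.Basis.sumExtend]
    rfl
  rw [this]
  rfl

theorem mem_span_linForm_pow_sup_of_mul_mem {ι : Type*} [DecidableEq ι]
    {v : ι → Module.Dual K (σ → K)} {U S C : Finset ι} (hv : LinearIndepOn K v (U : Set ι))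
    (hS : S ⊆ U) (hC : C ⊆ U) {x : ι} (hxU : x ∈ U) (hxC : x ∉ C) {k : ℕ} {F : MvPolynomial σ K}
    (h : linForm (v x) * F ∈ Ideal.span ((fun i => linForm (v i)) '' (S : Set ι)) ^
          (k + if x ∈ S then 1 else 0) ⊔
        Ideal.span ((fun i => linForm (v i)) '' (C : Set ι))) :
    F ∈ Ideal.span ((fun i => linForm (v i)) '' (S : Set ι)) ^ k ⊔
        Ideal.span ((fun i => linForm (v i)) '' (C : Set ι)) := by
  classical
  obtain ⟨τ, Φ, hΦ⟩ := exists_equiv_X_eq_linForm (U := U) hv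
  let lift : Finset ι → Finset (U ⊕ τ) := fun S =>
    (S.subtype (· ∈ U)).map Function.Embedding.inl
  have hspan : ∀ S ⊆ U, Ideal.span ((fun i => linForm (v i)) '' (S : Set ι)) =
      (Ideal.span ((X : U ⊕ τ → MvPolynomial (U ⊕ τ) K) '' (lift S : Set (U ⊕ τ)))).map
        (Φ : MvPolynomial (U ⊕ τ) K ≃+* MvPolynomial σ K) := by
    intro S hS
    rw [Ideal.map_span]
    congr 1
    ext g
    constructor
    · rintro ⟨i, hi, rfl⟩
      exact ⟨_, ⟨Sum.inl ⟨i, hS hi⟩, by simpa [lift] using hi, rfl⟩, hΦ _⟩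
    · rintro ⟨_, ⟨t, ht, rfl⟩, rfl⟩
      simp only [lift, Finset.coe_map, Set.mem_image, Finset.mem_coe, Finset.mem_subtype] at ht
      obtain ⟨i, hi, rfl⟩ := ht
      exact ⟨i, hi, (hΦ i).symm⟩
  rw [hspan S hS, hspan C hC, ← Ideal.map_pow, ← Ideal.map_sup,
    ← Ideal.symm_apply_mem_of_equiv_iff] at h ⊢
  refine mem_span_X_pow_sup_of_X_mul_mem (x := Sum.inl ⟨x, hxU⟩) (by simpa [lift] using hxC) ?_
  have hx : (Φ : MvPolynomial (U ⊕ τ) K ≃+* MvPolynomial σ K).symm (linForm (v x)) =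
      X (Sum.inl ⟨x, hxU⟩) := by
    rw [← hΦ ⟨x, hxU⟩]
    exact Φ.symm_apply_apply _
  rw [map_mul, hx] at h
  have hiff : Sum.inl ⟨x, hxU⟩ ∈ lift S ↔ x ∈ S := by simp [lift]
  rwa [if_congr hiff rfl rfl]

end linForm

theorem prod_pow_mem_pow_mul_pow {A : Type*} [CommRing A] {N d s k : ℕ} (hN : 1 ≤ N) (hNd : N ≤ d)
    (hs : N ≤ s) (h : Fin s ⊕ Fin k → A) (I M : Ideal A) (hM : ∀ i, h i ∈ M)
    (hI : ∀ j, h (Sum.inr j) ∈ I)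
    (hW : ∀ W : Finset (Fin s), W.card = s - N + 1 → ∏ i ∈ W, h (Sum.inl i) ∈ I)
    (a : Fin s ⊕ Fin k → ℕ) {r m : ℕ} (hr : 1 ≤ r) (hm : (r - 1) * d + 1 ≤ m)
    (ha : ∀ T : Finset (Fin s), T.card = N → m ≤ ∑ i ∈ T.disjSum Finset.univ, a i) :
    ∏ i, h i ^ a i ∈ M ^ (m - r) * I ^ r := by
  obtain ⟨T, hT, hTmin⟩ := Finset.exists_min_image (Finset.univ.powersetCard N)
    (fun T : Finset (Fin s) => ∑ i ∈ T, a (Sum.inl i))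
    (Finset.powersetCard_nonempty.2 (by simpa using hs))
  simp only [Finset.mem_powersetCard, Finset.subset_univ, true_and] at hT hTmin
  obtain ⟨i₀, hi₀, hmax⟩ := Finset.exists_max_image T (fun i => a (Sum.inl i))
    (Finset.card_pos.1 (by omega))
  set c := a (Sum.inl i₀)
  have hcompl : ∀ j ∉ T, c ≤ a (Sum.inl j) := by
    intro j hj
    have hj' : j ∉ T.erase i₀ := fun h => hj (Finset.mem_of_mem_erase h)
    have := hTmin (insert j (T.erase i₀)) (by
      rw [Finset.card_insert_of_notMem hj', Finset.card_erase_of_mem hi₀]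
      omega)
    rw [Finset.sum_insert hj', ← Finset.add_sum_erase _ _ hi₀] at this
    exact Nat.le_of_add_le_add_right this
  have hsumT := ha T hT
  rw [Finset.sum_disjSum] at hsumT
  set t := ∑ j, a (Sum.inr j)
  set u := ∑ i ∈ T, a (Sum.inl i)
  have huc : u ≤ d * c := by
    refine (Finset.sum_le_card_nsmul _ _ c hmax).trans ?_
    rw [hT, smul_eq_mul]
    exact Nat.mul_le_mul_right c hNd
  have hcu : c ≤ u := Finset.single_le_sum (f := fun i => a (Sum.inl i)) (by simp) hi₀
  set ρ := min r c
  have hρr : ρ ≤ r := min_le_left _ _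
  have hρc : ρ ≤ c := min_le_right _ _
  have hrt : r - ρ ≤ t := by
    rcases le_total r c with hrc | hrc
    · simp [ρ, hrc]
    · obtain ⟨e, rfl⟩ := Nat.exists_eq_add_of_le hrc
      have : ρ = c := min_eq_right hrc
      rw [this, Nat.add_sub_cancel_left]
      rcases Nat.eq_zero_or_pos e with rfl | he
      · simp
      obtain ⟨e, rfl⟩ := Nat.exists_eq_add_of_le' he
      rw [show c + (e + 1) - 1 = c + e by omega] at hm
      nlinarith
  set W := insert i₀ Tᶜ
  have hi₀W : i₀ ∉ Tᶜ := by simpa using hi₀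
  have hWcard : W.card = s - N + 1 := by
    rw [Finset.card_insert_of_notMem hi₀W, Finset.card_compl, hT, Fintype.card_fin]
  have hρa : ∀ i, (if i ∈ W then ρ else 0) ≤ a (Sum.inl i) := by
    intro i
    split_ifs with hi
    · refine hρc.trans ?_
      rcases Finset.mem_insert.1 hi with rfl | hi
      · exact le_rfl
      · exact hcompl i (by simpa using hi)
    · exact Nat.zero_le _
  have hleft : ∏ i, h (Sum.inl i) ^ a (Sum.inl i) ∈ I ^ ρ * M ^ (u - ρ) := by
    have heq : ∏ i, h (Sum.inl i) ^ a (Sum.inl i) = (∏ i ∈ W, h (Sum.inl i)) ^ ρ *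
        ∏ i, h (Sum.inl i) ^ (a (Sum.inl i) - if i ∈ W then ρ else 0) := by
      have : (∏ i ∈ W, h (Sum.inl i)) ^ ρ = ∏ i, h (Sum.inl i) ^ (if i ∈ W then ρ else 0) := by
        rw [← Finset.prod_pow]
        simp [pow_ite, Finset.prod_ite_mem]
      rw [this, ← Finset.prod_mul_distrib]
      refine Finset.prod_congr rfl fun i _ => ?_
      rw [← pow_add, Nat.add_sub_cancel' (hρa i)]
    rw [heq]
    refine Ideal.mul_mem_mul (Ideal.pow_mem_pow (hW W hWcard) _) ?_
    have hle : u - ρ ≤ ∑ i, (a (Sum.inl i) - if i ∈ W then ρ else 0) := by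
      rw [Finset.sum_tsub_distrib _ (fun i _ => hρa i), Finset.sum_ite_mem, Finset.univ_inter,
        Finset.sum_const, smul_eq_mul, Finset.card_insert_of_notMem hi₀W,
        ← Finset.sum_add_sum_compl T]
      have : Tᶜ.card • c ≤ ∑ i ∈ Tᶜ, a (Sum.inl i) :=
        Finset.card_nsmul_le_sum _ _ _ fun i hi => hcompl i (by simpa using hi)
      have h2 : Tᶜ.card * ρ ≤ Tᶜ.card * c := Nat.mul_le_mul_left _ hρc
      rw [smul_eq_mul] at this
      rw [add_mul]
      omega
    refine Ideal.pow_le_pow_right hle ?_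
    rw [← Finset.prod_pow_eq_pow_sum]
    exact Ideal.prod_mem_prod fun i _ => Ideal.pow_mem_pow (hM _) _
  have hright : ∏ j, h (Sum.inr j) ^ a (Sum.inr j) ∈ I ^ (r - ρ) * M ^ (t - (r - ρ)) := by
    have : ∏ j, h (Sum.inr j) ^ a (Sum.inr j) ∈ (I ⊓ M) ^ t := by
      rw [← Finset.prod_pow_eq_pow_sum]
      exact Ideal.prod_mem_prod fun j _ => Ideal.pow_mem_pow (Submodule.mem_inf.2 ⟨hI j, hM _⟩) _
    rw [← Nat.add_sub_cancel' hrt, pow_add] at this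
    exact Ideal.mul_mono (Ideal.pow_right_mono inf_le_left _) (Ideal.pow_right_mono inf_le_right _)
      this
  have hprod := Ideal.mul_mem_mul hleft hright
  rw [mul_mul_mul_comm, ← pow_add, ← pow_add, Nat.add_sub_cancel' hρr, mul_comm,
    ← Fintype.prod_sum_type (fun i => h i ^ a i)] at hprod
  exact Ideal.mul_mono (Ideal.pow_le_pow_right (by omega)) le_rfl hprod

theorem homVanishingIdeal_eq_span {K σ ι : Type*} [Field K] [Fintype σ] [DecidableEq σ]
    {p : σ → K} (hp : p ≠ 0) {v : ι → Module.Dual K (σ → K)} {S : Set ι}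
    (hv : ∀ i ∈ S, v i p = 0) (hspan : ∀ f : Module.Dual K (σ → K), f p = 0 →
      f ∈ Submodule.span K (v '' S)) :
    homVanishingIdeal p = Ideal.span ((fun i => linForm (v i)) '' S) := by
  apply le_antisymm
  · refine Ideal.span_le.2 ?_
    rintro F ⟨⟨e, he⟩, hF⟩
    set J := Ideal.span ((fun i => linForm (v i)) '' S)
    have hlin : ∀ f : Module.Dual K (σ → K), f p = 0 → linForm f ∈ J := by
      intro f hf
      refine Submodule.span_induction ?_ (by simp) ?_ ?_ (hspan f hf)
      · rintro _ ⟨i, hi, rfl⟩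
        exact Ideal.subset_span ⟨i, hi, rfl⟩
      · intro f g _ _ hf hg
        rw [map_add]
        exact Ideal.add_mem _ hf hg
      · intro c f _ hf
        rw [map_smul, smul_eq_C_mul]
        exact Ideal.mul_mem_left _ _ hf
    obtain ⟨j₀, hj₀⟩ := Function.ne_iff.1 hp
    rw [Pi.zero_apply] at hj₀
    -- modulo `J`, every coordinate is a multiple of a single linear form
    let t : MvPolynomial σ K := C (p j₀)⁻¹ * X j₀
    have hX : ∀ j, Ideal.Quotient.mk J (X j) = Ideal.Quotient.mk J (C (p j) * t) := by
      intro j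
      rw [Ideal.Quotient.mk_eq_mk_iff_sub_mem]
      have := hlin ((LinearMap.proj j : (σ → K) →ₗ[K] K) -
        (p j * (p j₀)⁻¹) • (LinearMap.proj j₀ : (σ → K) →ₗ[K] K)) (by
          simp [mul_assoc, inv_mul_cancel₀ hj₀])
      rwa [map_sub, map_smul, linForm_proj, linForm_proj, smul_eq_C_mul, C_mul, mul_assoc] at this
    have hcong : (Ideal.Quotient.mk J) F = Ideal.Quotient.mk J (t ^ e * C (eval p F)) := by
      conv_lhs => rw [F.as_sum]
      conv_rhs => rw [F.as_sum]
      simp only [map_sum, Finset.mul_sum]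
      refine Finset.sum_congr rfl fun u hu => ?_
      have hdeg : ∑ i ∈ u.support, u i = e := by
        have := he (mem_support_iff.1 hu)
        rwa [Pi.one_def, ← Finsupp.degree_eq_weight_one, Finsupp.degree_apply] at this
      rw [eval_monomial, monomial_eq, ← hdeg, ← Finset.prod_pow_eq_pow_sum]
      simp only [Finsupp.prod, map_mul, map_prod, map_pow, hX, mul_pow, Finset.prod_mul_distrib]
      ring
    rw [hF, C_0, mul_zero, map_zero, Ideal.Quotient.eq_zero_iff_mem] at hcong
    exact hcong
  · rw [Ideal.span_le]
    rintro _ ⟨i, hi, rfl⟩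
    exact Ideal.subset_span ⟨⟨1, isHomogeneous_linForm _⟩, by rw [eval_linForm, hv i hi]⟩

theorem linForm_mem_irrel {K σ : Type*} [Field K] [Fintype σ] [DecidableEq σ]
    (f : Module.Dual K (σ → K)) : linForm f ∈ irrel K σ := by
  rw [linForm_eq_sum]
  refine Ideal.sum_mem _ fun j _ => ?_
  rw [smul_eq_C_mul]
  exact Ideal.mul_mem_left _ _ (Ideal.subset_span ⟨j, rfl⟩)

/-- As many functionals as the codimension of a point, spanning all functionals vanishing there,
are linearly independent. -/
theorem linearIndepOn_of_span_eq_vanishing {K ι : Type*} [Field K] {d : ℕ}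
    {p : Fin (d + 1) → K} (hp : p ≠ 0) {v : ι → Module.Dual K (Fin (d + 1) → K)} {S : Finset ι}
    (hS : S.card = d) (hv : ∀ i ∈ S, v i p = 0)
    (hspan : ∀ f : Module.Dual K (Fin (d + 1) → K), f p = 0 →
      f ∈ Submodule.span K (v '' (S : Set ι))) :
    LinearIndepOn K v (S : Set ι) := by
  have hker : Submodule.span K (v '' (S : Set ι)) =
      LinearMap.ker (Module.Dual.eval K (Fin (d + 1) → K) p) := by
    apply le_antisymm
    · rw [Submodule.span_le]
      rintro _ ⟨i, hi, rfl⟩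
      exact hv i hi
    · intro f hf
      exact hspan f hf
  have hne : Module.Dual.eval K (Fin (d + 1) → K) p ≠ 0 :=
    fun h => hp ((Module.eval_apply_eq_zero_iff K p).1 h)
  have hrank := Module.Dual.finrank_ker_add_one_of_ne_zero hne
  rw [Subspace.dual_finrank_eq, Module.finrank_fin_fun] at hrank
  have : LinearIndependent K fun i : S => v i := by
    rw [linearIndependent_iff_card_eq_finrank_span, Set.finrank, Fintype.card_coe, hS]
    have hrange : Set.range (fun i : S => v i) = v '' (S : Set ι) := by
      rw [Set.image_eq_range]; rfl
    rw [hrange, hker]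
    omega
  exact this

section starConfiguration

variable {K : Type*} [Field K] {N d s k : ℕ}
  {p : {T : Finset (Fin s) // T.card = N} → Fin (d + 1) → K}
  {v : Fin s ⊕ Fin k → Module.Dual K (Fin (d + 1) → K)}

/-- Symbolic powers of the ideal of an embedded star configuration are generated by products of
the linear forms defining the hyperplanes and the ambient subspace. -/
theorem symbPow_le_span_prod (hk : N + k = d) (hp : ∀ T, p T ≠ 0)
    (hv : ∀ T, ∀ i ∈ T.1.disjSum (Finset.univ : Finset (Fin k)), v i (p T) = 0)
    (hspan : ∀ T, ∀ f : Module.Dual K (Fin (d + 1) → K), f (p T) = 0 →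
      f ∈ Submodule.span K (v '' (T.1.disjSum (Finset.univ : Finset (Fin k)) : Set _)))
    (hne : ∀ T, ∀ i ∉ T.1, v (Sum.inl i) (p T) ≠ 0) (m : ℕ) :
    symbPow p m ≤ Ideal.span {g | ∃ a : Fin s ⊕ Fin k → ℕ,
      (∀ T : Finset (Fin s), T.card = N → m ≤ ∑ i ∈ T.disjSum Finset.univ, a i) ∧
        g = ∏ i, linForm (v i) ^ a i} := by
  have hindep : ∀ T : {T : Finset (Fin s) // T.card = N},
      LinearIndepOn K v (T.1.disjSum (Finset.univ : Finset (Fin k)) : Set _) :=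
    fun T => linearIndepOn_of_span_eq_vanishing (hp T)
      (by rw [Finset.card_disjSum, T.2, Finset.card_univ, Fintype.card_fin, hk]) (hv T) (hspan T)
  have hindep' : ∀ T : {T : Finset (Fin s) // T.card = N},
      ∀ x ∉ T.1.disjSum (Finset.univ : Finset (Fin k)),
      LinearIndepOn K v ((insert x (T.1.disjSum Finset.univ) : Finset (Fin s ⊕ Fin k)) : Set _) := by
    intro T x hx
    rw [Finset.coe_insert, linearIndepOn_insert (by exact_mod_cast hx)]
    refine ⟨hindep T, fun h => ?_⟩
    have hle : Submodule.span K (v '' (T.1.disjSum (Finset.univ : Finset (Fin k)) : Set _)) ≤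
        LinearMap.ker (Module.Dual.eval K (Fin (d + 1) → K) (p T)) := by
      rw [Submodule.span_le]
      rintro _ ⟨i, hi, rfl⟩
      exact hv T i hi
    rcases x with i | j
    · exact hne T i (by simpa using hx) (hle h)
    · simp at hx
  intro F hF
  rw [symbPow, Ideal.mem_iInf] at hF
  have key := mem_span_prod_pow_sup (fun i => linForm (v i))
    ((Finset.univ.powersetCard N).image fun T : Finset (Fin s) =>
      T.disjSum (Finset.univ : Finset (Fin k))) ?_ ?_ ?_ ∅ m 0 F ?_
  · simpa using key
  · intro T hT C hCT x hx T' hT' hC'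
    simp only [Finset.mem_image, Finset.mem_powersetCard, Finset.subset_univ, true_and] at hT hT'
    obtain ⟨T, hT, rfl⟩ := hT
    obtain ⟨T', hT', rfl⟩ := hT'
    rcases x with i | j
    swap
    · simp at hx
    have hi : i ∉ T := by simpa using hx
    have hiT' : i ∈ T' := by simpa using hC' (Finset.mem_insert_self _ _)
    obtain ⟨y, hyT, hyC⟩ : ∃ y ∈ T, Sum.inl y ∉ C := by
      by_contra! h
      have : insert i T ⊆ T' := by
        refine Finset.insert_subset hiT' fun y hy => ?_
        simpa using hC' (Finset.mem_insert_of_mem (h y hy))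
      have := Finset.card_le_card this
      rw [Finset.card_insert_of_notMem hi] at this
      omega
    refine ⟨Sum.inl y, by simp [hyT, hyC], ?_⟩
    simp only [Finset.mem_image, Finset.mem_powersetCard, Finset.subset_univ, true_and]
    refine ⟨insert i (T.erase y), ?_, ?_⟩
    · rw [Finset.card_insert_of_notMem (by simp [hi]), Finset.card_erase_of_mem hyT]
      have := Finset.card_pos.2 ⟨y, hyT⟩
      omega
    · ext (z | z) <;> simp
  · intro T hT C hCT x hx n G hG
    simp only [Finset.mem_image, Finset.mem_powersetCard, Finset.subset_univ, true_and] at hT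
    obtain ⟨T, hT, rfl⟩ := hT
    refine mem_span_linForm_pow_sup_of_mul_mem (hindep' ⟨T, hT⟩ x hx)
      (Finset.sdiff_subset.trans (Finset.subset_insert _ _))
      (hCT.trans (Finset.subset_insert _ _)) (Finset.mem_insert_self _ _)
      (fun h => hx (hCT h)) ?_
    rwa [if_neg (fun h => hx (Finset.mem_sdiff.1 h).1), add_zero]
  · intro T hT C hCT x hx n G hG
    simp only [Finset.mem_image, Finset.mem_powersetCard, Finset.subset_univ, true_and] at hT
    obtain ⟨T, hT, rfl⟩ := hT
    refine mem_span_linForm_pow_sup_of_mul_mem (hindep ⟨T, hT⟩) Finset.sdiff_subset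
      hCT (Finset.mem_sdiff.1 hx).1 (Finset.mem_sdiff.1 hx).2 ?_
    rwa [if_pos hx]
  · intro T hT _
    simp only [Finset.mem_image, Finset.mem_powersetCard, Finset.subset_univ, true_and] at hT
    obtain ⟨T, hT, rfl⟩ := hT
    have := hF ⟨T, hT⟩
    rw [homVanishingIdeal_eq_span (hp _) (hv _) (hspan _)] at this
    simpa using this

theorem symbPow_le_irrel_pow_mul (hN : 1 ≤ N) (hs : N ≤ s) (hk : N + k = d) (hp : ∀ T, p T ≠ 0)
    (hv : ∀ T, ∀ i ∈ T.1.disjSum (Finset.univ : Finset (Fin k)), v i (p T) = 0)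
    (hspan : ∀ T, ∀ f : Module.Dual K (Fin (d + 1) → K), f (p T) = 0 →
      f ∈ Submodule.span K (v '' (T.1.disjSum (Finset.univ : Finset (Fin k)) : Set _)))
    (hne : ∀ T, ∀ i ∉ T.1, v (Sum.inl i) (p T) ≠ 0) {r m : ℕ} (hr : 1 ≤ r)
    (hm : (r - 1) * d + 1 ≤ m) :
    symbPow p m ≤ irrel K (Fin (d + 1)) ^ (m - r) * symbPow p 1 ^ r := by
  refine (symbPow_le_span_prod hk hp hv hspan hne m).trans (Ideal.span_le.2 ?_)
  have hmem : ∀ T : {T : Finset (Fin s) // T.card = N},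
      ∀ i ∈ T.1.disjSum (Finset.univ : Finset (Fin k)),
      linForm (v i) ∈ homVanishingIdeal (p T) := by
    intro T i hi
    rw [homVanishingIdeal_eq_span (hp _) (hv _) (hspan _)]
    exact Ideal.subset_span ⟨i, hi, rfl⟩
  rintro _ ⟨a, ha, rfl⟩
  refine prod_pow_mem_pow_mul_pow hN (by omega) hs _ _ _ (fun i => linForm_mem_irrel _) ?_ ?_
    a hr hm ha
  · intro j
    simp only [symbPow, pow_one, Ideal.mem_iInf]
    exact fun T => hmem T _ (by simp)
  · intro W hW
    simp only [symbPow, pow_one, Ideal.mem_iInf]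
    intro T
    obtain ⟨i, hi⟩ : (W ∩ T.1).Nonempty := by
      by_contra h
      have hd := Finset.card_union_of_disjoint
        (Finset.disjoint_iff_inter_eq_empty.2 (Finset.not_nonempty_iff_eq_empty.1 h))
      have := Finset.card_le_univ (W ∪ T.1)
      rw [hd, T.2, hW, Fintype.card_fin] at this
      omega
    rw [Finset.mem_inter] at hi
    exact Ideal.mem_of_dvd _ (Finset.dvd_prod_of_mem _ hi.1) (hmem T _ (by simp [hi.2]))

end starConfiguration

/-- Char 0.  `Z` is a star configuration of points in `P^N` (the points
`Q T`, indexed by `N`-element subsets `T` of the `s ≥ N` hyperplanes `H i`, `Q T` being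
the common point of the hyperplanes in `T`), and `P^N` is embedded in `P^d` via an
injective linear map `φ`.  For the radical ideal `I` of the points `φ (Q T)` of `P^d`:
(a) `I^{(rd)} ⊆ M^{r(d-1)} I^r` and (b) `I^{(rd-(d-1))} ⊆ M^{(r-1)(d-1)} I^r`
for all `r ≥ 1`. -/
theorem stmt16 {K : Type*} [Field K] [IsAlgClosed K] [CharZero K]
    {N d s : ℕ} (hN : 1 ≤ N) (hNd : N ≤ d) (hs : N ≤ s)
    (H : Fin s → MvPolynomial (Fin (N + 1)) K)
    (hH1 : ∀ i, (H i).IsHomogeneous 1) (hH0 : ∀ i, H i ≠ 0)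
    (Q : {T : Finset (Fin s) // T.card = N} → (Fin (N + 1) → K))
    (hQ : ProjectivelyDistinct Q)
    (hQH : ∀ T : {T : Finset (Fin s) // T.card = N}, ∀ i ∈ T.1,
      MvPolynomial.eval (Q T) (H i) = 0)
    (hmeet : ∀ T : {T : Finset (Fin s) // T.card = N}, ∀ p : Fin (N + 1) → K, p ≠ 0 →
      (∀ i ∈ T.1, MvPolynomial.eval p (H i) = 0) → ∃ c : K, p = c • Q T)
    (hnocommon : ∀ T : Finset (Fin s), T.card = N + 1 →
      ∀ p : Fin (N + 1) → K, p ≠ 0 → ∃ i ∈ T, MvPolynomial.eval p (H i) ≠ 0)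
    (φ : (Fin (N + 1) → K) →ₗ[K] (Fin (d + 1) → K)) (hφ : Function.Injective φ)
    (r : ℕ) (hr : 1 ≤ r) :
    symbPow (fun T => φ (Q T)) (r * d) ≤
      irrel K (Fin (d + 1)) ^ (r * (d - 1)) * symbPow (fun T => φ (Q T)) 1 ^ r ∧
    symbPow (fun T => φ (Q T)) (r * d - (d - 1)) ≤
      irrel K (Fin (d + 1)) ^ ((r - 1) * (d - 1)) * symbPow (fun T => φ (Q T)) 1 ^ r := by
  obtain ⟨k, rfl⟩ := Nat.exists_eq_add_of_le hNd
  choose f hf using fun i => (hH1 i).exists_linForm_eq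
  have hHf : ∀ i q, eval q (H i) = f i q := fun i q => by rw [← hf, eval_linForm]
  obtain ⟨π, hπ⟩ := φ.exists_leftInverse_of_injective (LinearMap.ker_eq_bot.2 hφ)
  have hπφ : ∀ q, π (φ q) = q := fun q => LinearMap.congr_fun hπ q
  have hrank : Module.finrank K ((Fin (N + k + 1) → K) ⧸ LinearMap.range φ) =
      Module.finrank K (Fin k → K) := by
    have := Submodule.finrank_quotient_add_finrank (LinearMap.range φ)
    rw [LinearMap.finrank_range_of_inj hφ, Module.finrank_fin_fun, Module.finrank_fin_fun] at this
    rw [Module.finrank_fin_fun]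
    omega
  let e := LinearEquiv.ofFinrankEq _ _ hrank
  let ℓ : Fin k → Module.Dual K (Fin (N + k + 1) → K) := fun j =>
    LinearMap.proj j ∘ₗ e.toLinearMap ∘ₗ (LinearMap.range φ).mkQ
  have hℓφ : ∀ j q, ℓ j (φ q) = 0 := fun j q => by
    have : (LinearMap.range φ).mkQ (φ q) = 0 := by simp
    simp only [ℓ, LinearMap.comp_apply, this, map_zero]
  have hrange : ∀ x, (∀ j, ℓ j x = 0) → ∃ q, φ q = x := by
    intro x hx
    have h0 : e ((LinearMap.range φ).mkQ x) = 0 := funext hx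
    rw [LinearEquiv.map_eq_zero_iff, Submodule.mkQ_apply, Submodule.Quotient.mk_eq_zero] at h0
    exact h0
  let v : Fin s ⊕ Fin k → Module.Dual K (Fin (N + k + 1) → K) :=
    Sum.elim (fun i => f i ∘ₗ π) ℓ
  have hp : ∀ T, φ (Q T) ≠ 0 := fun T h => hQ.1 T (hφ (h.trans (map_zero φ).symm))
  have hv : ∀ T, ∀ i ∈ T.1.disjSum (Finset.univ : Finset (Fin k)), v i (φ (Q T)) = 0 := by
    rintro T (i | j) hi
    · simp only [v, Sum.elim_inl, LinearMap.comp_apply, hπφ, ← hHf]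
      exact hQH T i (by simpa using hi)
    · exact hℓφ j _
  have hspan : ∀ T, ∀ g : Module.Dual K (Fin (N + k + 1) → K), g (φ (Q T)) = 0 →
      g ∈ Submodule.span K (v '' (T.1.disjSum (Finset.univ : Finset (Fin k)) : Set _)) := by
    intro T g hg
    rw [Set.image_eq_range]
    refine mem_span_of_iInf_ker_le_ker fun x hx => ?_
    rw [Submodule.mem_iInf] at hx
    obtain ⟨q, rfl⟩ := hrange x fun j => hx ⟨Sum.inr j, by simp⟩
    rcases eq_or_ne q 0 with rfl | hq
    · simp
    obtain ⟨c, rfl⟩ := hmeet T q hq fun i hi => by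
      have : v (Sum.inl i) (φ q) = 0 := hx ⟨Sum.inl i, by simpa using hi⟩
      simpa [v, hπφ, hHf] using this
    simp [hg]
  have hne : ∀ T, ∀ i ∉ T.1, v (Sum.inl i) (φ (Q T)) ≠ 0 := by
    intro T i hi h
    obtain ⟨j, hj, hj0⟩ := hnocommon (insert i T.1)
      (by rw [Finset.card_insert_of_notMem hi, T.2]) (Q T) (hQ.1 T)
    rcases Finset.mem_insert.1 hj with rfl | hj
    · refine hj0 ?_
      simpa [v, hπφ, hHf] using h
    · exact hj0 (hQH T j hj)
  obtain ⟨D, hD⟩ := Nat.exists_eq_add_of_le' (hN.trans hNd)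
  obtain ⟨r, rfl⟩ := Nat.exists_eq_add_of_le' hr
  constructor
  · convert symbPow_le_irrel_pow_mul hN hs rfl hp hv hspan hne hr (m := (r + 1) * (N + k)) ?_ using 3
    · rw [hD, Nat.add_sub_cancel, mul_add, mul_one, Nat.add_sub_cancel]
    · rw [Nat.add_sub_cancel, add_mul]
      omega
  · convert symbPow_le_irrel_pow_mul hN hs rfl hp hv hspan hne hr
      (m := (r + 1) * (N + k) - (N + k - 1)) ?_ using 3
    · rw [hD, Nat.add_sub_cancel, Nat.add_sub_cancel, add_mul, mul_add]
      omega
    · rw [Nat.add_sub_cancel, add_mul]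
      omega
end
end

section
/- Assume K has characteristic 0. Let P_1, …, P_n be distinct points of P^d with n ≤ d+1 whose homogeneous coordinate vectors are linearly independent in K^{d+1} (i.e., n general points of P^d), and let I ⊆ K[x_0, …, x_d] be their radical ideal. Then for every integer r ≥ 1: (a) I^{(rd)} ⊆ M^{r(d−1)} I^r, and (b) I^{(rd−(d−1))} ⊆ M^{(r−1)(d−1)} I^r. -/
open MvPolynomial

noncomputable section

section MonomialMembership

variable {R ι κ : Type*} [CommRing R] [Fintype ι] [Fintype κ]

theorem finsupp_prod_mem_pow_degree {τ : Type*} {M : Ideal R} {ℓ : τ → R}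
    (hM : ∀ j, ℓ j ∈ M) (a : τ →₀ ℕ) : (a.prod fun j e => ℓ j ^ e) ∈ M ^ a.degree := by
  rw [Finsupp.degree_apply, ← Finset.prod_pow_eq_pow_sum]
  exact Ideal.prod_mem_prod fun j _ => Ideal.pow_mem_pow (hM j) _

theorem degree_eq_sum_inl_add_sum_inr (a : ι ⊕ κ →₀ ℕ) :
    a.degree = ∑ i, a (Sum.inl i) + ∑ k, a (Sum.inr k) := by
  rw [Finsupp.degree_eq_sum, Fintype.sum_sum_type]

/-- If every coordinate leaves at least `s` of a total of at least `2 * s`, two distinct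
coordinates can be lowered by one so that every coordinate still leaves at least `s - 1`. -/
theorem exists_ne_of_add_le_sum {b : ι → ℕ} {s : ℕ} (hs : 0 < s)
    (hb : ∀ i, s + b i ≤ ∑ j, b j) (hsum : 2 * s ≤ ∑ j, b j) :
    ∃ i k, i ≠ k ∧ 0 < b i ∧ 0 < b k ∧
      ∀ l, l ≠ i → l ≠ k → s + b l < ∑ j, b j := by
  classical
  have hne : (Finset.univ : Finset ι).Nonempty := by
    by_contra h
    rw [Finset.not_nonempty_iff_eq_empty] at h
    rw [h, Finset.sum_empty] at hsum
    omega
  obtain ⟨i, -, hi⟩ := Finset.exists_max_image Finset.univ b hne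
  have hsplit := Finset.add_sum_erase Finset.univ b (Finset.mem_univ i)
  have hne' : (Finset.univ.erase i).Nonempty := by
    by_contra h
    rw [Finset.not_nonempty_iff_eq_empty] at h
    rw [h, Finset.sum_empty] at hsplit
    have := hb i
    omega
  obtain ⟨k, hk, hkmax⟩ := Finset.exists_max_image (Finset.univ.erase i) b hne'
  have hki : k ≠ i := Finset.ne_of_mem_erase hk
  have hkpos : 0 < b k := by
    by_contra h
    have : ∑ j ∈ Finset.univ.erase i, b j = 0 :=
      Finset.sum_eq_zero fun j hj => by have := hkmax j hj; omega
    have := hb i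
    omega
  refine ⟨i, k, hki.symm, hkpos.trans_le (hi k (Finset.mem_univ k)), hkpos, fun l hli hlk => ?_⟩
  have h1 : b l ≤ b k := hkmax l (Finset.mem_erase.2 ⟨hli, Finset.mem_univ l⟩)
  have h2 := hi k (Finset.mem_univ k)
  have h3 : ∑ j ∈ {l, i, k}, b j ≤ ∑ j, b j := Finset.sum_le_sum_of_subset (Finset.subset_univ _)
  rw [Finset.sum_insert (by simp [hli, hlk]), Finset.sum_pair hki.symm] at h3
  have := hb l
  omega

theorem finsupp_prod_mem_pow_mul_pow {M I : Ideal R} {ℓ : ι ⊕ κ → R} (hM : ∀ j, ℓ j ∈ M)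
    (hI : ∀ k, ℓ (Sum.inr k) ∈ I)
    (hI' : ∀ i k, i ≠ k → ℓ (Sum.inl i) * ℓ (Sum.inl k) ∈ I) (q r : ℕ) (a : ι ⊕ κ →₀ ℕ)
    (ha : ∀ i, r + a (Sum.inl i) ≤ a.degree) (hdeg : q + r ≤ a.degree)
    (hdeg' : q + 2 * r ≤ a.degree + ∑ k, a (Sum.inr k)) :
    (a.prod fun j e => ℓ j ^ e) ∈ M ^ q * I ^ r := by
  classical
  induction r generalizing a with
  | zero =>
    rw [pow_zero, mul_one]
    exact Ideal.pow_le_pow_right (by omega) (finsupp_prod_mem_pow_degree hM a)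
  | succ r ih =>
    have prod_add : ∀ b c : ι ⊕ κ →₀ ℕ, ((b + c).prod fun j e => ℓ j ^ e) =
        (b.prod fun j e => ℓ j ^ e) * c.prod fun j e => ℓ j ^ e := fun b c =>
      Finsupp.prod_add_index' (fun _ => pow_zero _) fun _ _ _ => pow_add _ _ _
    have prod_single : ∀ j, ((Finsupp.single j 1 : ι ⊕ κ →₀ ℕ).prod fun j e => ℓ j ^ e) = ℓ j :=
      fun j => by simp [Finsupp.prod_single_index]
    by_cases hL : ∃ k, 0 < a (Sum.inr k)
    · obtain ⟨k, hk⟩ := hL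
      obtain ⟨b, rfl⟩ : ∃ b, a = b + Finsupp.single (Sum.inr k) 1 :=
        ⟨a - Finsupp.single (Sum.inr k) 1,
          (tsub_add_cancel_of_le (Finsupp.single_le_iff.2 hk)).symm⟩
      have hsum : ∑ l, (b + Finsupp.single (Sum.inr k) 1 : ι ⊕ κ →₀ ℕ) (Sum.inr l) =
          ∑ l, b (Sum.inr l) + 1 := by
        simp [Finset.sum_add_distrib, Finsupp.single_apply]
      rw [hsum] at hdeg'
      simp only [map_add, Finsupp.degree_single] at ha hdeg hdeg'
      rw [prod_add, prod_single, pow_succ I, ← mul_assoc]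
      refine Ideal.mul_mem_mul (ih b (fun i => ?_) (by omega) (by omega)) (hI k)
      have := ha i
      simp at this
      omega
    · have hzero : ∑ k, a (Sum.inr k) = 0 :=
        Finset.sum_eq_zero fun k _ => by simpa using fun h => hL ⟨k, Nat.pos_of_ne_zero h⟩
      have hsplit := degree_eq_sum_inl_add_sum_inr a
      obtain ⟨i, k, hik, hi, hk, hl⟩ := exists_ne_of_add_le_sum (b := fun i => a (Sum.inl i))
        r.succ_pos (fun i => by have := ha i; omega) (by omega)
      have hle : Finsupp.single (Sum.inl i) 1 + Finsupp.single (Sum.inl k) 1 ≤ a := by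
        intro j
        rcases j with j | j
        · by_cases h : i = j
          · subst h
            simpa [Finsupp.single_apply, hik.symm] using Nat.succ_le_of_lt hi
          · by_cases h' : k = j
            · subst h'
              simpa [Finsupp.single_apply, h] using Nat.succ_le_of_lt hk
            · simp [h, h']
        · simp
      obtain ⟨b, rfl⟩ : ∃ b, a = b + (Finsupp.single (Sum.inl i) 1 + Finsupp.single (Sum.inl k) 1) :=
        ⟨_, (tsub_add_cancel_of_le hle).symm⟩
      have hb : ∑ l, b (Sum.inr l) = 0 := by simpa using hzero
      rw [← Nat.add_zero (∑ i, _), ← hzero, ← hsplit] at hl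
      simp only [map_add, Finsupp.degree_single] at ha hdeg hdeg' hl
      rw [prod_add, prod_add (Finsupp.single _ _), prod_single, prod_single, pow_succ I, ← mul_assoc]
      refine Ideal.mul_mem_mul (ih b (fun l => ?_) (by omega) (by omega)) (hI' i k hik)
      have h1 := ha l
      have h2 := hl l
      simp only [Finsupp.add_apply, Finsupp.single_apply, Sum.inl.injEq] at h1 h2
      by_cases h : i = l
      · simp only [h, if_true] at h1
        omega
      · by_cases h' : k = l
        · simp only [h', if_true] at h1
          omega
        · have := h2 (Ne.symm h) (Ne.symm h')
          simp only [h, h', if_false] at this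
          omega

end MonomialMembership

section CoordinatePoint

variable {K τ : Type*} [Field K]

/-- The ideal spanned by the monomials of degree at least `m` in the variables other
than `X i`. -/
def monomialIdealAway (K : Type*) [Field K] (i : τ) (m : ℕ) : Ideal (MvPolynomial τ K) :=
  Ideal.span ((fun a => monomial a (1 : K)) '' {a : τ →₀ ℕ | m + a i ≤ a.degree})

theorem mem_monomialIdealAway {i : τ} {m : ℕ} {F : MvPolynomial τ K} :
    F ∈ monomialIdealAway K i m ↔ ∀ a ∈ F.support, m + a i ≤ a.degree := by
  rw [monomialIdealAway, mem_ideal_span_monomial_image]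
  refine forall₂_congr fun a _ => ⟨?_, fun h => ⟨a, h, le_rfl⟩⟩
  rintro ⟨b, hb, hba⟩
  obtain ⟨c, rfl⟩ := exists_add_of_le hba
  have hc := Finsupp.le_degree i c
  simp only [Set.mem_ofPred_eq] at hb
  simp only [map_add, Finsupp.add_apply]
  omega

theorem monomialIdealAway_one_pow_le (i : τ) (m : ℕ) :
    monomialIdealAway K i 1 ^ m ≤ monomialIdealAway K i m := by
  induction m with
  | zero =>
    intro F _
    rw [mem_monomialIdealAway]
    intro a _
    simpa using Finsupp.le_degree i a
  | succ m ih =>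
    rw [pow_succ]
    refine (Ideal.mul_mono_left ih).trans ?_
    rw [monomialIdealAway, monomialIdealAway, monomialIdealAway, Ideal.span_mul_span', Ideal.span_le]
    rintro _ ⟨_, ⟨a, ha, rfl⟩, _, ⟨b, hb, rfl⟩, rfl⟩
    refine Ideal.subset_span ⟨a + b, ?_, by simp [monomial_mul]⟩
    simp only [Set.mem_ofPred_eq, map_add, Finsupp.add_apply] at *
    omega

theorem MvPolynomial.IsHomogeneous.mem_monomialIdealAway_one [Finite τ] [DecidableEq τ] {i : τ}
    {e : ℕ} {F : MvPolynomial τ K} (hF : F.IsHomogeneous e) (h0 : eval (Pi.single i 1) F = 0) :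
    F ∈ monomialIdealAway K i 1 := by
  have := Fintype.ofFinite τ
  have eq_single : ∀ a ∈ F.support, a.degree = a i → a = Finsupp.single i e := by
    intro a ha h
    have hdeg : a.degree = e := by
      rw [← hF (mem_support_iff.1 ha), Finsupp.degree_eq_weight_one]
      rfl
    have hs := Finset.add_sum_erase Finset.univ a (Finset.mem_univ i)
    rw [← Finsupp.degree_eq_sum, h] at hs
    ext j
    by_cases hj : j = i
    · subst hj
      simp; omega
    · have := Finset.sum_eq_zero_iff.1 (show ∑ x ∈ Finset.univ.erase i, a x = 0 by omega) j
        (Finset.mem_erase.2 ⟨hj, Finset.mem_univ j⟩)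
      simpa [Finsupp.single_apply, Ne.symm hj] using this
  rw [mem_monomialIdealAway]
  intro a ha
  by_contra hlt
  have hle := Finsupp.le_degree i a
  have heq := eq_single a ha (by omega)
  subst heq
  rw [eval_eq', Finset.sum_eq_single_of_mem _ ha] at h0
  · refine mem_support_iff.1 ha ?_
    rw [Finset.prod_eq_one, mul_one] at h0
    · exact h0
    · intro j _
      by_cases hj : j = i
      · subst hj; simp
      · simp [Ne.symm hj]
  · intro b hb hne
    have hle := Finsupp.le_degree i b
    obtain ⟨j, hji, hj⟩ : ∃ j, j ≠ i ∧ b j ≠ 0 := by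
      by_contra! h
      refine hne (eq_single b hb ?_)
      rw [Finsupp.degree_eq_sum]
      exact Finset.sum_eq_single_of_mem i (Finset.mem_univ i) fun j _ hj => h j hj
    rw [Finset.prod_eq_zero (Finset.mem_univ j), mul_zero]
    simp [hji, hj]

end CoordinatePoint

section ChangeOfCoordinates

variable {K σ τ : Type*} [Field K]

/-- The polynomial in coordinates with respect to `v` of a polynomial in standard coordinates. -/
def toBasisCoords [Fintype τ] (v : τ → σ → K) : MvPolynomial σ K →ₐ[K] MvPolynomial τ K :=
  aeval fun k => ∑ j, C (v j k) * X j

/-- The `j`-th coordinate function with respect to `v`, as a linear form. -/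
def coordForm [Fintype σ] [DecidableEq σ] (v : Module.Basis τ K (σ → K)) (j : τ) : MvPolynomial σ K :=
  ∑ k, C (v.coord j (Pi.single k 1)) * X k

theorem isHomogeneous_sum_C_mul_X [Fintype τ] (c : τ → K) :
    (∑ j, C (c j) * X j : MvPolynomial τ K).IsHomogeneous 1 :=
  IsHomogeneous.sum _ _ _ fun j _ => by
    simpa using (isHomogeneous_C τ (c j)).mul (isHomogeneous_X K j)

theorem eval_coordForm [Fintype σ] [DecidableEq σ] (v : Module.Basis τ K (σ → K)) (j : τ) (p : σ → K) :
    eval p (coordForm v j) = v.coord j p := by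
  conv_rhs => rw [pi_eq_sum_univ' p]
  simp [coordForm, mul_comm]

theorem coordForm_mem_irrel [Fintype σ] [DecidableEq σ] (v : Module.Basis τ K (σ → K)) (j : τ) :
    coordForm v j ∈ irrel K σ :=
  sum_mem fun k _ => Ideal.mul_mem_left _ _ (Ideal.subset_span ⟨k, rfl⟩)

theorem coordForm_mem_homVanishingIdeal [Fintype σ] [DecidableEq σ] (v : Module.Basis τ K (σ → K)) {i j : τ}
    (hij : i ≠ j) : coordForm v j ∈ homVanishingIdeal (v i) := by
  refine Ideal.subset_span ⟨⟨1, isHomogeneous_sum_C_mul_X _⟩, ?_⟩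
  rw [eval_coordForm, Module.Basis.coord_apply, v.repr_self, Finsupp.single_eq_of_ne hij.symm]

theorem aeval_coordForm_toBasisCoords [Fintype σ] [Fintype τ] [DecidableEq σ]
    (v : Module.Basis τ K (σ → K)) (F : MvPolynomial σ K) : aeval (coordForm v) (toBasisCoords v F) = F := by
  suffices h : (aeval (coordForm v)).comp (toBasisCoords v) = AlgHom.id K _ from
    DFunLike.congr_fun h F
  ext1 k
  have hv : ∀ l, ∑ j, v j k * v.coord j (Pi.single l 1) = (Pi.single l 1 : σ → K) k := by
    intro l
    conv_rhs => rw [← v.sum_repr (Pi.single l 1)]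
    simp [Finset.sum_apply, mul_comm]
  simp only [toBasisCoords, coordForm, AlgHom.comp_apply, aeval_X, map_sum, map_mul, algHom_C,
    AlgHom.id_apply, Finset.mul_sum, algebraMap_eq, ← mul_assoc]
  rw [Finset.sum_comm]
  simp_rw [← C_mul]
  simp_rw [← Finset.sum_mul, ← map_sum, hv]
  simp [Pi.single_apply]

theorem toBasisCoords_mem_monomialIdealAway [Fintype τ] (v : τ → σ → K) {i : τ}
    {m : ℕ} {F : MvPolynomial σ K} (hF : F ∈ homVanishingIdeal (v i) ^ m) :
    toBasisCoords v F ∈ monomialIdealAway K i m := by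
  classical
  refine monomialIdealAway_one_pow_le i m ?_
  refine Ideal.pow_right_mono (?_ : Ideal.map (toBasisCoords v) (homVanishingIdeal (v i)) ≤ _) m ?_
  · rw [homVanishingIdeal, Ideal.map_span, Ideal.span_le]
    rintro _ ⟨G, ⟨⟨e, hG⟩, hG0⟩, rfl⟩
    refine IsHomogeneous.mem_monomialIdealAway_one (e := 1 * e)
      (hG.aeval _ fun k => isHomogeneous_sum_C_mul_X _) ?_
    have h : ((aeval (Pi.single i 1)).comp (toBasisCoords v)) = aeval (R := K) (v i) := by
      ext1 k
      simp [toBasisCoords, Pi.single_apply]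
    have h' := DFunLike.congr_fun h G
    simp only [AlgHom.comp_apply, aeval_eq_eval] at h'
    exact h'.trans hG0
  · rw [← Ideal.map_pow]
    exact Ideal.mem_map_of_mem _ hF

end ChangeOfCoordinates

theorem symbPow_le_pow_mul_pow {K σ ι : Type*} [Field K] [Fintype σ] [Fintype ι]
    {P : ι → σ → K} (hli : LinearIndependent K P) {m q r : ℕ}
    (hmr : r ≤ m)
    (hm : ∀ (D L : ℕ) (b : ι → ℕ), D = ∑ i, b i + L → (∀ i, m + b i ≤ D) →
      q + r ≤ D ∧ q + 2 * r ≤ D + L) :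
    symbPow P m ≤ irrel K σ ^ q * symbPow P 1 ^ r := by
  classical
  let v := Module.Basis.sumExtend hli
  have : Finite (ι ⊕ Module.Basis.sumExtendIndex hli) := Module.Finite.finite_basis v
  have : Finite (Module.Basis.sumExtendIndex hli) := Finite.sum_right ι
  have := Fintype.ofFinite (Module.Basis.sumExtendIndex hli)
  have hv : ∀ i, v (Sum.inl i) = P i := fun i => by
    simp only [v, Module.Basis.sumExtend, Module.Basis.reindex_apply,
      Module.Basis.extend_apply_self]
    rfl
  intro F hF
  rw [symbPow, Ideal.mem_iInf] at hF
  rw [← aeval_coordForm_toBasisCoords v F, aeval_def, eval₂_eq]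
  refine sum_mem fun a ha => Ideal.mul_mem_left _ _ ?_
  have hai : ∀ i, m + a (Sum.inl i) ≤ a.degree := fun i =>
    mem_monomialIdealAway.1 (toBasisCoords_mem_monomialIdealAway v (by rw [hv]; exact hF i)) a ha
  have hb := hm a.degree _ (fun i => a (Sum.inl i)) (degree_eq_sum_inl_add_sum_inr a) hai
  refine finsupp_prod_mem_pow_mul_pow (coordForm_mem_irrel v) (fun k => ?_) (fun i k hik => ?_)
    q r a (fun i => by have := hai i; omega) hb.1 hb.2
  · simp only [symbPow, pow_one, Ideal.mem_iInf]
    intro i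
    rw [← hv]
    exact coordForm_mem_homVanishingIdeal v (by simp)
  · simp only [symbPow, pow_one, Ideal.mem_iInf]
    intro l
    rw [← hv]
    by_cases h : l = i
    · exact Ideal.mul_mem_left _ _ (coordForm_mem_homVanishingIdeal v (by simpa [h] using hik))
    · exact Ideal.mul_mem_right _ _ (coordForm_mem_homVanishingIdeal v (by simpa using h))

theorem succ_mul_le_of_add_le {d n m D L : ℕ} (hn : 1 ≤ n) (hnd : n ≤ d + 1) {b : Fin n → ℕ}
    (hD : D = ∑ i, b i + L) (hb : ∀ i, m + b i ≤ D) : m ≤ D ∧ (d + 1) * m ≤ d * D + L := by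
  have hmD : m ≤ D := (Nat.le_add_right m _).trans (hb ⟨0, hn⟩)
  refine ⟨hmD, ?_⟩
  have hsum := Finset.sum_le_sum fun i (_ : i ∈ Finset.univ) => hb i
  simp only [Finset.sum_add_distrib, Finset.sum_const, Finset.card_univ, Fintype.card_fin,
    smul_eq_mul] at hsum
  obtain ⟨c, hc⟩ := exists_add_of_le hnd
  rw [hc]
  have hcm := Nat.mul_le_mul_left c hmD
  have : (d + 1) * D = n * D + c * D := by rw [hc, add_mul]
  linarith

/-- Char 0.  For the radical ideal `I` of `n ≤ d+1` points of `P^d` whose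
coordinate vectors are linearly independent (i.e. `n` general points of `P^d`):
(a) `I^{(rd)} ⊆ M^{r(d-1)} I^r` and (b) `I^{(rd-(d-1))} ⊆ M^{(r-1)(d-1)} I^r`
for all `r ≥ 1`. -/
theorem stmt17 {K : Type*} [Field K] [IsAlgClosed K] [CharZero K]
    {d n : ℕ} (hd : 1 ≤ d) (hn : 1 ≤ n) (hnd : n ≤ d + 1)
    (P : Fin n → (Fin (d + 1) → K)) (hli : LinearIndependent K P)
    (r : ℕ) (hr : 1 ≤ r) :
    symbPow P (r * d) ≤ irrel K (Fin (d + 1)) ^ (r * (d - 1)) * symbPow P 1 ^ r ∧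
    symbPow P (r * d - (d - 1)) ≤
      irrel K (Fin (d + 1)) ^ ((r - 1) * (d - 1)) * symbPow P 1 ^ r := by
  obtain ⟨e, rfl⟩ := Nat.exists_eq_add_of_le' hd
  obtain ⟨s, rfl⟩ := Nat.exists_eq_add_of_le' hr
  have hm : (s + 1) * (e + 1) - (e + 1 - 1) = s * (e + 1) + 1 := by
    rw [add_mul]
    omega
  rw [hm]
  simp only [Nat.add_sub_cancel]
  constructor
  · refine symbPow_le_pow_mul_pow hli (Nat.le_mul_of_pos_right _ e.succ_pos)
      fun D L b hD hb => ?_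
    obtain ⟨h1, h2⟩ := succ_mul_le_of_add_le hn hnd hD hb
    refine ⟨by linarith, Nat.le_of_mul_le_mul_left (?_ : (e + 1) * _ ≤ (e + 1) * _) e.succ_pos⟩
    nlinarith [Nat.zero_le (e * L)]
  · refine symbPow_le_pow_mul_pow hli (by nlinarith [Nat.zero_le (s * e)]) fun D L b hD hb => ?_
    obtain ⟨h1, h2⟩ := succ_mul_le_of_add_le hn hnd hD hb
    refine ⟨by linarith, ?_⟩
    by_contra! h
    have h3 : D + L ≤ s * e + 2 * s + 1 := by omega
    have h4 := Nat.mul_le_mul_left (e + 1) h3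
    nlinarith [Nat.zero_le (e * L)]
end
end
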